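/- arXiv:2203.16390 — 4 statements merged into one kernel-verified Lean document; each statement's English description precedes it below -/
import Mathlib

section
/- If G is a finite simple graph with mad(G) < 12/5 that contains no induced cycle on 5 vertices, then G has a proper conflict-free 4-coloring, i.e., χ_pcf(G) ≤ 4. -/
open SimpleGraph

/-- A proper conflict-free coloring with colors in `Fin c`. -/
def IsPCFColoring {V : Type*} {c : ℕ} (G : SimpleGraph V) (f : V → Fin c) : Prop :=
  (∀ ⦃u v : V⦄, G.Adj u v → f u ≠ f v) ∧
  ∀ v : V, (∃ u, G.Adj v u) →
    ∃ u, G.Adj v u ∧ ∀ w, G.Adj v w → f w = f u → w = u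

/-- `mad(G) ≤ q` : every nonempty subgraph has average degree at most `q`. -/
def MadLE {V : Type*} (G : SimpleGraph V) (q : ℚ) : Prop :=
  ∀ H : G.Subgraph, H.verts.Nonempty →
    (2 * H.edgeSet.ncard : ℚ) ≤ q * H.verts.ncard

def MadLT {V : Type*} (G : SimpleGraph V) (q : ℚ) : Prop :=
  ∀ H : G.Subgraph, H.verts.Nonempty →
    (2 * H.edgeSet.ncard : ℚ) < q * H.verts.ncard

/-- `G` contains a copy of `H` as a (not necessarily induced) subgraph. -/
def ContainsSubgraph {V W : Type*} (G : SimpleGraph V) (H : SimpleGraph W) : Prop :=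
  ∃ f : W → V, Function.Injective f ∧ ∀ ⦃a b : W⦄, H.Adj a b → G.Adj (f a) (f b)

/-- The 1-subdivision of a graph: subdivide every edge exactly once. -/
def Subdiv {V : Type*} (G : SimpleGraph V) : SimpleGraph (V ⊕ G.edgeSet) :=
  SimpleGraph.fromRel (fun a b =>
    match a, b with
    | Sum.inl v, Sum.inr e => v ∈ (e : Sym2 V)
    | _, _ => False)

/-- `K*_n`, the 1-subdivision of the complete graph on `n` vertices. -/
def KStarGraph (n : ℕ) : SimpleGraph (Fin n ⊕ (completeGraph (Fin n)).edgeSet) :=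
  Subdiv (completeGraph (Fin n))

/-- `G` is `c`-PCF-critical: `G` has no PCF `c`-coloring, but every proper
subgraph of `G` has one. -/
def PCFCritical {V : Type*} (G : SimpleGraph V) (c : ℕ) : Prop :=
  (¬ ∃ f : V → Fin c, IsPCFColoring G f) ∧
  ∀ H : G.Subgraph, H ≠ ⊤ → ∃ f : H.verts → Fin c, IsPCFColoring H.coe f

/-- `n_d(v)`: the number of neighbors of `v` having degree exactly `d`. -/
noncomputable def nDeg {V : Type*} [Fintype V] (G : SimpleGraph V) [DecidableRel G.Adj]
    (v : V) (d : ℕ) : ℕ :=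
  {u | G.Adj v u ∧ G.degree u = d}.ncard

/-- `n_{d+}(v)`: the number of neighbors of `v` having degree at least `d`. -/
noncomputable def nDegGE {V : Type*} [Fintype V] (G : SimpleGraph V) [DecidableRel G.Adj]
    (v : V) (d : ℕ) : ℕ :=
  {u | G.Adj v u ∧ d ≤ G.degree u}.ncard

section Extension

variable {V : Type*} {G : SimpleGraph V}

/-- A proper conflict-free coloring of the subgraph induced on `A`. -/
def PCFOn (G : SimpleGraph V) (A : Set V) (f : V → Fin 4) : Prop :=
  (∀ u ∈ A, ∀ v ∈ A, G.Adj u v → f u ≠ f v) ∧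
  ∀ v ∈ A, (∃ u ∈ A, G.Adj v u) →
    ∃ u ∈ A, G.Adj v u ∧ ∀ w ∈ A, G.Adj v w → f w = f u → w = u

/-- `f` is a proper coloring of the subgraph induced on `A`, and `c v` is a color appearing
exactly once in the neighborhood of `v`, for all `v ∈ A` outside the exempt set `E`. -/
structure PartialColoring (G : SimpleGraph V) (A E : Set V) (f c : V → Fin 4) : Prop where
  proper : ∀ u ∈ A, ∀ v ∈ A, G.Adj u v → f u ≠ f v
  unique : ∀ v ∈ A, v ∉ E →
    ∃ u ∈ A, G.Adj v u ∧ f u = c v ∧ ∀ w ∈ A, G.Adj v w → f w = c v → w = u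

namespace PartialColoring

variable {A E : Set V} {f c : V → Fin 4}

theorem c_ne (h : PartialColoring G A E f c) {v : V} (hv : v ∈ A) (hE : v ∉ E) : f v ≠ c v := by
  obtain ⟨u, hu, huv, huc, -⟩ := h.unique v hv hE
  rw [← huc]
  exact h.proper v hv u hu huv

open Classical in
theorem insert (h : PartialColoring G A E f c) {x : V} {a : Fin 4} (hx : x ∉ A)
    (ha : ∀ v ∈ A, G.Adj v x → f v ≠ a ∧ (v ∉ E → c v ≠ a)) :
    PartialColoring G (insert x A) (insert x E) (Function.update f x a) c := by
  have hne : ∀ v ∈ A, v ≠ x := fun v hv e => hx (e ▸ hv)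
  constructor
  · rintro u (rfl | hu) v (rfl | hv) huv
    · exact absurd huv (G.irrefl)
    · rw [Function.update_self, Function.update_of_ne (hne v hv)]
      exact (ha v hv huv.symm).1.symm
    · rw [Function.update_self, Function.update_of_ne (hne u hu)]
      exact (ha u hu huv).1
    · rw [Function.update_of_ne (hne u hu), Function.update_of_ne (hne v hv)]
      exact h.proper u hu v hv huv
  · rintro v (rfl | hv) hE
    · exact absurd (Set.mem_insert _ _) hE
    · have hE' : v ∉ E := fun h' => hE (Set.mem_insert_of_mem _ h')
      obtain ⟨u, hu, huv, huc, huniq⟩ := h.unique v hv hE'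
      refine ⟨u, Set.mem_insert_of_mem _ hu, huv, ?_, ?_⟩
      · rwa [Function.update_of_ne (hne u hu)]
      · rintro w (rfl | hw) hvw hw'
        · rw [Function.update_self] at hw'
          exact absurd hw'.symm ((ha v hv hvw).2 hE')
        · rw [Function.update_of_ne (hne w hw)] at hw'
          exact huniq w hw hvw hw'

open Classical in
theorem setUnique (h : PartialColoring G A E f c) {v u : V} (hu : u ∈ A) (hvu : G.Adj v u)
    (huniq : ∀ w ∈ A, G.Adj v w → f w = f u → w = u) :
    PartialColoring G A (E \ {v}) f (Function.update c v (f u)) := by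
  refine ⟨h.proper, fun z hz hE => ?_⟩
  by_cases hzv : z = v
  · subst hzv
    refine ⟨u, hu, hvu, by simp, by simpa using huniq⟩
  · rw [Function.update_of_ne hzv]
    exact h.unique z hz fun h' => hE ⟨h', hzv⟩

theorem isPCFColoring (h : PartialColoring G Set.univ ∅ f c) : IsPCFColoring G f := by
  refine ⟨fun u v huv => h.proper u trivial v trivial huv, fun v _ => ?_⟩
  obtain ⟨u, -, hvu, huc, huniq⟩ := h.unique v trivial (by simp)
  exact ⟨u, hvu, fun w hw hw' => huniq w trivial hw (hw'.trans huc)⟩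

end PartialColoring

theorem PCFOn.exists_partialColoring {A : Set V} {f : V → Fin 4} (h : PCFOn G A f)
    (hA : ∀ v ∈ A, ∃ u ∈ A, G.Adj v u) : ∃ c, PartialColoring G A ∅ f c := by
  have : ∀ v, ∃ a : Fin 4, v ∈ A →
      ∃ u ∈ A, G.Adj v u ∧ f u = a ∧ ∀ w ∈ A, G.Adj v w → f w = a → w = u := by
    intro v
    by_cases hv : v ∈ A
    · obtain ⟨u, hu, hvu, huniq⟩ := h.2 v hv (hA v hv)
      exact ⟨f u, fun _ => ⟨u, hu, hvu, rfl, huniq⟩⟩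
    · exact ⟨0, fun h' => absurd h' hv⟩
  choose c hc using this
  exact ⟨c, h.1, fun v hv _ => hc v hv⟩

/-- Relative to a coloring `(f₀, c₀)` of `A₀`, the set `B`, attached to `u` through its
neighbor `x`, can be colored so that `x` gets any color `ξ` with `R a ξ`, where `a` is the
color of `u`. -/
structure Branch (G : SimpleGraph V) (A₀ : Set V) (f₀ c₀ : V → Fin 4) (u x : V) (B : Set V)
    (R : Fin 4 → Fin 4 → Prop) : Prop where
  near : x ∈ B ∨ x ∈ A₀ ∧ ∀ a ξ, R a ξ → a ≠ f₀ x ∧ a ≠ c₀ x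
  ext : ∀ (A E : Set V) (f c : V → Fin 4), A₀ ⊆ A → Disjoint A B → Disjoint E A₀ → u ∈ A → u ∈ E →
    (∀ v ∈ A₀, f v = f₀ v ∧ c v = c₀ v) → PartialColoring G A E f c → ∀ ξ, R (f u) ξ →
    ∃ f' c', PartialColoring G (A ∪ B) E f' c' ∧ (∀ v ∈ A, f' v = f v ∧ c' v = c v) ∧ f' x = ξ

/-- Some color appears exactly once among the elements of `N`. -/
def Happy (N : Finset V) (ξ : V → Fin 4) : Prop :=
  ∃ x ∈ N, ∀ y ∈ N, ξ y = ξ x → y = x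

section Hub

variable {A₀ : Set V} {f₀ c₀ : V → Fin 4} {B : V → Set V} {R : V → Fin 4 → Fin 4 → Prop}

theorem Branch.mono {u x : V} {B : Set V} {R R' : Fin 4 → Fin 4 → Prop}
    (h : Branch G A₀ f₀ c₀ u x B R) (hR : ∀ a ξ, R' a ξ → R a ξ) :
    Branch G A₀ f₀ c₀ u x B R' where
  near := h.near.imp_right fun h' => ⟨h'.1, fun a ξ hr => h'.2 a ξ (hR a ξ hr)⟩
  ext A E f c h1 h2 h3 h4 h5 h6 h7 ξ hξ := h.ext A E f c h1 h2 h3 h4 h5 h6 h7 ξ (hR _ _ hξ)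

theorem attach_branches (u : V) (P : Finset V)
    (hB : ∀ p ∈ P, Branch G A₀ f₀ c₀ u p (B p) (R p))
    (hdis : ∀ p ∈ P, ∀ q ∈ P, p ≠ q → Disjoint (B p) (B q))
    {A E : Set V} {f c : V → Fin 4} (hA : A₀ ⊆ A) (hAB : ∀ p ∈ P, Disjoint A (B p))
    (hE : Disjoint E A₀) (huA : u ∈ A) (huE : u ∈ E)
    (hf : ∀ v ∈ A₀, f v = f₀ v ∧ c v = c₀ v) (h : PartialColoring G A E f c)
    (ξ : V → Fin 4) (hξ : ∀ p ∈ P, R p (f u) (ξ p)) :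
    ∃ f' c', PartialColoring G (A ∪ ⋃ p ∈ P, B p) E f' c' ∧
      (∀ v ∈ A, f' v = f v ∧ c' v = c v) ∧ ∀ p ∈ P, f' p = ξ p := by
  classical
  induction P using Finset.induction_on with
  | empty => exact ⟨f, c, by simpa using h, by simp, by simp⟩
  | insert p P hp ih =>
    obtain ⟨f', c', h', hagree, hcol⟩ := ih (fun q hq => hB q (by simp [hq]))
      (fun q hq r hr => hdis q (by simp [hq]) r (by simp [hr]))
      (fun q hq => hAB q (by simp [hq])) (fun q hq => hξ q (by simp [hq]))
    have hdisj : Disjoint (A ∪ ⋃ q ∈ P, B q) (B p) := by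
      rw [Set.disjoint_union_left]
      refine ⟨hAB p (by simp), ?_⟩
      simp only [Set.disjoint_iUnion_left]
      intro q hq
      exact hdis q (by simp [hq]) p (by simp) (by rintro rfl; exact hp hq)
    obtain ⟨f'', c'', h'', hagree', hcol'⟩ := (hB p (by simp)).ext _ E f' c'
      (hA.trans Set.subset_union_left) hdisj hE (Or.inl huA) huE
      (fun v hv => by rw [(hagree v (hA hv)).1, (hagree v (hA hv)).2]; exact hf v hv) h' (ξ p)
      (by rw [(hagree u huA).1]; exact hξ p (by simp))
    refine ⟨f'', c'', ?_, ?_, ?_⟩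
    · rw [Finset.set_biUnion_insert, Set.union_comm (B p), ← Set.union_assoc]
      exact h''
    · intro v hv
      rw [(hagree' v (Or.inl hv)).1, (hagree' v (Or.inl hv)).2]
      exact hagree v hv
    · intro q hq
      rcases Finset.mem_insert.1 hq with rfl | hq
      · exact hcol'
      · rw [(hagree' q ?_).1, hcol q hq]
        rcases (hB q (by simp [hq])).near with hn | hn
        · exact Or.inr (by simp only [Set.mem_iUnion]; exact ⟨q, hq, hn⟩)
        · exact Or.inl (hA hn.1)

theorem insert_hub (u : V) (P : Finset V)
    (hB : ∀ p ∈ P, Branch G A₀ f₀ c₀ u p (B p) (R p))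
    (hdis : ∀ p ∈ P, ∀ q ∈ P, p ≠ q → Disjoint (B p) (B q))
    {A E : Set V} {f c : V → Fin 4} (hA : A₀ ⊆ A) (hAB : ∀ p ∈ P, Disjoint A (B p))
    (huB : ∀ p ∈ P, u ∉ B p) (hE : Disjoint E A₀) (huA : u ∉ A)
    (hf : ∀ v ∈ A₀, f v = f₀ v ∧ c v = c₀ v) (h : PartialColoring G A E f c)
    (a : Fin 4) (ha : ∀ v ∈ A, G.Adj v u → v ∈ P ∨ v ∈ E ∧ f v ≠ a)
    (ξ : V → Fin 4) (hξ : ∀ p ∈ P, R p a (ξ p)) :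
    ∃ f' c', PartialColoring G (A ∪ insert u (⋃ p ∈ P, B p)) (insert u E) f' c' ∧
      (∀ v ∈ A, f' v = f v ∧ c' v = c v) ∧ f' u = a ∧ ∀ p ∈ P, f' p = ξ p := by
  classical
  have hne : ∀ v ∈ A, v ≠ u := fun v hv e => huA (e ▸ hv)
  have h1 := h.insert (x := u) (a := a) huA (by
    intro v hv hvu
    rcases ha v hv hvu with hP | hP
    · rcases (hB v hP).near with hn | hn
      · exact absurd hn (Set.disjoint_left.1 (hAB v hP) hv)
      · have := hn.2 a (ξ v) (hξ v hP)
        rw [(hf v hn.1).1, (hf v hn.1).2]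
        exact ⟨this.1.symm, fun _ => this.2.symm⟩
    · exact ⟨hP.2, fun h' => absurd hP.1 h'⟩)
  obtain ⟨f', c', h', hagree, hcol⟩ := attach_branches u P hB hdis
    (hA.trans (Set.subset_insert u A))
    (fun p hp => by
      rw [Set.disjoint_left]
      rintro v (rfl | hv) hv'
      · exact huB p hp hv'
      · exact Set.disjoint_left.1 (hAB p hp) hv hv')
    (by
      rw [Set.disjoint_left]
      rintro v (rfl | hv) hv'
      · exact huA (hA hv')
      · exact Set.disjoint_left.1 hE hv hv')
    (Set.mem_insert _ _) (Set.mem_insert _ _)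
    (fun v hv => by rw [Function.update_of_ne (hne v (hA hv))]; exact hf v hv) h1 ξ
    (by simpa using hξ)
  refine ⟨f', c', ?_, ?_, ?_, hcol⟩
  · convert h' using 1
    ext v; simp; tauto
  · intro v hv
    have := hagree v (Or.inr hv)
    rwa [Function.update_of_ne (hne v hv)] at this
  · have := (hagree u (Or.inl rfl)).1
    rwa [Function.update_self] at this

/-- If all branches at `u` cover the complement of `A₀`, compatible colors give a coloring. -/
theorem exists_isPCFColoring_of_branches (u : V) (P : Finset V) (hP : ∀ v, G.Adj u v ↔ v ∈ P)
    (hB : ∀ p ∈ P, Branch G A₀ f₀ c₀ u p (B p) (R p))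
    (hdis : ∀ p ∈ P, ∀ q ∈ P, p ≠ q → Disjoint (B p) (B q))
    (hAB : ∀ p ∈ P, Disjoint A₀ (B p)) (huB : ∀ p ∈ P, u ∉ B p) (huA : u ∉ A₀)
    (hcover : ∀ v, v ∈ A₀ ∨ v = u ∨ ∃ p ∈ P, v ∈ B p)
    (h : PartialColoring G A₀ ∅ f₀ c₀) (a : Fin 4)
    (ξ : V → Fin 4) (hξ : ∀ p ∈ P, R p a (ξ p)) (hh : Happy P ξ) :
    ∃ f : V → Fin 4, IsPCFColoring G f := by
  classical
  obtain ⟨f', c', h', -, -, hcol⟩ := insert_hub u P hB hdis subset_rfl hAB huB (by simp) huA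
    (by simp) h a (fun v _ hv => Or.inl ((hP v).1 hv.symm)) ξ hξ
  have huniv : A₀ ∪ insert u (⋃ p ∈ P, B p) = Set.univ := by
    ext v
    have := hcover v
    simp only [Set.mem_union, Set.mem_insert_iff, Set.mem_iUnion, Set.mem_univ, iff_true]
    simpa using this
  rw [huniv] at h'
  obtain ⟨x, hx, hux⟩ := hh
  have h2 := h'.setUnique (v := u) (u := x) trivial ((hP x).2 hx) (by
    intro w _ huw hw
    rw [hP] at huw
    rw [hcol w huw, hcol x hx] at hw
    exact hux w huw hw)
  have : (insert u (∅ : Set V)) \ {u} = ∅ := by ext; simp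
  rw [this] at h2
  exact ⟨f', h2.isPCFColoring⟩

/-- A vertex `x` with parent `u` whose other neighbors carry branches forms a branch at `u`. -/
theorem Branch.hub [DecidableEq V] (u x : V) (P : Finset V)
    (hP : ∀ v, G.Adj x v ↔ v = u ∨ v ∈ P)
    (hB : ∀ p ∈ P, Branch G A₀ f₀ c₀ x p (B p) (R p))
    (hdis : ∀ p ∈ P, ∀ q ∈ P, p ≠ q → Disjoint (B p) (B q)) (hxB : ∀ p ∈ P, x ∉ B p) :
    Branch G A₀ f₀ c₀ u x (insert x (⋃ p ∈ P, B p))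
      (fun a ξ => ξ ≠ a ∧ ∃ η : V → Fin 4, (∀ p ∈ P, R p ξ (η p)) ∧ η u = a ∧
        Happy (insert u P) η) where
  near := Or.inl (Set.mem_insert _ _)
  ext := by
    rintro A E f c hA hdisj hE huA huE hf h ξ ⟨hξa, η, hη, hηu, hh⟩
    have hxA : x ∉ A := fun hx => Set.disjoint_left.1 hdisj hx (Set.mem_insert _ _)
    have hAB : ∀ p ∈ P, Disjoint A (B p) := by
      intro p hp
      refine hdisj.mono_right fun v hv => Or.inr ?_
      simp only [Set.mem_iUnion]
      exact ⟨p, hp, hv⟩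
    obtain ⟨f', c', h', hagree, hx, hcol⟩ := insert_hub x P hB hdis hA hAB hxB hE hxA hf h ξ
      (by
        intro v hv hvx
        rcases (hP v).1 hvx.symm with rfl | hvP
        · exact Or.inr ⟨huE, hξa.symm⟩
        · exact Or.inl hvP) η hη
    have hcol' : ∀ w, G.Adj x w → f' w = η w := by
      intro w hw
      rcases (hP w).1 hw with rfl | hw
      · rw [(hagree w huA).1, hηu]
      · exact hcol w hw
    obtain ⟨q, hq, hquniq⟩ := hh
    have hqadj : G.Adj x q := by rw [hP]; simpa using hq
    have hqmem : q ∈ A ∪ insert x (⋃ p ∈ P, B p) := by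
      rcases Finset.mem_insert.1 hq with rfl | hq
      · exact Or.inl huA
      · rcases (hB q hq).near with hn | hn
        · exact Or.inr (Or.inr (by simp only [Set.mem_iUnion]; exact ⟨q, hq, hn⟩))
        · exact Or.inl (hA hn.1)
    have h2 := h'.setUnique (v := x) hqmem hqadj (by
      intro w _ hxw hw
      rw [hcol' w hxw, hcol' q hqadj] at hw
      exact hquniq w (by rw [hP] at hxw; simpa using hxw) hw)
    refine ⟨f', _, ⟨h2.proper, fun v hv hvE => h2.unique v hv ?_⟩, ?_, hx⟩
    · rintro ⟨rfl | h3, h4⟩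
      · exact h4 rfl
      · exact hvE h3
    · intro v hv
      have hvx : v ≠ x := fun e => hxA (e ▸ hv)
      exact ⟨(hagree v hv).1, by simpa [Function.update, hvx] using (hagree v hv).2⟩

end Hub

end Extension

/-- Colors `(a, ξ)` allowed at the first two vertices of a path with `t` inner vertices ending
at a vertex of color `b` whose unique neighborhood color is `c`. -/
def PathRel : ℕ → Fin 4 → Fin 4 → Fin 4 → Fin 4 → Prop
  | 0, b, c, a, ξ => a ≠ b ∧ a ≠ c ∧ ξ = b
  | t + 1, b, c, a, ξ => ξ ≠ a ∧ ∃ η, η ≠ a ∧ PathRel t b c ξ η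

instance PathRel.decidable : ∀ t b c a ξ, Decidable (PathRel t b c a ξ)
  | 0, b, c, a, ξ => inferInstanceAs (Decidable (a ≠ b ∧ a ≠ c ∧ ξ = b))
  | t + 1, b, c, a, ξ =>
    have : ∀ η, Decidable (PathRel t b c ξ η) := fun η => PathRel.decidable t b c ξ η
    inferInstanceAs (Decidable (ξ ≠ a ∧ ∃ η, η ≠ a ∧ PathRel t b c ξ η))

section Colors

theorem PathRel.exists_of_le_three {t : ℕ} (ht : t ≤ 3) : ∀ b c a : Fin 4, b ≠ c →
    (t ≤ 1 → a ≠ b) → (t = 0 → a ≠ c) → ∃ ξ, PathRel t b c a ξ := by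
  interval_cases t <;> decide

theorem PathRel.three_of_ne : ∀ b c a ξ : Fin 4, b ≠ c → a ≠ c → ξ ≠ a → PathRel 3 b c a ξ := by
  decide

theorem PathRel.two_of_eq_left : ∀ b c ξ : Fin 4, b ≠ c → ξ ≠ b → PathRel 2 b c b ξ := by
  decide

theorem PathRel.two_of_eq_right : ∀ b c ξ : Fin 4, ξ ≠ b → ξ ≠ c → PathRel 2 b c c ξ := by
  decide

/-- A vertex with two pending paths of lengths three and one acts as a path of length two. -/
theorem exists_pathRel_two_of_three_one : ∀ b₁ c₁ b₂ c₂ : Fin 4, b₁ ≠ c₁ → b₂ ≠ c₂ →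
    ∃ β γ, β ≠ γ ∧ ∀ a ξ, PathRel 2 β γ a ξ → ξ ≠ a ∧
      ∃ η₁, PathRel 3 b₁ c₁ ξ η₁ ∧ ∃ η₂, PathRel 1 b₂ c₂ ξ η₂ ∧ ¬ (η₁ = a ∧ η₂ = a) := by
  decide +kernel

/-- A vertex with two pending paths of length two acts as a path of length two. -/
theorem exists_pathRel_two_of_two_two : ∀ b₁ c₁ b₂ c₂ : Fin 4, b₁ ≠ c₁ → b₂ ≠ c₂ →
    ∃ β γ, β ≠ γ ∧ ∀ a ξ, PathRel 2 β γ a ξ → ξ ≠ a ∧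
      ∃ η₁, PathRel 2 b₁ c₁ ξ η₁ ∧ ∃ η₂, PathRel 2 b₂ c₂ ξ η₂ ∧ ¬ (η₁ = a ∧ η₂ = a) := by
  decide +kernel

/-- Paths of lengths three, one and zero at a common vertex fail only for special end data. -/
theorem pathRel_three_one_zero : ∀ b₁ c₁ b₂ c₂ b₃ c₃ : Fin 4, b₁ ≠ c₁ → b₂ ≠ c₂ → b₃ ≠ c₃ →
    (b₂ = b₃ ∨ c₁ = c₃ ∨ c₁ = b₃ ∨ c₂ = b₃) →
    ∃ a ξ₁, PathRel 3 b₁ c₁ a ξ₁ ∧ ∃ ξ₂, PathRel 1 b₂ c₂ a ξ₂ ∧ ∃ ξ₃, PathRel 0 b₃ c₃ a ξ₃ ∧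
      ¬ (ξ₁ = ξ₂ ∧ ξ₁ = ξ₃) := by
  decide +kernel

set_option synthInstance.maxSize 1000 in
/-- Paths of lengths two, two and zero at a common vertex fail only for special end data. -/
theorem pathRel_two_two_zero : ∀ b₁ c₁ b₂ c₂ b₃ c₃ : Fin 4, b₁ ≠ c₁ → b₂ ≠ c₂ → b₃ ≠ c₃ →
    (b₁ = b₃ ∨ b₂ = b₃) →
    ∃ a ξ₁, PathRel 2 b₁ c₁ a ξ₁ ∧ ∃ ξ₂, PathRel 2 b₂ c₂ a ξ₂ ∧ ∃ ξ₃, PathRel 0 b₃ c₃ a ξ₃ ∧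
      ¬ (ξ₁ = ξ₂ ∧ ξ₁ = ξ₃) := by
  decide +kernel

variable {V : Type*}

theorem Happy.of_ne {x y z : V} [DecidableEq V] (hxy : x ≠ y) (hxz : x ≠ z) (hyz : y ≠ z)
    {ξ : V → Fin 4} (h : ¬ (ξ x = ξ y ∧ ξ x = ξ z)) : Happy {x, y, z} ξ := by
  by_cases h1 : ξ x = ξ y
  · refine ⟨z, by simp, ?_⟩
    have h2 : ξ x ≠ ξ z := fun e => h ⟨h1, e⟩
    simp only [Finset.mem_insert, Finset.mem_singleton]
    rintro w (rfl | rfl | rfl) hw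
    · exact absurd hw h2
    · exact absurd hw (h1 ▸ h2)
    · rfl
  · by_cases h2 : ξ x = ξ z
    · refine ⟨y, by simp, ?_⟩
      simp only [Finset.mem_insert, Finset.mem_singleton]
      rintro w (rfl | rfl | rfl) hw
      · exact absurd hw h1
      · rfl
      · exact absurd (h2.trans hw) h1
    · refine ⟨x, by simp, ?_⟩
      simp only [Finset.mem_insert, Finset.mem_singleton]
      rintro w (rfl | rfl | rfl) hw
      · rfl
      · exact absurd hw.symm h1
      · exact absurd hw.symm h2

/-- At most `k` colors at `x` can spoil the neighborhood, when there are at most `2 k`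
other neighbors, up to one more. -/
theorem exists_happy_update [DecidableEq V] {N : Finset V} {x : V} (hx : x ∈ N) (g : V → Fin 4)
    (k : ℕ) (hk : 1 ≤ k) (hN : N.card ≤ 2 * k + 2) :
    ∃ bad : Finset (Fin 4), bad.card ≤ k ∧ ∀ ξ ∉ bad, Happy N (Function.update g x ξ) := by
  by_cases h : ∃ y ∈ N.erase x, ∀ z ∈ N.erase x, g z = g y → z = y
  · obtain ⟨y, hy, hyz⟩ := h
    refine ⟨{g y}, by simpa, fun ξ hξ => ⟨y, Finset.mem_of_mem_erase hy, fun z hz hzy => ?_⟩⟩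
    have hyx := Finset.ne_of_mem_erase hy
    rw [Function.update_of_ne hyx] at hzy
    by_cases hzx : z = x
    · subst hzx
      simp at hzy hξ
      exact absurd hzy hξ
    · rw [Function.update_of_ne hzx] at hzy
      exact hyz z (Finset.mem_erase.2 ⟨hzx, hz⟩) hzy
  · push Not at h
    refine ⟨(N.erase x).image g, ?_, fun ξ hξ => ⟨x, hx, fun z hz hzx => ?_⟩⟩
    · have h2 : 2 * ((N.erase x).image g).card ≤ (N.erase x).card := by
        rw [Finset.card_eq_sum_card_image g (N.erase x), mul_comm, ← smul_eq_mul]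
        refine Finset.card_nsmul_le_sum _ _ _ fun b hb => ?_
        obtain ⟨y, hy, rfl⟩ := Finset.mem_image.1 hb
        obtain ⟨z, hz, hzy, hne⟩ := h y hy
        refine Finset.one_lt_card.2 ⟨z, ?_, y, ?_, hne⟩
        · simp [Finset.mem_filter] at hz ⊢; exact ⟨hz, hzy⟩
        · simp [Finset.mem_filter] at hy ⊢; exact hy
      rw [Finset.card_erase_of_mem hx] at h2
      omega
    · by_contra hne
      rw [Function.update_self, Function.update_of_ne hne] at hzx
      exact hξ (Finset.mem_image.2 ⟨z, Finset.mem_erase.2 ⟨hne, hz⟩, hzx⟩)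

/-- Colors for a hub with neighbors `N`, the path at `x` having length `t x` and end data
`(b x, c x)`. -/
def Solvable (N : Finset V) (t : V → ℕ) (b c : V → Fin 4) : Prop :=
  ∃ (a : Fin 4) (ξ : V → Fin 4), (∀ x ∈ N, PathRel (t x) (b x) (c x) a (ξ x)) ∧ Happy N ξ

variable {N : Finset V} {t : V → ℕ} {b c : V → Fin 4}

theorem solvable_of_free (ht : ∀ x ∈ N, t x ≤ 3) (hbc : ∀ x ∈ N, b x ≠ c x) (a : Fin 4)
    (h1 : ∀ x ∈ N, t x ≤ 1 → a ≠ b x) (h0 : ∀ x ∈ N, t x = 0 → a ≠ c x) {x : V} (hx : x ∈ N)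
    (k : ℕ) (hk : 1 ≤ k) (hN : N.card ≤ 2 * k + 2) (C : Finset (Fin 4)) (hC : k < C.card)
    (hfree : ∀ ξ ∈ C, PathRel (t x) (b x) (c x) a ξ) : Solvable N t b c := by
  classical
  have : ∀ y, ∃ ξ, y ∈ N → PathRel (t y) (b y) (c y) a ξ := by
    intro y
    by_cases hy : y ∈ N
    · obtain ⟨ξ, hξ⟩ := PathRel.exists_of_le_three (ht y hy) _ _ a (hbc y hy) (h1 y hy) (h0 y hy)
      exact ⟨ξ, fun _ => hξ⟩
    · exact ⟨0, fun h => absurd h hy⟩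
  choose g hg using this
  obtain ⟨bad, hbad, hh⟩ := exists_happy_update hx g k hk hN
  obtain ⟨ξ, hξC, hξ⟩ := Finset.exists_mem_notMem_of_card_lt_card (hbad.trans_lt hC)
  refine ⟨a, Function.update g x ξ, fun y hy => ?_, hh ξ hξ⟩
  by_cases hyx : y = x
  · subst hyx; rw [Function.update_self]; exact hfree ξ hξC
  · rw [Function.update_of_ne hyx]; exact hg y hy

/-- A path of length three together with few paths of length at most one. -/
theorem solvable_of_three (ht : ∀ x ∈ N, t x ≤ 3) (hbc : ∀ x ∈ N, b x ≠ c x) {x : V}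
    (hx : x ∈ N) (hx3 : t x = 3) (hN : N.card ≤ 5)
    (hfew : ∑ y ∈ N, (2 - t y) ≤ 2) : Solvable N t b c := by
  classical
  obtain ⟨a, ha⟩ : ∃ a, a ∉ insert (c x) (N.biUnion fun y =>
      if t y = 0 then {b y, c y} else if t y = 1 then {b y} else ∅) := by
    by_contra hcon
    push Not at hcon
    have h4 : (Finset.univ : Finset (Fin 4)).card ≤ 3 := by
      refine (Finset.card_le_card fun a _ => hcon a).trans ((Finset.card_insert_le _ _).trans ?_)
      refine Nat.succ_le_succ ((Finset.card_biUnion_le).trans (le_trans ?_ hfew))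
      refine Finset.sum_le_sum fun y _ => ?_
      split_ifs with h0 h1
      · rw [h0]; exact Finset.card_le_two
      · rw [h1]; simp
      · simp
    simp at h4
  simp only [Finset.mem_insert, Finset.mem_biUnion, not_or, not_exists, not_and] at ha
  refine solvable_of_free ht hbc a (fun y hy hy1 e => ha.2 y hy ?_) (fun y hy hy0 e => ha.2 y hy ?_)
    hx 2 (by norm_num) (by omega) (Finset.univ.erase a) (by simp) (fun ξ hξ => ?_)
  · rcases Nat.le_one_iff_eq_zero_or_eq_one.1 hy1 with h | h <;> simp [h, e]
  · simp [hy0, e]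
  · rw [hx3]
    exact PathRel.three_of_ne _ _ _ _ (hbc x hx) ha.1 (Finset.ne_of_mem_erase hξ)

theorem solvable_of_two {x y : V} (ht : ∀ z ∈ N, t z ≤ 3) (hbc : ∀ z ∈ N, b z ≠ c z)
    (hx : x ∈ N) (hx2 : t x = 2) (hN : N.card ≤ 4) (hy : ∀ z ∈ N, t z ≤ 1 → z = y)
    (hy1 : t y = 1) : Solvable N t b c := by
  by_cases h : b x = b y
  · refine solvable_of_free ht hbc (c x) (fun z hz hz1 => ?_) (fun z hz hz0 => ?_) hx 1 le_rfl
      (by omega) ((Finset.univ.erase (b x)).erase (c x)) ?_ (fun ξ hξ => ?_)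
    · rw [hy z hz hz1, ← h]; exact (hbc x hx).symm
    · rw [hy z hz (by omega)] at hz0; omega
    · rw [Finset.card_erase_of_mem (by simpa using (hbc x hx).symm)]; simp
    · simp only [Finset.mem_erase] at hξ
      rw [hx2]; exact PathRel.two_of_eq_right _ _ _ hξ.2.1 hξ.1
  · refine solvable_of_free ht hbc (b x) (fun z hz hz1 => ?_) (fun z hz hz0 => ?_) hx 1 le_rfl
      (by omega) (Finset.univ.erase (b x)) (by simp) (fun ξ hξ => ?_)
    · rw [hy z hz hz1]; exact h
    · rw [hy z hz (by omega)] at hz0; omega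
    · rw [hx2]; exact PathRel.two_of_eq_left _ _ _ (hbc x hx) (Finset.ne_of_mem_erase hξ)

set_option synthInstance.maxSize 1000 in
theorem pathRel_two_one_one : ∀ b₁ c₁ b₂ c₂ b₃ c₃ : Fin 4, b₁ ≠ c₁ → b₂ ≠ c₂ → b₃ ≠ c₃ →
    ∃ a ξ₁, PathRel 2 b₁ c₁ a ξ₁ ∧ ∃ ξ₂, PathRel 1 b₂ c₂ a ξ₂ ∧ ∃ ξ₃, PathRel 1 b₃ c₃ a ξ₃ ∧
      ¬ (ξ₁ = ξ₂ ∧ ξ₁ = ξ₃) := by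
  decide +kernel

theorem solvable_triple [DecidableEq V] {x y z : V} (hxy : x ≠ y) (hxz : x ≠ z) (hyz : y ≠ z)
    (h : ∃ a ξ₁, PathRel (t x) (b x) (c x) a ξ₁ ∧ ∃ ξ₂, PathRel (t y) (b y) (c y) a ξ₂ ∧
      ∃ ξ₃, PathRel (t z) (b z) (c z) a ξ₃ ∧ ¬ (ξ₁ = ξ₂ ∧ ξ₁ = ξ₃)) :
    Solvable {x, y, z} t b c := by
  obtain ⟨a, ξ₁, h₁, ξ₂, h₂, ξ₃, h₃, hne⟩ := h
  refine ⟨a, fun v => if v = x then ξ₁ else if v = y then ξ₂ else ξ₃, ?_, ?_⟩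
  · simp [h₁, h₂, h₃, hxy.symm, hxz.symm, hyz.symm]
  · exact Happy.of_ne hxy hxz hyz (by simpa [hxy.symm, hxz.symm, hyz.symm] using hne)

/-- Long paths at a hub of degree three, four or five. -/
theorem solvable_of_sum_le (ht : ∀ x ∈ N, t x ≤ 3) (h1 : ∀ x ∈ N, 1 ≤ t x)
    (hbc : ∀ x ∈ N, b x ≠ c x) (hN3 : 3 ≤ N.card) (hN5 : N.card ≤ 5)
    (hsum : ∑ x ∈ N, (3 - t x) ≤ 5) : Solvable N t b c := by
  classical
  by_cases h3 : ∃ x ∈ N, t x = 3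
  · obtain ⟨x, hx, hx3⟩ := h3
    refine solvable_of_three ht hbc hx hx3 hN5 ?_
    have : 2 * ∑ y ∈ N, (2 - t y) ≤ ∑ x ∈ N, (3 - t x) := by
      rw [Finset.mul_sum]
      refine Finset.sum_le_sum fun y hy => ?_
      have := h1 y hy
      have := ht y hy
      omega
    omega
  push Not at h3
  have h2 : ∀ x ∈ N, t x ≤ 2 := fun x hx => by
    have := ht x hx; have := h3 x hx; omega
  set O := N.filter (fun x => t x = 1) with hO
  have hcard : N.card + O.card ≤ 5 := by
    have : N.card + O.card ≤ ∑ x ∈ N, (3 - t x) := by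
      rw [Finset.card_eq_sum_ones, hO, Finset.card_filter, ← Finset.sum_add_distrib]
      refine Finset.sum_le_sum fun y hy => ?_
      have := h1 y hy
      have := h2 y hy
      split_ifs <;> omega
    omega
  have hO' : ∀ x ∈ N, x ∉ O → t x = 2 := fun x hx hxO => by
    have := h1 x hx
    have := h2 x hx
    have : t x ≠ 1 := fun e => hxO (Finset.mem_filter.2 ⟨hx, e⟩)
    omega
  obtain ⟨x, hxN, hxO⟩ : ∃ x ∈ N, x ∉ O := Finset.exists_mem_notMem_of_card_lt_card (by omega)
  have hx2 := hO' x hxN hxO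
  have hcases : O.card = 0 ∨ O.card = 1 ∨ O.card = 2 := by omega
  rcases hcases with h | h | h
  · have hO2 : ∀ z ∈ N, t z = 2 := fun z hz => hO' z hz (by rw [Finset.card_eq_zero.1 h]; simp)
    refine solvable_of_free ht hbc (b x) (fun z hz hz1 => ?_) (fun z hz hz0 => ?_) hxN 2
      (by norm_num) (by omega) (Finset.univ.erase (b x)) (by simp) (fun ξ hξ => ?_)
    · have := hO2 z hz; omega
    · have := hO2 z hz; omega
    · rw [hx2]; exact PathRel.two_of_eq_left _ _ _ (hbc x hxN) (Finset.ne_of_mem_erase hξ)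
  · obtain ⟨y, hy⟩ := Finset.card_eq_one.1 h
    have hyO : y ∈ O := by simp [hy]
    refine solvable_of_two (y := y) ht hbc hxN hx2 (by omega) (fun z hz hz1 => ?_)
      (Finset.mem_filter.1 hyO).2
    have : z ∈ O := by
      by_contra hzO
      have := hO' z hz hzO
      omega
    simpa [hy] using this
  · obtain ⟨y, z, hyz, hOyz⟩ := Finset.card_eq_two.1 h
    have hyO : y ∈ O := by simp [hOyz]
    have hzO : z ∈ O := by simp [hOyz]
    have hxy : x ≠ y := fun e => hxO (e ▸ hyO)
    have hxz : x ≠ z := fun e => hxO (e ▸ hzO)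
    have hyO' := Finset.mem_filter.1 hyO
    have hzO' := Finset.mem_filter.1 hzO
    have hNeq : N = {x, y, z} := by
      refine (Finset.eq_of_subset_of_card_le ?_ ?_).symm
      · intro v hv
        simp only [Finset.mem_insert, Finset.mem_singleton] at hv
        rcases hv with rfl | rfl | rfl
        exacts [hxN, hyO'.1, hzO'.1]
      · rw [Finset.card_eq_three.2 ⟨x, y, z, hxy, hxz, hyz, rfl⟩]
        omega
    rw [hNeq]
    refine solvable_triple hxy hxz hyz ?_
    rw [hx2, hyO'.2, hzO'.2]
    exact pathRel_two_one_one _ _ _ _ _ _ (hbc x hxN) (hbc y hyO'.1) (hbc z hzO'.1)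

end Colors

section Threads

variable {V : Type*} {G : SimpleGraph V}

/-- A path from `u` to `w` with set `B` of `t` inner vertices, all of degree two. The first vertex
after `u` is `x` and the last one before `w` is `l`. -/
inductive Thread (G : SimpleGraph V) : V → V → V → V → Set V → ℕ → Prop
  | nil {u w : V} : G.Adj u w → Thread G u w u w ∅ 0
  | cons {u x y l w : V} {B : Set V} {t : ℕ} : Thread G x y l w B t → x ∉ B →
      (∀ v, G.Adj x v ↔ v = u ∨ v = y) → u ≠ y → Thread G u x l w (insert x B) (t + 1)

namespace Thread

variable {u x l w : V} {B : Set V} {t : ℕ}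

theorem adj_first (h : Thread G u x l w B t) : G.Adj u x := by
  cases h with
  | nil h => exact h
  | cons _ _ h _ => exact ((h u).2 (Or.inl rfl)).symm

theorem first_mem_or (h : Thread G u x l w B t) : x ∈ B ∨ x = w := by
  cases h with
  | nil h => exact Or.inr rfl
  | cons _ _ h _ => exact Or.inl (Set.mem_insert _ _)

theorem first_mem (h : Thread G u x l w B t) (ht : t ≠ 0) : x ∈ B := by
  cases h with
  | nil h => exact absurd rfl ht
  | cons _ _ h _ => exact Set.mem_insert _ _

theorem of_zero (h : Thread G u x l w B 0) : x = w ∧ l = u ∧ B = ∅ := by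
  cases h with
  | nil h => exact ⟨rfl, rfl, rfl⟩

theorem snoc {w' : V} (h : Thread G u x l w B t) (hw : w ∉ B)
    (hadj : ∀ v, G.Adj w v ↔ v = l ∨ v = w') (hl : l ≠ w') :
    Thread G u x w w' (insert w B) (t + 1) := by
  induction h with
  | nil h => exact cons (nil ((hadj _).2 (Or.inr rfl))) (by simp) hadj hl
  | @cons u x y l w B t h hx hadj' hu ih =>
    rw [Set.mem_insert_iff, not_or] at hw
    rw [Set.insert_comm]
    refine cons (ih hw.2 hadj hl) ?_ hadj' hu
    rw [Set.mem_insert_iff, not_or]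
    exact ⟨Ne.symm hw.1, hx⟩

theorem reverse (h : Thread G u x l w B t) : Thread G w l x u B t := by
  induction h with
  | nil h => exact nil h.symm
  | cons h hx hadj hu ih => exact ih.snoc hx (fun v => (hadj v).trans or_comm) hu.symm

theorem adj_last (h : Thread G u x l w B t) : G.Adj w l := h.reverse.adj_first

theorem exists_shorten (h : Thread G u x l w B (t + 1)) : ∃ l' B', Thread G u x l' l B' t ∧
    B = insert l B' ∧ l ∉ B' ∧ (∀ v, G.Adj l v ↔ v = w ∨ v = l') ∧ w ≠ l' := by
  have h' := h.reverse
  cases h' with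
  | cons h' hl hadj hw => exact ⟨_, _, h'.reverse, rfl, hl, hadj, hw⟩

theorem mem_or_of_adj (h : Thread G u x l w B t) {v v' : V} (hv : v ∈ B) (hadj : G.Adj v v') :
    v' ∈ B ∨ v' = u ∨ v' = w := by
  induction h with
  | nil h => exact absurd hv (by simp)
  | cons h hx hadj' hu ih =>
    rcases hv with rfl | hv
    · rcases (hadj' _).1 hadj with rfl | rfl
      · exact Or.inr (Or.inl rfl)
      · exact h.first_mem_or.imp (Set.mem_insert_of_mem _) Or.inr
    · rcases ih hv with h' | rfl | rfl
      · exact Or.inl (Set.mem_insert_of_mem _ h')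
      · exact Or.inl (Set.mem_insert _ _)
      · exact Or.inr (Or.inr rfl)

/-- The two threads from an inner vertex to both ends. -/
theorem exists_split (h : Thread G u x l w B t) {p : V} (hp : p ∈ B) :
    ∃ q r B₁ B₂ t₁ t₂, q ≠ r ∧ (∀ v, G.Adj p v ↔ v = q ∨ v = r) ∧ B₁ ⊆ B ∧
      Thread G p q x u B₁ t₁ ∧ Thread G p r l w B₂ t₂ := by
  induction h with
  | nil h => exact absurd hp (by simp)
  | @cons u x y l w B t h hx hadj hu ih =>
    rcases hp with rfl | hp
    · exact ⟨u, y, ∅, B, 0, t, hu, hadj, by simp, nil ((hadj u).2 (Or.inl rfl)), h⟩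
    · obtain ⟨q, r, B₁, B₂, t₁, t₂, hqr, hpadj, hB, h₁, h₂⟩ := ih hp
      exact ⟨q, r, _, B₂, t₁ + 1, t₂, hqr, hpadj, Set.insert_subset_insert hB,
        h₁.snoc (fun h' => hx (hB h')) (fun v => (hadj v).trans or_comm) hu.symm, h₂⟩

open Classical in
theorem branch {A₀ : Set V} {f₀ c₀ : V → Fin 4} (h : Thread G u x l w B t) (hw : w ∈ A₀) :
    Branch G A₀ f₀ c₀ u x B (PathRel t (f₀ w) (c₀ w)) := by
  induction h with
  | @nil u w h =>
    refine ⟨Or.inr ⟨hw, fun a ξ h => ⟨h.1, h.2.1⟩⟩, ?_⟩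
    intro A E f c h₁ _ _ _ _ h₆ h₇ ξ hξ
    refine ⟨f, c, by simpa using h₇, fun _ _ => ⟨rfl, rfl⟩, ?_⟩
    rw [(h₆ w hw).1]
    exact hξ.2.2.symm
  | @cons u x y l w B t h hx hadj hu ih =>
    have := Branch.hub (B := fun _ => B) (R := fun _ => PathRel t (f₀ w) (c₀ w)) u x {y}
      (by simpa using hadj) (by simpa using ih hw)
      (fun p hp q hq hpq => absurd ((Finset.mem_singleton.1 hp).trans
        (Finset.mem_singleton.1 hq).symm) hpq) (by simpa using hx)
    simp only [Finset.mem_singleton, Set.iUnion_iUnion_eq_left] at this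
    refine this.mono fun a ξ hξ => ⟨hξ.1, ?_⟩
    obtain ⟨η, hηa, hη⟩ := hξ.2
    refine ⟨fun v => if v = u then a else η, ?_, by simp, ⟨u, by simp, ?_⟩⟩
    · rintro p rfl
      simpa [hu.symm] using hη
    · intro v hv hv'
      by_contra hne
      simp [hne] at hv'
      exact hηa hv'

end Thread

section Degree

variable [Fintype V] [DecidableRel G.Adj]

theorem degree_eq_two {x u y : V} (h : ∀ v, G.Adj x v ↔ v = u ∨ v = y) (hu : u ≠ y) :
    G.degree x = 2 := by
  classical
  rw [← G.card_neighborFinset_eq_degree, Finset.card_eq_two]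
  exact ⟨u, y, hu, by ext v; simp [h]⟩

theorem exists_of_degree_eq_two {x u : V} (h : G.degree x = 2) (hu : G.Adj x u) :
    ∃ y, u ≠ y ∧ ∀ v, G.Adj x v ↔ v = u ∨ v = y := by
  classical
  rw [← G.card_neighborFinset_eq_degree, Finset.card_eq_two] at h
  obtain ⟨a, b, hab, h⟩ := h
  have hadj : ∀ v, G.Adj x v ↔ v = a ∨ v = b := fun v => by
    rw [← G.mem_neighborFinset, h]; simp
  rcases (hadj u).1 hu with rfl | rfl
  · exact ⟨b, hab, hadj⟩
  · exact ⟨a, hab.symm, fun v => (hadj v).trans or_comm⟩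

theorem Thread.degree_eq_two {u x l w : V} {B : Set V} {t : ℕ} (h : Thread G u x l w B t)
    {v : V} (hv : v ∈ B) : G.degree v = 2 := by
  obtain ⟨q, r, -, -, -, -, hqr, hadj, -⟩ := h.exists_split hv
  exact _root_.degree_eq_two hadj hqr

theorem Thread.unique {u x l w l' w' : V} {B B' : Set V} {t t' : ℕ} (h : Thread G u x l w B t)
    (hw : 3 ≤ G.degree w) (h' : Thread G u x l' w' B' t') (hw' : 3 ≤ G.degree w') :
    l = l' ∧ w = w' ∧ B = B' ∧ t = t' := by
  induction h generalizing l' w' B' t' with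
  | nil h =>
    cases h' with
    | nil => exact ⟨rfl, rfl, rfl, rfl⟩
    | cons _ _ hadj hu => have := _root_.degree_eq_two hadj hu; omega
  | cons h hx hadj hu ih =>
    cases h' with
    | nil => have := _root_.degree_eq_two hadj hu; omega
    | cons h₂ _ hadj₂ hu₂ =>
      have := (hadj₂ _).1 ((hadj _).2 (Or.inr rfl))
      rcases this with e | e
      · exact absurd e.symm hu
      · subst e
        obtain ⟨rfl, rfl, rfl, rfl⟩ := ih hw h₂ hw'
        exact ⟨rfl, rfl, rfl, rfl⟩

end Degree
end Threads

section Critical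

variable {V : Type*} {G : SimpleGraph V}

/-- A graph without `5`-cycles and without proper conflict-free `4`-coloring, all of whose proper
induced subgraphs have one. -/
structure Crit (G : SimpleGraph V) : Prop where
  no_coloring : ¬ ∃ f : V → Fin 4, IsPCFColoring G f
  exists_pcfOn : ∀ A : Set V, A ≠ Set.univ → ∃ f, PCFOn G A f
  no_cycle : ∀ a b c d e : V, G.Adj a b → G.Adj b c → G.Adj c d → G.Adj d e → G.Adj e a →
    a ≠ c → a ≠ d → b ≠ d → b ≠ e → c ≠ e → False

namespace Crit

theorem exists_partialColoring (hG : Crit G) {A : Set V} {x : V} (hx : x ∉ A)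
    (hA : ∀ z ∈ A, ∃ y ∈ A, G.Adj z y) : ∃ f c, PartialColoring G A ∅ f c := by
  obtain ⟨f, hf⟩ := hG.exists_pcfOn A (fun h => hx (h ▸ Set.mem_univ x))
  exact ⟨f, hf.exists_partialColoring hA⟩

theorem exists_dipole (hG : Crit G) {A : Set V} {v y : V} (hv : v ∉ A) (hy : y ∉ A)
    (hvy : G.Adj v y) (hvA : ∀ z ∈ A, ¬ G.Adj z v) (hyA : ∀ z ∈ A, ¬ G.Adj z y)
    (hA : ∀ z ∈ A, ∃ y ∈ A, G.Adj z y) {b c : Fin 4} (hbc : b ≠ c) :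
    ∃ f g, PartialColoring G (insert y (insert v A)) ∅ f g ∧
      f v = b ∧ f y = c ∧ g v = c ∧ g y = b := by
  classical
  obtain ⟨f, g, h⟩ := hG.exists_partialColoring hv hA
  have h₁ := h.insert (x := v) (a := b) hv (fun z hz hz' => absurd hz' (hvA z hz))
  have h₂ := h₁.insert (x := y) (a := c) (by simp [hvy.ne', hy]) (by
    rintro z (rfl | hz) hz'
    · simp [hbc]
    · exact absurd hz' (hyA z hz))
  have h₃ := h₂.setUnique (v := v) (u := y) (by simp) hvy (by
    rintro z (rfl | rfl | hz) hz' _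
    · rfl
    · exact absurd hz' (G.irrefl)
    · exact absurd hz'.symm (hvA z hz))
  have h₄ := h₃.setUnique (v := y) (u := v) (by simp) hvy.symm (by
    rintro z (rfl | rfl | hz) hz' _
    · exact absurd hz' (G.irrefl)
    · rfl
    · exact absurd hz'.symm (hyA z hz))
  have hE : (insert y (insert v (∅ : Set V)) \ {v}) \ {y} = ∅ := by
    ext z
    simp
    tauto
  rw [hE] at h₄
  refine ⟨_, _, h₄, ?_, ?_, ?_, ?_⟩ <;> simp [hvy.ne]

theorem not_solvable (hG : Crit G) {u : V} {P : Finset V} (hP : ∀ v, G.Adj u v ↔ v ∈ P)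
    {A₀ : Set V} {f₀ c₀ : V → Fin 4} (h : PartialColoring G A₀ ∅ f₀ c₀) {B : V → Set V}
    {t : V → ℕ} {b c : V → Fin 4}
    (hB : ∀ p ∈ P, Branch G A₀ f₀ c₀ u p (B p) (PathRel (t p) (b p) (c p)))
    (hdis : ∀ p ∈ P, ∀ q ∈ P, p ≠ q → Disjoint (B p) (B q))
    (hAB : ∀ p ∈ P, Disjoint A₀ (B p)) (huB : ∀ p ∈ P, u ∉ B p) (huA : u ∉ A₀)
    (hcover : ∀ v, v ∈ A₀ ∨ v = u ∨ ∃ p ∈ P, v ∈ B p) : ¬ Solvable P t b c := by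
  rintro ⟨a, ξ, hξ, hh⟩
  exact hG.no_coloring (exists_isPCFColoring_of_branches u P hP hB hdis hAB huB huA hcover h a ξ
    hξ hh)

theorem not_pathRel (hG : Crit G) {x u y l w : V} {B : Set V} {t : ℕ}
    (hadj : ∀ v, G.Adj x v ↔ v = u ∨ v = y) (huy : u ≠ y) (hth : Thread G x y l w B t)
    (hx : x ∉ B) (hu : u ∉ B) (hwx : w ≠ x) (hw : w ∉ B) {f c : V → Fin 4}
    (h : PartialColoring G (insert x B)ᶜ ∅ f c) {a ξ : Fin 4} (hb : a ≠ f u) (hc : a ≠ c u)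
    (hξ : PathRel t (f w) (c w) a ξ) (hne : ξ ≠ f u) : False := by
  classical
  have hxu : G.Adj x u := (hadj u).2 (Or.inl rfl)
  have huA : u ∈ (insert x B)ᶜ := by simp [hu, hxu.ne']
  have hwA : w ∈ (insert x B)ᶜ := by simp [hw, hwx]
  refine hG.not_solvable (u := x) (P := {u, y}) (by simpa using hadj) h
    (B := fun p => if p = u then ∅ else B) (t := fun p => if p = u then 0 else t)
    (b := fun p => if p = u then f u else f w) (c := fun p => if p = u then c u else c w)
    ?_ ?_ ?_ ?_ (by simp) ?_ ?_
  · simp only [Finset.mem_insert, Finset.mem_singleton, forall_eq_or_imp, forall_eq, if_true,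
      huy.symm, if_false]
    exact ⟨(Thread.nil hxu).branch huA, hth.branch hwA⟩
  · simp [huy.symm, huy]
  · simp only [Finset.mem_insert, Finset.mem_singleton, forall_eq_or_imp, forall_eq, if_true,
      huy.symm, if_false]
    refine ⟨by simp, ?_⟩
    rw [Set.disjoint_compl_left_iff_subset]
    exact Set.subset_insert _ _
  · simp [hx]
  · intro v
    simp [huy.symm]
    tauto
  · refine ⟨a, fun p => if p = u then f u else ξ, ?_, ⟨u, by simp, ?_⟩⟩
    · simp [huy.symm, hξ, PathRel, hb, hc]
    · simp [hne]

theorem exists_adj (hG : Crit G) (v : V) : ∃ u, G.Adj v u := by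
  by_contra h
  push Not at h
  obtain ⟨f, hf⟩ := hG.exists_pcfOn {v}ᶜ (by simp)
  have hne : ∀ x y, G.Adj x y → x ∈ ({v}ᶜ : Set V) := by
    rintro x y hxy rfl
    exact h y hxy
  refine hG.no_coloring ⟨f, fun x y hxy => hf.1 x (hne _ _ hxy) y (hne _ _ hxy.symm) hxy, ?_⟩
  rintro x ⟨y, hxy⟩
  obtain ⟨z, -, hxz, hz⟩ := hf.2 x (hne _ _ hxy) ⟨y, hne _ _ hxy.symm, hxy⟩
  exact ⟨z, hxz, fun w hw => hz w (hne _ _ hw.symm) hw⟩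

theorem exists_adj_ne (hG : Crit G) (v u : V) : ∃ x, G.Adj v x ∧ x ≠ u := by
  by_contra h
  push Not at h
  obtain ⟨u', hu⟩ := hG.exists_adj v
  obtain rfl := h u' hu
  have hadj : ∀ z, G.Adj z v → z = u' := fun z hz => h z hz.symm
  by_cases hiso : ∃ z, G.Adj u' z ∧ z ≠ v
  · obtain ⟨y, huy, hyv⟩ := hiso
    obtain ⟨f, c, hfc⟩ := hG.exists_partialColoring (A := {v}ᶜ) (x := v) (by simp) (by
      intro z hz
      by_cases hzu : z = u'
      · exact ⟨y, hyv, hzu ▸ huy⟩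
      · obtain ⟨y, hy⟩ := hG.exists_adj z
        exact ⟨y, fun e => hzu (hadj z (e ▸ hy)), hy⟩)
    refine hG.not_solvable (u := v) (P := {u'}) ?_ hfc (B := fun _ => ∅) (t := fun _ => 0)
      (b := fun _ => f u') (c := fun _ => c u') ?_ ?_ ?_ ?_ ?_ ?_ ?_
    · intro z
      simp only [Finset.mem_singleton]
      exact ⟨h z, fun e => e ▸ hu⟩
    · simpa using (Thread.nil hu).branch (show u' ∈ ({v}ᶜ : Set V) from hu.ne')
    · simp
    · simp
    · simp
    · simp
    · intro z; simp; tauto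
    · obtain ⟨a, hb, hc⟩ : ∃ a : Fin 4, a ≠ f u' ∧ a ≠ c u' := by
        generalize f u' = b
        generalize c u' = d
        revert b d
        decide
      exact ⟨a, fun _ => f u', by simp [PathRel, hb, hc], ⟨u', by simp, by simp⟩⟩
  · push Not at hiso
    have hout : ∀ z ∈ ({u', v}ᶜ : Set V), ∀ y, G.Adj z y → y ∈ ({u', v}ᶜ : Set V) := by
      rintro z hz y hzy (rfl | rfl)
      · exact hz (Or.inr (hiso z hzy.symm))
      · exact hz (Or.inl (hadj z hzy))
    obtain ⟨f, g, hfg, -⟩ := hG.exists_dipole (A := {u', v}ᶜ) (v := v) (y := u') (b := 0) (c := 1)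
      (by simp) (by simp) hu (fun z hz hz' => hout z hz v hz' (by simp))
      (fun z hz hz' => hout z hz u' hz' (by simp)) (fun z hz => by
        obtain ⟨y, hy⟩ := hG.exists_adj z
        exact ⟨y, hout z hz y hy, hy⟩) (by decide)
    have huniv : insert u' (insert v ({u', v}ᶜ : Set V)) = Set.univ := by
      ext z
      simp
      tauto
    rw [huniv] at hfg
    exact hG.no_coloring ⟨f, hfg.isPCFColoring⟩

variable [Fintype V] [DecidableRel G.Adj]

theorem two_le_degree (hG : Crit G) (v : V) : 2 ≤ G.degree v := by
  classical
  obtain ⟨u, hu⟩ := hG.exists_adj v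
  obtain ⟨x, hx, hxu⟩ := hG.exists_adj_ne v u
  rw [← G.card_neighborFinset_eq_degree]
  exact Finset.one_lt_card.2 ⟨u, by simpa using hu, x, by simpa using hx, hxu.symm⟩

end Crit

end Critical

section Cycles

variable {V : Type*} {G : SimpleGraph V}

namespace Crit

/-- A triangle has at most one vertex of degree two. -/
theorem no_triangle (hG : Crit G) {u x y : V} (hu : G.Adj u y)
    (hx : ∀ v, G.Adj x v ↔ v = u ∨ v = y) (hy : ∀ v, G.Adj y v ↔ v = u ∨ v = x) : False := by
  have hxu : G.Adj x u := (hx u).2 (Or.inl rfl)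
  have hxy : G.Adj x y := (hx y).2 (Or.inr rfl)
  by_cases hiso : ∃ z, G.Adj u z ∧ z ≠ x ∧ z ≠ y
  · obtain ⟨z, huz, hzx, hzy⟩ := hiso
    obtain ⟨f, c, h⟩ := hG.exists_partialColoring (A := (insert x (insert y ∅))ᶜ) (x := x)
      (by simp) (by
        intro p hp
        simp only [Set.mem_compl_iff, Set.mem_insert_iff, Set.mem_empty_iff_false, or_false,
          not_or] at hp ⊢
        by_cases hpu : p = u
        · exact ⟨z, ⟨hzx, hzy⟩, hpu ▸ huz⟩
        · obtain ⟨q, hq⟩ := hG.exists_adj p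
          refine ⟨q, ⟨?_, ?_⟩, hq⟩
          · rintro rfl
            rcases (hx p).1 hq.symm with e | e
            exacts [hpu e, hp.2 e]
          · rintro rfl
            rcases (hy p).1 hq.symm with e | e
            exacts [hpu e, hp.1 e])
    have hc := h.c_ne (v := u) (by simp [hxu.ne', hu.ne]) (by simp)
    obtain ⟨a, hb, hc, ξ, hξ, hne⟩ : ∃ a, a ≠ f u ∧ a ≠ c u ∧ ∃ ξ, PathRel 1 (f u) (c u) a ξ ∧
        ξ ≠ f u := by
      generalize f u = b at *
      generalize c u = d at *
      clear h
      revert b d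
      decide
    exact hG.not_pathRel hx hu.ne
      (Thread.cons (Thread.nil hu.symm) (by simp) (fun v => (hy v).trans or_comm) hxu.ne)
      (by simp [hxy.ne]) (by simp [hu.ne]) hxu.ne' (by simp [hu.ne]) h hb hc hξ hne
  · push Not at hiso
    have hout : ∀ z ∈ ({u, y, x}ᶜ : Set V), ∀ w, G.Adj z w → w ∈ ({u, y, x}ᶜ : Set V) := by
      rintro z hz w hzw (rfl | rfl | rfl)
      · by_cases hzx : z = x
        · exact hz (by simp [hzx])
        · exact hz (by simp [hiso z hzw.symm hzx])
      · rcases (hy z).1 hzw.symm with rfl | rfl <;> simp at hz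
      · rcases (hx z).1 hzw.symm with rfl | rfl <;> simp at hz
    obtain ⟨f, g, hfg, hfu, hfy, hgu, hgy⟩ := hG.exists_dipole (A := {u, y, x}ᶜ) (v := u) (y := y)
      (b := 0) (c := 1) (by simp) (by simp) hu (fun z hz hz' => hout z hz u hz' (by simp))
      (fun z hz hz' => hout z hz y hz' (by simp)) (fun z hz => by
        obtain ⟨y, hy⟩ := hG.exists_adj z
        exact ⟨y, hout z hz y hy, hy⟩) (by decide)
    have hset : insert y (insert u ({u, y, x}ᶜ : Set V)) = (insert x ∅)ᶜ := by
      ext z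
      simp only [Set.mem_insert_iff, Set.mem_compl_iff, Set.mem_singleton_iff,
        Set.mem_empty_iff_false, or_false]
      refine ⟨?_, by tauto⟩
      rintro (rfl | rfl | h)
      exacts [hxy.ne', hxu.ne', by tauto]
    rw [hset] at hfg
    refine hG.not_pathRel (a := 2) (ξ := 1) hx hu.ne (Thread.nil hxy)
      (by simp) (by simp) hxy.ne' (by simp) hfg ?_ ?_ ?_ ?_
    all_goals simp [hfu, hgu, hfy, hgy, PathRel]

/-- Three vertices of a `4`-cycle are not all of degree two. -/
theorem no_four_cycle (hG : Crit G) {u x y z : V}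
    (hx : ∀ v, G.Adj x v ↔ v = u ∨ v = y) (hy : ∀ v, G.Adj y v ↔ v = x ∨ v = z)
    (hz : ∀ v, G.Adj z v ↔ v = y ∨ v = u) (huy : u ≠ y) (hxz : x ≠ z) : False := by
  have hxu : G.Adj x u := (hx u).2 (Or.inl rfl)
  have hxy : G.Adj x y := (hx y).2 (Or.inr rfl)
  have hyz : G.Adj y z := (hy z).2 (Or.inr rfl)
  have hzu : G.Adj z u := (hz u).2 (Or.inr rfl)
  by_cases hiso : ∃ p, G.Adj u p ∧ p ≠ x ∧ p ≠ z
  · obtain ⟨q, huq, hqx, hqz⟩ := hiso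
    have hqy : q ≠ y := by
      rintro rfl
      rcases (hy u).1 huq.symm with rfl | rfl
      exacts [hxu.ne rfl, hzu.ne rfl]
    obtain ⟨f, c, h⟩ := hG.exists_partialColoring (A := (insert x (insert y (insert z ∅)))ᶜ) (x := x)
      (by simp) (by
        intro p hp
        simp only [Set.mem_compl_iff, Set.mem_insert_iff, Set.mem_empty_iff_false, or_false,
          not_or] at hp ⊢
        by_cases hpu : p = u
        · exact ⟨q, ⟨hqx, hqy, hqz⟩, hpu ▸ huq⟩
        · obtain ⟨q, hq⟩ := hG.exists_adj p
          refine ⟨q, ⟨?_, ?_, ?_⟩, hq⟩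
          · rintro rfl
            have := (hx p).1 hq.symm
            tauto
          · rintro rfl
            have := (hy p).1 hq.symm
            tauto
          · rintro rfl
            have := (hz p).1 hq.symm
            tauto)
    have hc := h.c_ne (v := u) (by simp [hxu.ne', huy, hzu.ne']) (by simp)
    obtain ⟨a, hb, hc, ξ, hξ, hne⟩ : ∃ a, a ≠ f u ∧ a ≠ c u ∧ ∃ ξ, PathRel 2 (f u) (c u) a ξ ∧
        ξ ≠ f u := by
      generalize f u = b at *
      generalize c u = d at *
      clear h
      revert b d
      decide
    exact hG.not_pathRel hx huy
      (Thread.cons (Thread.cons (Thread.nil hzu) (by simp) hz huy.symm) (by simp [hyz.ne]) hy hxz)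
      (by simp [hxy.ne, hxz]) (by simp [huy, hzu.ne']) hxu.ne' (by simp [huy, hzu.ne']) h hb hc
      hξ hne
  · push Not at hiso
    have hout : ∀ p ∈ ({u, x, y, z}ᶜ : Set V), ∀ w, G.Adj p w → w ∈ ({u, x, y, z}ᶜ : Set V) := by
      rintro p hp w hpw hw
      simp only [Set.mem_compl_iff, Set.mem_insert_iff, Set.mem_singleton_iff, not_or] at hp hw
      rcases hw with rfl | rfl | rfl | rfl
      · have := hiso p hpw.symm
        tauto
      · have := (hx p).1 hpw.symm
        tauto
      · have := (hy p).1 hpw.symm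
        tauto
      · have := (hz p).1 hpw.symm
        tauto
    obtain ⟨f, g, hfg, hfu, hfz, hgu, hgz⟩ := hG.exists_dipole (A := {u, x, y, z}ᶜ) (v := u)
      (y := z) (b := 0) (c := 1) (by simp) (by simp) hzu.symm
      (fun p hp hp' => hout p hp u hp' (by simp))
      (fun p hp hp' => hout p hp z hp' (by simp)) (fun p hp => by
        obtain ⟨q, hq⟩ := hG.exists_adj p
        exact ⟨q, hout p hp q hq, hq⟩) (by decide)
    have hset : insert z (insert u ({u, x, y, z}ᶜ : Set V)) = (insert x (insert y ∅))ᶜ := by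
      ext p
      simp only [Set.mem_insert_iff, Set.mem_compl_iff, Set.mem_singleton_iff,
        Set.mem_empty_iff_false, or_false]
      refine ⟨?_, by tauto⟩
      rintro (rfl | rfl | h)
      · simp [hxz.symm, hyz.ne']
      · simp [hxu.ne', huy]
      · tauto
    rw [hset] at hfg
    refine hG.not_pathRel (a := 2) (ξ := 3) hx huy (Thread.cons (Thread.nil hyz) (by simp) hy hxz)
      (by simp [hxy.ne]) (by simp [huy]) hxz.symm (by simp [hyz.ne']) hfg ?_ ?_ ?_ ?_
    · simp [hfu]
    · simp [hgu]
    · rw [hfz, hgz]; decide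
    · simp [hfu]

/-- There are no four consecutive vertices of degree two. -/
theorem no_four_path (hG : Crit G) {u x₁ x₂ x₃ x₄ w : V}
    (h₁ : ∀ v, G.Adj x₁ v ↔ v = u ∨ v = x₂) (h₂ : ∀ v, G.Adj x₂ v ↔ v = x₁ ∨ v = x₃)
    (h₃ : ∀ v, G.Adj x₃ v ↔ v = x₂ ∨ v = x₄) (h₄ : ∀ v, G.Adj x₄ v ↔ v = x₃ ∨ v = w)
    (hu : u ≠ x₂) (h₁₃ : x₁ ≠ x₃) (h₂₄ : x₂ ≠ x₄) (hw : x₃ ≠ w) : False := by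
  classical
  have a₁ : G.Adj u x₁ := ((h₁ u).2 (Or.inl rfl)).symm
  have a₂ : G.Adj x₁ x₂ := (h₁ x₂).2 (Or.inr rfl)
  have a₃ : G.Adj x₂ x₃ := (h₂ x₃).2 (Or.inr rfl)
  have a₄ : G.Adj x₃ x₄ := (h₃ x₄).2 (Or.inr rfl)
  have a₅ : G.Adj x₄ w := (h₄ w).2 (Or.inr rfl)
  have h₁₄ : x₁ ≠ x₄ := by
    rintro rfl
    exact hG.no_triangle (u := x₁) (x := x₂) (y := x₃) a₄.symm h₂
      (fun v => (h₃ v).trans or_comm)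
  have hu₃ : u ≠ x₃ := by
    rintro rfl
    rcases (h₃ x₁).1 a₁ with e | e
    exacts [a₂.ne e, h₁₄ e]
  have hw₂ : w ≠ x₂ := by
    rintro rfl
    rcases (h₂ x₄).1 a₅.symm with e | e
    exacts [h₁₄ e.symm, a₄.ne e.symm]
  have hw₁ : w ≠ x₁ := by
    rintro rfl
    exact hG.no_four_cycle (u := w) h₂ h₃ h₄ h₁₃ h₂₄
  have hu₄ : u ≠ x₄ := by
    rintro rfl
    rcases (h₄ x₁).1 a₁ with e | e
    exacts [h₁₃ e, hw₁ e.symm]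
  have huw : u ≠ w := by
    rintro rfl
    exact hG.no_cycle u x₁ x₂ x₃ x₄ a₁ a₂ a₃ a₄ a₅ hu hu₃ h₁₃ h₁₄ h₂₄
  obtain ⟨f, c, h⟩ := hG.exists_partialColoring
    (A := (insert x₁ (insert x₂ (insert x₃ (insert x₄ ∅))))ᶜ) (x := x₁) (by simp) (by
      intro p hp
      simp only [Set.mem_compl_iff, Set.mem_insert_iff, Set.mem_empty_iff_false, or_false,
        not_or] at hp ⊢
      obtain ⟨q, hq, hq'⟩ := hG.exists_adj_ne p (if p = u then x₁ else x₄)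
      refine ⟨q, ⟨?_, ?_, ?_, ?_⟩, hq⟩
      · rintro rfl
        rcases (h₁ p).1 hq.symm with rfl | e
        · simp at hq'
        · exact hp.2.1 e
      · rintro rfl
        have := (h₂ p).1 hq.symm
        tauto
      · rintro rfl
        have := (h₃ p).1 hq.symm
        tauto
      · rintro rfl
        rcases (h₄ p).1 hq.symm with e | rfl
        · exact hp.2.2.1 e
        · simp [huw.symm] at hq')
  have hcu := h.c_ne (v := u) (by simp [a₁.ne, hu, hu₃, hu₄]) (by simp)
  have hcw := h.c_ne (v := w) (by simp [hw₁, hw₂, hw.symm, a₅.ne']) (by simp)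
  obtain ⟨a, hb, hc, ξ, hξ, hne⟩ : ∃ a, a ≠ f u ∧ a ≠ c u ∧ ∃ ξ, PathRel 3 (f w) (c w) a ξ ∧
      ξ ≠ f u := by
    generalize f u = b at *
    generalize c u = d at *
    generalize f w = b' at *
    generalize c w = d' at *
    clear h
    revert b d b' d'
    decide +kernel
  exact hG.not_pathRel h₁ hu
    (Thread.cons (Thread.cons (Thread.cons (Thread.nil a₅) (by simp) h₄ hw) (by simp [a₄.ne]) h₃ h₂₄)
      (by simp [a₃.ne, h₂₄]) h₂ h₁₃)
    (by simp [a₂.ne, h₁₃, h₁₄]) (by simp [hu, hu₃, hu₄]) hw₁ (by simp [hw₂, hw.symm, a₅.ne']) h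
    hb hc hξ hne

variable [Fintype V] [DecidableRel G.Adj]

theorem exists_thread (hG : Crit G) {u x : V} (hux : G.Adj u x) :
    ∃ l w B t, Thread G u x l w B t ∧ t ≤ 3 ∧ 3 ≤ G.degree w := by
  have key : ∀ {p q : V}, G.Adj p q → ¬ 3 ≤ G.degree q →
      ∃ r, p ≠ r ∧ ∀ v, G.Adj q v ↔ v = p ∨ v = r := fun {p q} hpq hq =>
    exists_of_degree_eq_two (le_antisymm (by omega) (hG.two_le_degree q)) hpq.symm
  by_cases hx : 3 ≤ G.degree x
  · exact ⟨_, _, _, _, Thread.nil hux, by omega, hx⟩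
  obtain ⟨x₂, hu, h₁⟩ := key hux hx
  have a₂ : G.Adj x x₂ := (h₁ x₂).2 (Or.inr rfl)
  by_cases hx₂ : 3 ≤ G.degree x₂
  · exact ⟨_, _, _, _, Thread.cons (Thread.nil a₂) (by simp) h₁ hu, by omega, hx₂⟩
  obtain ⟨x₃, h₁₃, h₂⟩ := key a₂ hx₂
  have a₃ : G.Adj x₂ x₃ := (h₂ x₃).2 (Or.inr rfl)
  by_cases hx₃ : 3 ≤ G.degree x₃
  · exact ⟨_, _, _, _, Thread.cons (Thread.cons (Thread.nil a₃) (by simp) h₂ h₁₃)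
      (by simp [a₂.ne]) h₁ hu, by omega, hx₃⟩
  obtain ⟨x₄, h₂₄, h₃⟩ := key a₃ hx₃
  have a₄ : G.Adj x₃ x₄ := (h₃ x₄).2 (Or.inr rfl)
  by_cases hx₄ : 3 ≤ G.degree x₄
  · exact ⟨_, _, _, _, Thread.cons (Thread.cons (Thread.cons (Thread.nil a₄) (by simp) h₃ h₂₄)
      (by simp [a₃.ne]) h₂ h₁₃) (by simp [a₂.ne, h₁₃]) h₁ hu, by omega, hx₄⟩
  obtain ⟨w, hw, h₄⟩ := key a₄ hx₄
  exact (hG.no_four_path h₁ h₂ h₃ h₄ hu h₁₃ h₂₄ hw).elim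

end Crit

end Cycles

section ThreadSystem

variable {V : Type*} {G : SimpleGraph V}

theorem Crit.start_ne_end (hG : Crit G) {u x l w : V} {B : Set V} {t : ℕ}
    (h : Thread G u x l w B t) (ht : t ≤ 3) : u ≠ w := by
  rintro rfl
  cases h with
  | nil h => exact h.ne rfl
  | cons h₁ hx hadj hu =>
    cases h₁ with
    | nil h => exact hu rfl
    | cons h₂ hx₂ hadj₂ hu₂ =>
      cases h₂ with
      | nil h =>
        exact hG.no_triangle ((hadj₂ _).2 (Or.inr rfl)).symm hadj
          (fun v => (hadj₂ v).trans or_comm)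
      | cons h₃ hx₃ hadj₃ hu₃ =>
        cases h₃ with
        | nil h => exact hG.no_four_cycle hadj hadj₂ hadj₃ hu hu₂
        | cons h₄ => omega

variable [Fintype V] [DecidableRel G.Adj]

theorem Crit.not_thread_three (hG : Crit G) {u x l w : V} {B : Set V}
    (h : Thread G u x l w B 3) (hu : 3 ≤ G.degree u) (hw : 3 ≤ G.degree w) : ¬ G.Adj u w := by
  intro huw
  cases h with
  | cons h₁ hx₁ hadj₁ hu₁ =>
    have d₁ := degree_eq_two hadj₁ hu₁
    cases h₁ with
    | cons h₂ hx₂ hadj₂ hu₂ =>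
      have d₂ := degree_eq_two hadj₂ hu₂
      cases h₂ with
      | cons h₃ hx₃ hadj₃ hu₃ =>
        have d₃ := degree_eq_two hadj₃ hu₃
        cases h₃ with
        | nil h₄ =>
          refine hG.no_cycle _ _ _ _ _ ((hadj₁ _).2 (Or.inl rfl)).symm
            ((hadj₂ _).2 (Or.inl rfl)).symm ((hadj₃ _).2 (Or.inl rfl)).symm h₄ huw.symm hu₁ ?_ hu₂
            ?_ ?_
          all_goals rintro rfl; omega

theorem Crit.not_thread_one_two (hG : Crit G) {u x l w x' l' : V} {B B' : Set V}
    (h : Thread G u x l w B 1) (hu : 3 ≤ G.degree u) (hw : 3 ≤ G.degree w) :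
    ¬ Thread G u x' l' w B' 2 := by
  intro h'
  cases h with
  | cons h₁ hx₁ hadj₁ hu₁ =>
    cases h₁ with
    | nil h =>
      cases h' with
      | cons h₁ hx₁ hadj₂ hu₂ =>
        have d₂ := degree_eq_two hadj₂ hu₂
        cases h₁ with
        | cons h₃ hx₃ hadj₃ hu₃ =>
          have d₃ := degree_eq_two hadj₃ hu₃
          cases h₃ with
          | nil h₄ =>
            refine hG.no_cycle _ _ _ _ _ ((hadj₁ _).2 (Or.inl rfl)).symm h h₄.symm
              ((hadj₃ _).2 (Or.inl rfl)) ((hadj₂ _).2 (Or.inl rfl)) hu₁ ?_ ?_ ?_ ?_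
            · rintro rfl; omega
            · rintro rfl
              rcases (hadj₃ _).1 ((hadj₁ _).2 (Or.inl rfl)) with rfl | rfl <;> first | omega | exact hu₁ rfl
            · rintro rfl
              rcases (hadj₂ _).1 h with rfl | rfl <;> first | omega | exact hu₁ rfl
            · rintro rfl; omega

/-- Threads of length at most three starting with each dart and ending at a vertex of degree
at least three. -/
structure ThreadSystem (G : SimpleGraph V) [DecidableRel G.Adj] where
  last : V → V → V
  fin : V → V → V
  int : V → V → Set V
  len : V → V → ℕ
  thread : ∀ {u x}, G.Adj u x → Thread G u x (last u x) (fin u x) (int u x) (len u x)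
  len_le : ∀ {u x}, G.Adj u x → len u x ≤ 3
  three_le_degree_fin : ∀ {u x}, G.Adj u x → 3 ≤ G.degree (fin u x)

theorem Crit.nonempty_threadSystem (hG : Crit G) : Nonempty (ThreadSystem G) := by
  have : ∀ u x, ∃ l w B t, G.Adj u x → Thread G u x l w B t ∧ t ≤ 3 ∧ 3 ≤ G.degree w := by
    intro u x
    by_cases h : G.Adj u x
    · obtain ⟨l, w, B, t, h'⟩ := hG.exists_thread h
      exact ⟨l, w, B, t, fun _ => h'⟩
    · exact ⟨u, u, ∅, 0, fun h' => absurd h' h⟩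
  choose l w B t h using this
  exact ⟨⟨l, w, B, t, fun h' => (h _ _ h').1, fun h' => (h _ _ h').2.1, fun h' => (h _ _ h').2.2⟩⟩

namespace ThreadSystem

variable (T : ThreadSystem G) {u x : V}

theorem eq_of_thread {l w : V} {B : Set V} {t : ℕ} (h : Thread G u x l w B t)
    (hw : 3 ≤ G.degree w) :
    T.last u x = l ∧ T.fin u x = w ∧ T.int u x = B ∧ T.len u x = t :=
  (T.thread h.adj_first).unique (T.three_le_degree_fin h.adj_first) h hw

theorem adj_fin_last (h : G.Adj u x) : G.Adj (T.fin u x) (T.last u x) := (T.thread h).adj_last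

theorem reverse (h : G.Adj u x) (hu : 3 ≤ G.degree u) :
    T.last (T.fin u x) (T.last u x) = x ∧ T.fin (T.fin u x) (T.last u x) = u ∧
      T.int (T.fin u x) (T.last u x) = T.int u x ∧ T.len (T.fin u x) (T.last u x) = T.len u x :=
  T.eq_of_thread (T.thread h).reverse hu

theorem degree_of_mem_int (h : G.Adj u x) {p : V} (hp : p ∈ T.int u x) : G.degree p = 2 :=
  (T.thread h).degree_eq_two hp

theorem notMem_int (h : G.Adj u x) {p : V} (hp : 3 ≤ G.degree p) : p ∉ T.int u x := fun h' => by
  have := T.degree_of_mem_int h h'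
  omega

theorem of_three_le_degree (h : G.Adj u x) (hx : 3 ≤ G.degree x) :
    T.last u x = u ∧ T.fin u x = x ∧ T.int u x = ∅ ∧ T.len u x = 0 :=
  T.eq_of_thread (Thread.nil h) hx

theorem three_le_degree_of_len (h : G.Adj u x) (hx : T.len u x = 0) : 3 ≤ G.degree x := by
  have h' := T.thread h
  rw [hx] at h'
  rw [h'.of_zero.1]
  exact T.three_le_degree_fin h

theorem exists_of_mem_int (h : G.Adj u x) (hu : 3 ≤ G.degree u) {p : V} (hp : p ∈ T.int u x) :
    ∃ q r, (∀ v, G.Adj p v ↔ v = q ∨ v = r) ∧ T.last p q = x ∧ T.fin p q = u ∧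
      T.last p r = T.last u x ∧ T.fin p r = T.fin u x := by
  obtain ⟨q, r, B₁, B₂, t₁, t₂, hqr, hadj, -, h₁, h₂⟩ := (T.thread h).exists_split hp
  have e₁ := T.eq_of_thread h₁ hu
  have e₂ := T.eq_of_thread h₂ (T.three_le_degree_fin h)
  exact ⟨q, r, hadj, e₁.1, e₁.2.1, e₂.1, e₂.2.1⟩

theorem eq_or_eq_of_mem_int (h : G.Adj u x) (hu : 3 ≤ G.degree u) {p : V} (hp : p ∈ T.int u x)
    {u' x' : V} (h' : G.Adj u' x') (hu' : 3 ≤ G.degree u') (hp' : p ∈ T.int u' x') :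
    (u' = u ∧ x' = x) ∨ (u' = T.fin u x ∧ x' = T.last u x) := by
  obtain ⟨q, r, hadj, h₁, h₂, h₃, h₄⟩ := T.exists_of_mem_int h hu hp
  obtain ⟨q', r', hadj', h₁', h₂', -⟩ := T.exists_of_mem_int h' hu' hp'
  rcases (hadj q').1 ((hadj' q').2 (Or.inl rfl)) with rfl | rfl
  · exact Or.inl ⟨h₂'.symm.trans h₂, h₁'.symm.trans h₁⟩
  · exact Or.inr ⟨h₂'.symm.trans h₄, h₁'.symm.trans h₃⟩

theorem fin_ne (hG : Crit G) (h : G.Adj u x) : T.fin u x ≠ u :=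
  (hG.start_ne_end (T.thread h) (T.len_le h)).symm

theorem no_cycle (hG : Crit G) (hu : 3 ≤ G.degree u) (h : G.Adj u x) {y : V} (hy : G.Adj u y)
    (hfin : T.fin u x = T.fin u y) (hlt : T.len u x < T.len u y) : T.len u x + T.len u y ≠ 3 := by
  intro hsum
  have h₁ := T.thread h
  have h₂ := T.thread hy
  have hw := T.three_le_degree_fin hy
  rw [hfin] at h₁
  have : T.len u x = 0 ∨ T.len u x = 1 := by omega
  rcases this with h0 | h0
  · rw [h0] at h₁
    rw [show T.len u y = 3 by omega] at h₂
    exact hG.not_thread_three h₂ hu hw (h₁.of_zero.1 ▸ h)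
  · rw [h0] at h₁
    rw [show T.len u y = 2 by omega] at h₂
    exact hG.not_thread_one_two h₁ hu hw h₂

/-- The vertices of `R` together with the inner vertices of all threads at `R`. -/
def star (R : Set V) : Set V := {v | v ∈ R ∨ ∃ r ∈ R, ∃ x, G.Adj r x ∧ v ∈ T.int r x}

theorem notMem_star {R : Set V} {v : V} (hv : 3 ≤ G.degree v) (hvR : v ∉ R) : v ∉ T.star R := by
  rintro (h | ⟨r, _, x, hrx, h⟩)
  exacts [hvR h, T.notMem_int hrx hv h]

/-- A vertex all of whose neighbors lie in a star receives all its threads from the star. -/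
theorem fin_mem_of_isolated (hG : Crit G) {R : Set V} (hR : ∀ r ∈ R, 3 ≤ G.degree r) {v : V}
    (hv : v ∉ T.star R) (hiso : ∀ y, G.Adj v y → y ∈ T.star R) :
    3 ≤ G.degree v ∧ ∀ y, G.Adj v y → T.fin v y ∈ R := by
  have key : ∀ y, G.Adj v y → 3 ≤ G.degree v ∧ T.fin v y ∈ R := by
    intro y hvy
    rcases hiso y hvy with hy | ⟨r, hr, x, hrx, hy⟩
    · refine ⟨?_, by rwa [(T.of_three_le_degree hvy (hR y hy)).2.1]⟩
      by_contra hdeg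
      refine hv (Or.inr ⟨y, hy, v, hvy.symm, (T.thread hvy.symm).first_mem fun h0 => hdeg ?_⟩)
      exact T.three_le_degree_of_len hvy.symm h0
    · have hvfin : v = T.fin r x := by
        rcases (T.thread hrx).mem_or_of_adj hy hvy.symm with h | h | h
        · exact absurd (Or.inr ⟨r, hr, x, hrx, h⟩) hv
        · exact absurd (Or.inl (h ▸ hr)) hv
        · exact h
      have hdeg : 3 ≤ G.degree v := hvfin ▸ T.three_le_degree_fin hrx
      refine ⟨hdeg, ?_⟩
      obtain ⟨p, q, hadj, h₁, h₂, h₃, h₄⟩ := T.exists_of_mem_int hrx (hR r hr) hy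
      have hyv := T.of_three_le_degree hvy.symm hdeg
      rcases (hadj v).1 hvy.symm with rfl | rfl
      · exact absurd (Or.inl ((hyv.2.1.symm.trans h₂) ▸ hr)) hv
      · rw [hyv.1] at h₃
        have := (T.reverse hrx (hR r hr)).2.1
        rw [← hvfin, ← h₃] at this
        rwa [this]
  obtain ⟨y, hy⟩ := hG.exists_adj v
  exact ⟨(key y hy).1, fun y hy => (key y hy).2⟩

theorem exists_partialColoring (hG : Crit G) {R : Set V} (hne : R.Nonempty)
    (hR : ∀ r ∈ R, 3 ≤ G.degree r)
    (hiso : ∀ v, v ∉ R → 3 ≤ G.degree v → ¬ ∀ y, G.Adj v y → T.fin v y ∈ R) :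
    ∃ f c, PartialColoring G (T.star R)ᶜ ∅ f c := by
  obtain ⟨r, hr⟩ := hne
  refine hG.exists_partialColoring (x := r) (fun h => h (Or.inl hr)) fun z hz => ?_
  by_contra hcon
  push Not at hcon
  obtain ⟨h₁, h₂⟩ := T.fin_mem_of_isolated hG hR hz fun y hy => by
    by_contra hy'
    exact hcon y hy' hy
  exact hiso z (fun h => hz (Or.inl h)) h₁ h₂

end ThreadSystem

end ThreadSystem

section Reductions

variable {V : Type*} {G : SimpleGraph V} [Fintype V] [DecidableRel G.Adj]

namespace ThreadSystem

variable (T : ThreadSystem G) {u v x : V}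

theorem disjoint_int (hG : Crit G) (hu : 3 ≤ G.degree u) {p q : V} (hp : G.Adj u p)
    (hq : G.Adj u q) (hpq : p ≠ q) : Disjoint (T.int u p) (T.int u q) := by
  rw [Set.disjoint_left]
  intro z hz hz'
  rcases T.eq_or_eq_of_mem_int hp hu hz hq hu hz' with ⟨-, h⟩ | ⟨h, -⟩
  · exact hpq h.symm
  · exact T.fin_ne hG hp h.symm

theorem fin_notMem_star (hG : Crit G) (h : G.Adj u x) : T.fin u x ∈ (T.star {u})ᶜ :=
  T.notMem_star (T.three_le_degree_fin h) (by simpa using T.fin_ne hG h)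

theorem not_solvable (hG : Crit G) (hu : 3 ≤ G.degree u) {f c : V → Fin 4}
    (h : PartialColoring G (T.star {u})ᶜ ∅ f c) :
    ¬ Solvable (G.neighborFinset u) (T.len u) (fun x => f (T.fin u x)) (fun x => c (T.fin u x)) := by
  refine hG.not_solvable (u := u) (B := T.int u) (by simp) h ?_ ?_ ?_ ?_ ?_ ?_
  · intro p hp
    rw [mem_neighborFinset] at hp
    exact (T.thread hp).branch (T.fin_notMem_star hG hp)
  · intro p hp q hq hpq
    rw [mem_neighborFinset] at hp hq
    exact T.disjoint_int hG hu hp hq hpq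
  · intro p hp
    rw [mem_neighborFinset] at hp
    rw [Set.disjoint_compl_left_iff_subset]
    exact fun z hz => Or.inr ⟨u, rfl, p, hp, hz⟩
  · intro p hp
    rw [mem_neighborFinset] at hp
    exact T.notMem_int hp hu
  · exact fun h' => h' (Or.inl rfl)
  · intro z
    by_cases hz : z ∈ T.star {u}
    · rcases hz with hz | ⟨r, rfl, p, hp, hz⟩
      · exact Or.inr (Or.inl hz)
      · exact Or.inr (Or.inr ⟨p, by simpa using hp, hz⟩)
    · exact Or.inl hz

theorem reverse_of_fin_eq (hv : 3 ≤ G.degree v) {y : V} (hy : G.Adj v y) (hu : T.fin v y = u) :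
    G.Adj u (T.last v y) ∧ T.fin u (T.last v y) = v ∧ T.last u (T.last v y) = y ∧
      T.len u (T.last v y) = T.len v y := by
  subst hu
  have h := T.reverse hy hv
  exact ⟨T.adj_fin_last hy, h.2.1, h.1, h.2.2.2⟩

theorem sum_le_of_darts (hv : 3 ≤ G.degree v) (D : Finset (V × V))
    (hD : ∀ y, G.Adj v y → (T.fin v y, T.last v y) ∈ D) :
    G.degree v ≤ D.card ∧
      ∑ y ∈ G.neighborFinset v, (3 - T.len v y) ≤ ∑ d ∈ D, (3 - T.len d.1 d.2) := by
  classical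
  have hinj : Set.InjOn (fun y => (T.fin v y, T.last v y)) (G.neighborFinset v) := by
    intro y hy z hz hyz
    simp only [Finset.mem_coe, mem_neighborFinset] at hy hz
    have h₁ := (T.reverse hy hv).1
    have h₂ := (T.reverse hz hv).1
    simp only [Prod.mk.injEq] at hyz
    rw [hyz.1, hyz.2] at h₁
    exact h₁.symm.trans h₂
  have hsub : (G.neighborFinset v).image (fun y => (T.fin v y, T.last v y)) ⊆ D := by
    intro d hd
    obtain ⟨y, hy, rfl⟩ := Finset.mem_image.1 hd
    exact hD y (by simpa using hy)
  constructor
  · rw [← G.card_neighborFinset_eq_degree, ← Finset.card_image_of_injOn hinj]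
    exact Finset.card_le_card hsub
  · refine le_trans (le_of_eq ?_) (Finset.sum_le_sum_of_subset hsub)
    rw [Finset.sum_image hinj]
    refine Finset.sum_congr rfl fun y hy => ?_
    rw [mem_neighborFinset] at hy
    rw [(T.reverse hy hv).2.2.2]

theorem degree_le_of_fin_eq (hv : 3 ≤ G.degree v) (hall : ∀ y, G.Adj v y → T.fin v y = u) :
    G.degree v ≤ G.degree u ∧ ∑ y ∈ G.neighborFinset v, (3 - T.len v y) ≤
      ∑ y ∈ G.neighborFinset u, (3 - T.len u y) := by
  classical
  have := T.sum_le_of_darts hv ({u} ×ˢ G.neighborFinset u) (fun y hy => by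
    simp only [Finset.mem_product, Finset.mem_singleton, mem_neighborFinset]
    exact ⟨hall y hy, (T.reverse_of_fin_eq hv hy (hall y hy)).1⟩)
  simpa [Finset.sum_product] using this

theorem fin_eq_of_degree_eq (hv : 3 ≤ G.degree v) (hall : ∀ y, G.Adj v y → T.fin v y = u)
    (hdeg : G.degree u ≤ G.degree v) : ∀ x, G.Adj u x → T.fin u x = v := by
  classical
  have hsub : (G.neighborFinset v).image (T.last v) ⊆ G.neighborFinset u := by
    intro x hx
    obtain ⟨y, hy, rfl⟩ := Finset.mem_image.1 hx
    rw [mem_neighborFinset] at hy ⊢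
    exact (T.reverse_of_fin_eq hv hy (hall y hy)).1
  have hinj : Set.InjOn (T.last v) (G.neighborFinset v) := by
    intro y hy z hz hyz
    simp only [Finset.mem_coe, mem_neighborFinset] at hy hz
    rw [← (T.reverse_of_fin_eq hv hy (hall y hy)).2.2.1, hyz,
      (T.reverse_of_fin_eq hv hz (hall z hz)).2.2.1]
  have heq := Finset.eq_of_subset_of_card_le hsub (by
    rw [Finset.card_image_of_injOn hinj]
    simpa using hdeg)
  intro x hx
  rw [← mem_neighborFinset, ← heq, Finset.mem_image] at hx
  obtain ⟨y, hy, rfl⟩ := hx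
  rw [mem_neighborFinset] at hy
  exact (T.reverse_of_fin_eq hv hy (hall y hy)).2.1

open Classical in
/-- All threads of `u` end at `v` and conversely; the thread through `x₀` is shortened by one. -/
theorem not_solvable_dipole (hG : Crit G) (hu : 3 ≤ G.degree u) (hv : 3 ≤ G.degree v)
    (huv : ∀ x, G.Adj u x → T.fin u x = v) (hvu : ∀ y, G.Adj v y → T.fin v y = u) {x₀ : V}
    (hx₀ : G.Adj u x₀) {n : ℕ} (hn : T.len u x₀ = n + 1) {b c : Fin 4} (hbc : b ≠ c) :
    ¬ Solvable (G.neighborFinset u) (fun x => if x = x₀ then n else T.len u x)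
      (fun x => if x = x₀ then c else b) (fun x => if x = x₀ then b else c) := by
  have hth := T.thread hx₀
  rw [hn, huv x₀ hx₀] at hth
  obtain ⟨l', B', hth', hB, hyB, hyadj, -⟩ := hth.exists_shorten
  set y := T.last u x₀ with hy
  have hyint : y ∈ T.int u x₀ := by rw [hB]; exact Set.mem_insert _ _
  have hystar : y ∈ T.star {u} := Or.inr ⟨u, rfl, x₀, hx₀, hyint⟩
  have hvne : v ≠ u := huv x₀ hx₀ ▸ T.fin_ne hG hx₀
  have hvstar : v ∉ T.star {u} := T.notMem_star hv hvne
  have hvadj : ∀ z, G.Adj z v → z ∈ T.star {u} := by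
    intro z hz
    have h := T.reverse_of_fin_eq hv hz.symm (hvu z hz.symm)
    rcases (T.thread h.1).reverse.first_mem_or with h' | h'
    · rw [h.2.2.1] at h'
      exact Or.inr ⟨u, rfl, _, h.1, h'⟩
    · rw [h.2.2.1] at h'
      exact Or.inl h'
  have hyout : ∀ z, G.Adj z y → z ∈ insert v (T.star {u}) := by
    intro z hz
    rcases (T.thread hx₀).mem_or_of_adj hyint hz.symm with h | h | h
    · exact Or.inr (Or.inr ⟨u, rfl, x₀, hx₀, h⟩)
    · exact Or.inr (Or.inl h)
    · exact Or.inl (h.trans (huv x₀ hx₀))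
  obtain ⟨f, g, hfg, hfv, hfy, hgv, hgy⟩ := hG.exists_dipole (A := (insert v (T.star {u}))ᶜ)
    (v := v) (y := y) (by simp) (by simp [hystar]) (((hyadj v).2 (Or.inl rfl)).symm)
    (fun z hz hz' => hz (Or.inr (hvadj z hz'))) (fun z hz hz' => hz (hyout z hz')) (by
      intro z hz
      by_contra hcon
      push Not at hcon
      have hz' : z ∉ T.star {u} := fun h => hz (Or.inr h)
      obtain ⟨hdeg, hfin⟩ := T.fin_mem_of_isolated hG (by simpa using hu) hz' (by
        intro p hp
        by_contra hpS
        refine hcon p ?_ hp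
        rintro (rfl | h)
        exacts [hz' (hvadj z hp), hpS h])
      obtain ⟨p, hp⟩ := hG.exists_adj z
      have h := T.reverse_of_fin_eq hdeg hp (hfin p hp)
      exact hz (Or.inl (h.2.1.symm.trans (huv _ h.1)))) hbc
  have hBsub : ∀ p, (if p = x₀ then B' else T.int u p) ⊆ T.int u p := by
    intro p
    split_ifs with hp
    · rw [hp, hB]; exact Set.subset_insert _ _
    · rfl
  refine hG.not_solvable (u := u) (B := fun p => if p = x₀ then B' else T.int u p) (by simp) hfg
    ?_ ?_ ?_ ?_ ?_ ?_
  · intro p hp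
    rw [mem_neighborFinset] at hp
    split_ifs with h
    · subst h
      have := hth'.branch (A₀ := insert y (insert v (insert v (T.star {u}))ᶜ)) (f₀ := f) (c₀ := g)
        (Or.inl rfl)
      rwa [hfy, hgy] at this
    · have := (T.thread hp).branch (A₀ := insert y (insert v (insert v (T.star {u}))ᶜ)) (f₀ := f)
        (c₀ := g) (by rw [huv p hp]; exact Or.inr (Or.inl rfl))
      rwa [huv p hp, hfv, hgv] at this
  · intro p hp q hq hpq
    rw [mem_neighborFinset] at hp hq
    exact (T.disjoint_int hG hu hp hq hpq).mono (hBsub p) (hBsub q)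
  · intro p hp
    rw [mem_neighborFinset] at hp
    rw [Set.disjoint_left]
    rintro z (rfl | rfl | hz) hzp
    · by_cases h : p = x₀
      · rw [if_pos h] at hzp
        exact hyB hzp
      · exact Set.disjoint_left.1 (T.disjoint_int hG hu hp hx₀ h) (hBsub p hzp) hyint
    · exact T.notMem_int hp hv (hBsub p hzp)
    · exact hz (Or.inr (Or.inr ⟨u, rfl, p, hp, hBsub p hzp⟩))
  · intro p hp h
    rw [mem_neighborFinset] at hp
    exact T.notMem_int hp hu (hBsub p h)
  · rintro (h | h | h)
    · exact T.notMem_int hx₀ hu (h ▸ hyint)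
    · exact hvne h.symm
    · exact h (Or.inr (Or.inl rfl))
  · intro z
    by_cases hz : z ∈ T.star {u}
    · rcases hz with hz | ⟨r, rfl, p, hp, hz⟩
      · exact Or.inr (Or.inl hz)
      · by_cases h : p = x₀
        · rw [h, hB] at hz
          rcases hz with rfl | hz
          · exact Or.inl (Or.inl rfl)
          · exact Or.inr (Or.inr ⟨p, by simpa using hp, by rwa [if_pos h]⟩)
        · exact Or.inr (Or.inr ⟨p, by simpa using hp, by rwa [if_neg h]⟩)
    · refine Or.inl (Or.inr ?_)
      by_cases h : z = v
      · exact Or.inl h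
      · exact Or.inr fun h' => h'.elim h hz

end ThreadSystem

end Reductions

section LongThreads

variable {V : Type*} {G : SimpleGraph V} [Fintype V] [DecidableRel G.Adj]

namespace ThreadSystem

variable (T : ThreadSystem G) {u v x : V}

theorem false_of_dipole (hG : Crit G) (hu : 3 ≤ G.degree u) (hu5 : G.degree u ≤ 5)
    (hlen : ∀ x, G.Adj u x → 1 ≤ T.len u x)
    (hsum : ∑ x ∈ G.neighborFinset u, (3 - T.len u x) ≤ 5) (hv : 3 ≤ G.degree v)
    (huv : ∀ x, G.Adj u x → T.fin u x = v) (hvu : ∀ y, G.Adj v y → T.fin v y = u) : False := by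
  classical
  have h01 : (0 : Fin 4) ≠ 1 := by decide
  by_cases hone : ∃ x₀, G.Adj u x₀ ∧ T.len u x₀ = 1
  · obtain ⟨x₀, hx₀, h1⟩ := hone
    have h2 : ∀ x, G.Adj u x → T.len u x ≠ 2 := by
      intro x hx hx2
      exact T.no_cycle hG hu hx₀ hx ((huv _ hx₀).trans (huv _ hx).symm) (by omega) (by omega)
    obtain ⟨x, hx, hx3⟩ : ∃ x, G.Adj u x ∧ T.len u x = 3 := by
      by_contra hcon
      push Not at hcon
      have hle : (G.neighborFinset u).card • 2 ≤ ∑ x ∈ G.neighborFinset u, (3 - T.len u x) := by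
        refine Finset.card_nsmul_le_sum _ _ _ fun x hx => ?_
        rw [mem_neighborFinset] at hx
        have := hcon x hx
        have := h2 x hx
        have := T.len_le hx
        omega
      rw [card_neighborFinset_eq_degree, smul_eq_mul] at hle
      omega
    have hxx : x ≠ x₀ := by rintro rfl; omega
    refine T.not_solvable_dipole hG hu hv huv hvu hx₀ (n := 0) h1 h01 (solvable_of_free ?_ ?_ 2 ?_ ?_
      (x := x) (by simpa using hx) 2 (by omega) (by simp; omega) (Finset.univ.erase 2) (by decide) ?_)
    · intro y hy
      rw [mem_neighborFinset] at hy
      have := T.len_le hy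
      split_ifs <;> omega
    · intro y _
      split_ifs <;> decide
    · intro y _ _
      split_ifs <;> decide
    · intro y _ _
      split_ifs <;> decide
    · intro ξ hξ
      simp only [hxx, if_false, hx3]
      exact PathRel.three_of_ne _ _ _ _ h01 (by decide) (Finset.ne_of_mem_erase hξ)
  · push Not at hone
    have h2 : ∀ x, G.Adj u x → 2 ≤ T.len u x := by
      intro x hx
      have := hone x hx
      have := hlen x hx
      omega
    have hcard : 1 < (G.neighborFinset u).card := by simp; omega
    obtain ⟨x₀, hx₀, x, hx, hxx⟩ := Finset.one_lt_card.1 hcard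
    rw [mem_neighborFinset] at hx₀ hx
    have h0 := h2 x₀ hx₀
    refine T.not_solvable_dipole hG hu hv huv hvu hx₀ (n := T.len u x₀ - 1) (by omega) h01
      (solvable_of_free ?_ ?_ 0 ?_ ?_
      (x := x) (by simpa using hx) 2 (by omega) (by simp; omega) (Finset.univ.erase 0) (by decide) ?_)
    · intro y hy
      rw [mem_neighborFinset] at hy
      have := T.len_le hy
      have := T.len_le hx₀
      split_ifs <;> omega
    · intro y _
      split_ifs <;> decide
    · intro y hy
      rw [mem_neighborFinset] at hy
      have := h2 y hy
      split_ifs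
      · intro; decide
      · omega
    · intro y hy
      rw [mem_neighborFinset] at hy
      have := h2 y hy
      split_ifs <;> omega
    · intro ξ hξ
      have hξ' := Finset.ne_of_mem_erase hξ
      simp only [hxx.symm, if_false]
      have : T.len u x = 2 ∨ T.len u x = 3 := by
        have := h2 x hx
        have := T.len_le hx
        omega
      rcases this with h | h
      · rw [h]
        exact PathRel.two_of_eq_left _ _ _ h01 hξ'
      · rw [h]
        exact PathRel.three_of_ne _ _ _ _ h01 h01 hξ'

theorem exists_partialColoring_star_singleton (hG : Crit G) (hu : 3 ≤ G.degree u)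
    (hiso : ∀ v, 3 ≤ G.degree v → ¬ ∀ y, G.Adj v y → T.fin v y = u) :
    ∃ f c, PartialColoring G (T.star {u})ᶜ ∅ f c :=
  T.exists_partialColoring hG (Set.singleton_nonempty u) (by simpa using hu)
    fun v _ hv hall => hiso v hv (by simpa using hall)

/-- The threads at a vertex of small degree cannot all be long. -/
theorem not_sum_le_five (hG : Crit G) : ∀ (u : V), 3 ≤ G.degree u → G.degree u ≤ 5 →
    (∀ x, G.Adj u x → 1 ≤ T.len u x) → ¬ ∑ x ∈ G.neighborFinset u, (3 - T.len u x) ≤ 5 := by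
  suffices h : ∀ n, ∀ u, G.degree u = n → 3 ≤ G.degree u → G.degree u ≤ 5 →
      (∀ x, G.Adj u x → 1 ≤ T.len u x) → ¬ ∑ x ∈ G.neighborFinset u, (3 - T.len u x) ≤ 5 from
    fun u => h _ u rfl
  intro n
  induction n using Nat.strong_induction_on with
  | _ n ih =>
    rintro u rfl hu hu5 hlen hsum
    by_cases hiso : ∃ v, 3 ≤ G.degree v ∧ ∀ y, G.Adj v y → T.fin v y = u
    · obtain ⟨v, hv, hall⟩ := hiso
      obtain ⟨hdeg, hsum'⟩ := T.degree_le_of_fin_eq hv hall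
      rcases hdeg.lt_or_eq with hlt | heq
      · refine ih _ hlt v rfl hv (by omega) (fun y hy => ?_) (hsum'.trans hsum)
        obtain ⟨h₁, -, -, h₂⟩ := T.reverse_of_fin_eq hv hy (hall y hy)
        rw [← h₂]
        exact hlen _ h₁
      · exact T.false_of_dipole hG hu hu5 hlen hsum hv (T.fin_eq_of_degree_eq hv hall heq.ge) hall
    · push Not at hiso
      obtain ⟨f, c, h⟩ := T.exists_partialColoring_star_singleton hG hu (fun v hv hall => by
        obtain ⟨y, hy, hne⟩ := hiso v hv
        exact hne (hall y hy))
      refine T.not_solvable hG hu h (solvable_of_sum_le ?_ ?_ ?_ (by simpa using hu)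
        (by simpa using hu5) hsum)
      · intro x hx
        exact T.len_le (by simpa using hx)
      · intro x hx
        exact hlen x (by simpa using hx)
      · intro x hx
        exact h.c_ne (T.fin_notMem_star hG (by simpa using hx)) (by simp)

theorem false_of_darts (hG : Crit G) (hv : 3 ≤ G.degree v) (D : Finset (V × V))
    (hD : ∀ y, G.Adj v y → (T.fin v y, T.last v y) ∈ D) (hcard : D.card ≤ 5)
    (hsum : ∑ d ∈ D, (3 - T.len d.1 d.2) ≤ 5) (hlen : ∀ d ∈ D, 1 ≤ T.len d.1 d.2) : False := by
  obtain ⟨h₁, h₂⟩ := T.sum_le_of_darts hv D hD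
  refine T.not_sum_le_five hG v hv (by omega) (fun y hy => ?_) (h₂.trans hsum)
  rw [← (T.reverse hy hv).2.2.2]
  exact hlen _ (hD y hy)

theorem exists_le_of_sum_le_four {ι : Type*} {N : Finset ι} {t : ι → ℕ} (hN : 3 ≤ N.card)
    {x₀ : ι} (hx₀ : x₀ ∈ N) (h0 : t x₀ = 0) (hsum : ∑ x ∈ N, (3 - t x) ≤ 4) :
    (∃ x ∈ N, 3 ≤ t x) ∧ ∑ x ∈ N, (2 - t x) ≤ 2 := by
  classical
  rw [← Finset.add_sum_erase _ _ hx₀, h0] at hsum ⊢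
  have hcard : (N.erase x₀).card + 1 = N.card := Finset.card_erase_add_one hx₀
  constructor
  · by_contra hcon
    push Not at hcon
    have : (N.erase x₀).card • 1 ≤ ∑ x ∈ N.erase x₀, (3 - t x) :=
      Finset.card_nsmul_le_sum _ _ _ fun x hx => by
        have := hcon x (Finset.mem_of_mem_erase hx)
        omega
    rw [smul_eq_mul] at this
    omega
  · suffices h : ∑ x ∈ N.erase x₀, (2 - t x) = 0 by omega
    refine Finset.sum_eq_zero fun x hx => ?_
    have := Finset.single_le_sum (f := fun x => 3 - t x) (fun _ _ => Nat.zero_le _) hx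
    omega

/-- At a vertex of degree three or four, threads of total deficiency four cannot occur. -/
theorem not_sum_le_four (hG : Crit G) (hu : 3 ≤ G.degree u) (hu4 : G.degree u ≤ 4) :
    ¬ ∑ x ∈ G.neighborFinset u, (3 - T.len u x) ≤ 4 := by
  intro hsum
  have key : ∀ v, 3 ≤ G.degree v → G.degree v ≤ 4 →
      ∑ x ∈ G.neighborFinset v, (3 - T.len v x) ≤ 4 →
      (∃ x, G.Adj v x ∧ T.len v x = 0) ∧ (∃ x, G.Adj v x ∧ T.len v x = 3) ∧
        ∑ x ∈ G.neighborFinset v, (2 - T.len v x) ≤ 2 := by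
    intro v hv hv4 hsum
    obtain ⟨y, hy, hy0⟩ : ∃ x, G.Adj v x ∧ T.len v x = 0 := by
      by_contra hcon
      push Not at hcon
      exact T.not_sum_le_five hG v hv (by omega) (fun x hx => Nat.pos_of_ne_zero (hcon x hx))
        (by omega)
    obtain ⟨⟨x, hx, hx3⟩, h⟩ := exists_le_of_sum_le_four (by simpa using hv)
      (by simpa using hy) hy0 hsum
    rw [mem_neighborFinset] at hx
    exact ⟨⟨y, hy, hy0⟩, ⟨x, hx, le_antisymm (T.len_le hx) hx3⟩, h⟩
  obtain ⟨-, ⟨x, hx, hx3⟩, hsum₂⟩ := key u hu hu4 hsum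
  obtain ⟨f, c, h⟩ := T.exists_partialColoring_star_singleton hG hu fun v hv hall => by
    obtain ⟨h₁, h₂⟩ := T.degree_le_of_fin_eq hv hall
    obtain ⟨⟨y, hy, hy0⟩, ⟨z, hz, hz3⟩, -⟩ := key v hv (by omega) (by omega)
    exact T.no_cycle hG hv hy hz ((hall y hy).trans (hall z hz).symm) (by omega) (by omega)
  refine T.not_solvable hG hu h (solvable_of_three (fun y hy => T.len_le (by simpa using hy))
    (fun y hy => h.c_ne (T.fin_notMem_star hG (by simpa using hy)) (by simp)) (x := x)
    (by simpa using hx) hx3 (by simp; omega) hsum₂)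

end ThreadSystem

end LongThreads

section BadVertices

variable {V : Type*} {G : SimpleGraph V}

theorem Thread.adj_of_two {u x l w : V} {B : Set V} (h : Thread G u x l w B 2) : G.Adj x l := by
  cases h with
  | cons h₁ _ _ _ =>
    have := h₁.adj_first
    cases h₁ with
    | cons h₂ _ _ _ =>
      cases h₂ with
      | nil _ => exact this

variable [Fintype V] [DecidableRel G.Adj]

theorem neighborFinset_eq_triple [DecidableEq V] {u w p q : V}
    (h : ∀ z, G.Adj u z ↔ z = w ∨ z = p ∨ z = q) : G.neighborFinset u = {w, p, q} := by
  ext z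
  simp [h]

theorem degree_eq_three {u w p q : V} (h : ∀ z, G.Adj u z ↔ z = w ∨ z = p ∨ z = q)
    (hwp : w ≠ p) (hwq : w ≠ q) (hpq : p ≠ q) : G.degree u = 3 := by
  classical
  rw [← card_neighborFinset_eq_degree, neighborFinset_eq_triple h,
    Finset.card_eq_three.2 ⟨w, p, q, hwp, hwq, hpq, rfl⟩]

theorem exists_triple_of_degree_eq_three {u w : V} (hu : G.degree u = 3) (hw : G.Adj u w) :
    ∃ p q, w ≠ p ∧ w ≠ q ∧ p ≠ q ∧ ∀ z, G.Adj u z ↔ z = w ∨ z = p ∨ z = q := by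
  classical
  have hcard : ((G.neighborFinset u).erase w).card = 2 := by
    rw [Finset.card_erase_of_mem (by simpa using hw), card_neighborFinset_eq_degree, hu]
  obtain ⟨p, q, hpq, h⟩ := Finset.card_eq_two.1 hcard
  have hmem : ∀ z, z ≠ w ∧ G.Adj u z ↔ z = p ∨ z = q := by
    intro z
    simpa using Finset.ext_iff.1 h z
  refine ⟨p, q, (((hmem p).2 (Or.inl rfl)).1).symm, (((hmem q).2 (Or.inr rfl)).1).symm, hpq,
    fun z => ?_⟩
  by_cases hz : z = w
  · simp [hz, hw]
  · simp [← hmem z, hz]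

namespace ThreadSystem

variable (T : ThreadSystem G) {u v w p q : V}

/-- A vertex of degree three whose threads have the largest possible total length. -/
def Bad (u : V) : Prop := G.degree u = 3 ∧ ∑ x ∈ G.neighborFinset u, T.len u x = 4

/-- A bad vertex `u` adjacent to `w`, the other neighbors being `p` and `q`. -/
structure BadAt (u w p q : V) : Prop where
  adj : ∀ z, G.Adj u z ↔ z = w ∨ z = p ∨ z = q
  ne_left : w ≠ p
  ne_right : w ≠ q
  ne : p ≠ q
  three_le_degree : 3 ≤ G.degree w
  len : T.len u p = 3 ∧ T.len u q = 1 ∨ T.len u p = 2 ∧ T.len u q = 2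

variable {T}

theorem Bad.exists_badAt (h : T.Bad u) (hw : G.Adj u w) (hdeg : 3 ≤ G.degree w) :
    ∃ p q, T.BadAt u w p q := by
  classical
  obtain ⟨p, q, hwp, hwq, hpq, hadj⟩ := exists_triple_of_degree_eq_three h.1 hw
  have hsum := h.2
  have h0 := (T.of_three_le_degree hw hdeg).2.2.2
  rw [neighborFinset_eq_triple hadj, Finset.sum_insert (by simp [hwp, hwq]),
    Finset.sum_pair hpq, h0] at hsum
  have hp := T.len_le ((hadj p).2 (by simp))
  have hq := T.len_le ((hadj q).2 (by simp))
  have : T.len u p = 3 ∧ T.len u q = 1 ∨ T.len u p = 2 ∧ T.len u q = 2 ∨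
      T.len u q = 3 ∧ T.len u p = 1 := by omega
  rcases this with h | h | h
  · exact ⟨p, q, hadj, hwp, hwq, hpq, hdeg, Or.inl h⟩
  · exact ⟨p, q, hadj, hwp, hwq, hpq, hdeg, Or.inr h⟩
  · exact ⟨q, p, fun z => by rw [hadj, or_comm (a := z = p)], hwq, hwp, hpq.symm, hdeg, Or.inl h⟩

theorem Bad.exists_adj (h : T.Bad u) (hG : Crit G) : ∃ w, G.Adj u w ∧ 3 ≤ G.degree w := by
  by_contra hcon
  push Not at hcon
  refine T.not_sum_le_five hG u h.1.ge (by rw [h.1]; omega) (fun x hx => ?_) ?_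
  · by_contra h0
    have := T.three_le_degree_of_len hx (by omega)
    have := hcon x hx
    omega
  · have : ∑ x ∈ G.neighborFinset u, (3 - T.len u x) + ∑ x ∈ G.neighborFinset u, T.len u x =
        G.degree u * 3 := by
      rw [← Finset.sum_add_distrib, ← card_neighborFinset_eq_degree, ← smul_eq_mul]
      refine Finset.sum_eq_card_nsmul fun x hx => ?_
      have := T.len_le ((mem_neighborFinset ..).1 hx)
      omega
    rw [h.1, h.2] at this
    omega

namespace BadAt

theorem degree_eq (h : T.BadAt u w p q) : G.degree u = 3 :=
  degree_eq_three h.adj h.ne_left h.ne_right h.ne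

theorem adj_hub (h : T.BadAt u w p q) : G.Adj u w := (h.adj w).2 (by simp)

theorem adj_left (h : T.BadAt u w p q) : G.Adj u p := (h.adj p).2 (by simp)

theorem adj_right (h : T.BadAt u w p q) : G.Adj u q := (h.adj q).2 (by simp)

theorem hub (h : T.BadAt u w p q) :
    T.last u w = u ∧ T.fin u w = w ∧ T.int u w = ∅ ∧ T.len u w = 0 :=
  T.of_three_le_degree h.adj_hub h.three_le_degree

theorem exists_partialColoring (h : T.BadAt u w p q) (hG : Crit G) :
    ∃ f c, PartialColoring G (T.star {u})ᶜ ∅ f c := by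
  classical
  refine T.exists_partialColoring_star_singleton hG h.degree_eq.ge fun v hv hall => ?_
  have hfin := T.fin_eq_of_degree_eq hv hall (h.degree_eq.trans_le hv)
  rcases h.len with ⟨hp, hq⟩ | ⟨hp, hq⟩
  · refine T.no_cycle hG h.degree_eq.ge h.adj_hub h.adj_left
      ((hfin _ h.adj_hub).trans (hfin _ h.adj_left).symm) ?_ ?_ <;> simp [hp, h.hub.2.2.2]
  · have := T.not_solvable_dipole hG h.degree_eq.ge hv hfin hall h.adj_left (n := 1) hp
      (b := 0) (c := 1) (by decide)
    rw [neighborFinset_eq_triple h.adj] at this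
    refine this (solvable_triple h.ne_left h.ne_right h.ne ?_)
    simp only [h.ne_left, h.ne.symm, if_true, if_false, h.hub.2.2.2, hq]
    decide

theorem not_pathRel (h : T.BadAt u w p q) (hG : Crit G) {f c : V → Fin 4}
    (hfc : PartialColoring G (T.star {u})ᶜ ∅ f c) :
    ¬ ∃ a ξ₁, PathRel (T.len u p) (f (T.fin u p)) (c (T.fin u p)) a ξ₁ ∧
      ∃ ξ₂, PathRel (T.len u q) (f (T.fin u q)) (c (T.fin u q)) a ξ₂ ∧
      ∃ ξ₃, PathRel 0 (f w) (c w) a ξ₃ ∧ ¬ (ξ₁ = ξ₂ ∧ ξ₁ = ξ₃) := by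
  classical
  intro hcon
  refine T.not_solvable hG h.degree_eq.ge hfc ?_
  have hN : G.neighborFinset u = {p, q, w} := neighborFinset_eq_triple fun z => by
    rw [h.adj]; tauto
  rw [hN]
  refine solvable_triple h.ne h.ne_left.symm h.ne_right.symm ?_
  simpa only [h.hub.2.1, h.hub.2.2.2] using hcon

theorem c_ne (h : T.BadAt u w p q) (hG : Crit G) {f c : V → Fin 4}
    (hfc : PartialColoring G (T.star {u})ᶜ ∅ f c) : f (T.fin u p) ≠ c (T.fin u p) ∧
      f (T.fin u q) ≠ c (T.fin u q) ∧ f w ≠ c w := by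
  refine ⟨hfc.c_ne (T.fin_notMem_star hG h.adj_left) (by simp),
    hfc.c_ne (T.fin_notMem_star hG h.adj_right) (by simp), ?_⟩
  have := hfc.c_ne (T.fin_notMem_star hG h.adj_hub) (by simp)
  rwa [h.hub.2.1] at this

theorem fin_ne_hub (h : T.BadAt u w p q) (hG : Crit G) : T.fin u p ≠ w ∧ T.fin u q ≠ w := by
  obtain ⟨f, c, hfc⟩ := h.exists_partialColoring hG
  obtain ⟨h₁, h₂, h₃⟩ := h.c_ne hG hfc
  have hn := h.not_pathRel hG hfc
  constructor <;> intro he <;> refine hn ?_ <;> rcases h.len with ⟨hp, hq⟩ | ⟨hp, hq⟩ <;>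
    rw [hp, hq]
  · exact pathRel_three_one_zero _ _ _ _ _ _ h₁ h₂ h₃ (Or.inr (Or.inl (by rw [he])))
  · exact pathRel_two_two_zero _ _ _ _ _ _ h₁ h₂ h₃ (Or.inl (by rw [he]))
  · exact pathRel_three_one_zero _ _ _ _ _ _ h₁ h₂ h₃ (Or.inl (by rw [he]))
  · exact pathRel_two_two_zero _ _ _ _ _ _ h₁ h₂ h₃ (Or.inr (by rw [he]))

theorem fin_ne_of_adj (h : T.BadAt u w p q) (hG : Crit G) (hv : G.degree v = 3)
    (hvw : G.Adj v w) {x : V} (hx : x = p ∨ x = q) : T.fin u x ≠ v := by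
  classical
  rintro rfl
  have hux : G.Adj u x := (h.adj x).2 (Or.inr hx)
  have hth := T.thread hux
  have hpos : T.len u x ≠ 0 := by
    rcases h.len with ⟨hp, hq⟩ | ⟨hp, hq⟩ <;> rcases hx with rfl | rfl <;> omega
  have hlast : T.last u x ∈ T.int u x := hth.reverse.first_mem hpos
  have hlastw : T.last u x ≠ w := by
    rintro rfl
    exact T.notMem_int hux h.three_le_degree hlast
  rcases h.len with ⟨hp, hq⟩ | ⟨hp, hq⟩
  · obtain ⟨f, c, hfc⟩ := h.exists_partialColoring hG
    have hvA := T.fin_notMem_star hG hux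
    have hwA : w ∈ (T.star {u})ᶜ := by
      have := T.fin_notMem_star hG h.adj_hub
      rwa [h.hub.2.1] at this
    obtain ⟨r, s, hlr, hls, hrs, hadj⟩ :=
      exists_triple_of_degree_eq_three hv (T.adj_fin_last hux)
    obtain ⟨s', hs'⟩ : ∃ s', ∀ z ∈ (T.star {u})ᶜ, G.Adj (T.fin u x) z → z = w ∨ z = s' := by
      have hl : ∀ z ∈ (T.star {u})ᶜ, z ≠ T.last u x := by
        rintro z hz rfl
        exact hz (Or.inr ⟨u, rfl, x, hux, hlast⟩)
      rcases (hadj w).1 hvw with h' | rfl | rfl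
      · exact absurd h'.symm hlastw
      · exact ⟨s, fun z hz hz' => ((hadj z).1 hz').resolve_left (hl z hz)⟩
      · exact ⟨r, fun z hz hz' => (((hadj z).1 hz').resolve_left (hl z hz)).symm⟩
    obtain ⟨y, hyA, hy, hyc, huniq⟩ := hfc.unique _ hvA (by simp)
    have hfc' := hfc.setUnique hwA hvw fun z hz hz' hzw => by
      rcases hs' z hz hz' with rfl | rfl
      · rfl
      · rcases hs' y hyA hy with rfl | rfl
        · exact huniq z hz hz' (hzw.trans hyc)
        · exact (huniq w hwA hvw (hzw.symm.trans hyc)).symm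
    rw [Set.empty_sdiff] at hfc'
    obtain ⟨h₁, h₂, h₃⟩ := h.c_ne hG hfc'
    refine h.not_pathRel hG hfc' ?_
    rw [hp, hq]
    refine pathRel_three_one_zero _ _ _ _ _ _ h₁ h₂ h₃ (Or.inr (Or.inr ?_))
    rcases hx with rfl | rfl
    · exact Or.inl (by simp)
    · exact Or.inr (by simp)
  · have h2 : T.len u x = 2 := by rcases hx with rfl | rfl <;> assumption
    have hfirst : x ∈ T.int u x := hth.first_mem hpos
    rw [h2] at hth
    have hd := h.degree_eq
    have hw := h.three_le_degree
    have hne : ∀ {a b}, a ∈ T.int u x → 3 ≤ G.degree b → a ≠ b := by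
      rintro a b ha hb rfl
      exact T.notMem_int hux hb ha
    exact hG.no_cycle u x (T.last u x) (T.fin u x) w hux hth.adj_of_two (T.adj_fin_last hux).symm
      hvw h.adj_hub.symm (hne hlast hd.ge).symm (T.fin_ne hG hux).symm (hne hfirst hv.ge)
      (hne hfirst hw) (hne hlast hw)

end BadAt

end ThreadSystem

end BadVertices

section HubOfBadVertices

variable {V : Type*} {G : SimpleGraph V} [Fintype V] [DecidableRel G.Adj]

namespace ThreadSystem

variable {T : ThreadSystem G} {u v w p q : V}

open Classical in
/-- Seen from its hub, a bad vertex behaves like a path with two interior vertices. -/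
theorem BadAt.exists_branch (h : T.BadAt u w p q) (hG : Crit G) {A₀ : Set V} {f c : V → Fin 4}
    (hp : T.fin u p ∈ A₀) (hq : T.fin u q ∈ A₀) (hfp : f (T.fin u p) ≠ c (T.fin u p))
    (hfq : f (T.fin u q) ≠ c (T.fin u q)) :
    ∃ β γ, β ≠ γ ∧ Branch G A₀ f c w u (insert u (⋃ s ∈ ({p, q} : Finset V), T.int u s))
      (PathRel 2 β γ) := by
  have hmem : ∀ s ∈ ({p, q} : Finset V), s = p ∨ s = q := by simp
  have hadj : ∀ s ∈ ({p, q} : Finset V), G.Adj u s := fun s hs => (h.adj s).2 (Or.inr (hmem s hs))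
  have hb := Branch.hub (G := G) (A₀ := A₀) (f₀ := f) (c₀ := c) w u {p, q} (by simpa using h.adj)
    (B := T.int u)
    (R := fun s => PathRel (T.len u s) (f (T.fin u s)) (c (T.fin u s)))
    (fun s hs => (T.thread (hadj s hs)).branch (by rcases hmem s hs with rfl | rfl <;> assumption))
    (fun s hs s' hs' hne => T.disjoint_int hG h.degree_eq.ge (hadj s hs) (hadj s' hs') hne)
    (fun s hs => T.notMem_int (hadj s hs) h.degree_eq.ge)
  obtain ⟨β, γ, hβγ, hR⟩ : ∃ β γ, β ≠ γ ∧ ∀ a ξ, PathRel 2 β γ a ξ → ξ ≠ a ∧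
      ∃ η₁, PathRel (T.len u p) (f (T.fin u p)) (c (T.fin u p)) ξ η₁ ∧
      ∃ η₂, PathRel (T.len u q) (f (T.fin u q)) (c (T.fin u q)) ξ η₂ ∧ ¬ (η₁ = a ∧ η₂ = a) := by
    rcases h.len with ⟨h₁, h₂⟩ | ⟨h₁, h₂⟩ <;> rw [h₁, h₂]
    · exact exists_pathRel_two_of_three_one _ _ _ _ hfp hfq
    · exact exists_pathRel_two_of_two_two _ _ _ _ hfp hfq
  refine ⟨β, γ, hβγ, hb.mono fun a ξ hrel => ?_⟩
  obtain ⟨hne, η₁, h₁, η₂, h₂, hnot⟩ := hR a ξ hrel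
  refine ⟨hne, fun s => if s = p then η₁ else if s = q then η₂ else a, ?_, ?_, ?_⟩
  · simp [h₁, h₂, h.ne.symm]
  · simp [h.ne_left, h.ne_right]
  · refine Happy.of_ne h.ne_left h.ne_right h.ne ?_
    simpa [h.ne_left, h.ne_right, h.ne.symm, eq_comm] using hnot

theorem BadAt.fin_notMem (h : T.BadAt u w p q) (hG : Crit G) {X : Set V}
    (hX : ∀ v ∈ X, G.degree v = 3 ∧ G.Adj v w) {s : V} (hs : s = p ∨ s = q) :
    T.fin u s ∉ insert w X := by
  rintro (h' | h')
  · rcases hs with rfl | rfl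
    exacts [(h.fin_ne_hub hG).1 h', (h.fin_ne_hub hG).2 h']
  · exact h.fin_ne_of_adj hG (hX _ h').1 (hX _ h').2 hs rfl

theorem fin_notMem_of_hub (hG : Crit G) (hw : 3 ≤ G.degree w) {X : Set V} {p q : V → V}
    (hX : ∀ u ∈ X, T.BadAt u w (p u) (q u)) {x : V} (hx : G.Adj w x) (hxX : x ∉ X) :
    T.fin w x ∉ insert w X := by
  rintro (h | h)
  · exact T.fin_ne hG hx h
  · obtain ⟨h₁, h₂, h₃, -⟩ := T.reverse_of_fin_eq hw hx rfl
    have hb := hX _ h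
    rcases (hb.adj _).1 h₁ with h' | h' | h'
    · rw [h', hb.hub.1] at h₃
      exact hxX (h₃ ▸ h)
    · rw [h'] at h₂
      exact (hb.fin_ne_hub hG).1 h₂
    · rw [h'] at h₂
      exact (hb.fin_ne_hub hG).2 h₂

open Classical in
/-- A vertex `w` adjacent to the bad vertices in `X` cannot be reduced. -/
theorem exists_not_solvable_hub (hG : Crit G) (hw : 3 ≤ G.degree w) (X : Set V) (p q : V → V)
    (hX : ∀ u ∈ X, T.BadAt u w (p u) (q u))
    (hiso : ∀ v, v ∉ insert w X → 3 ≤ G.degree v → ¬ ∀ y, G.Adj v y → T.fin v y ∈ insert w X) :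
    ∃ b c, (∀ x ∈ G.neighborFinset w, b x ≠ c x) ∧
      ¬ Solvable (G.neighborFinset w) (fun x => if x ∈ X then 2 else T.len w x) b c := by
  have hX3 : ∀ v ∈ X, G.degree v = 3 ∧ G.Adj v w := fun v hv =>
    ⟨(hX v hv).degree_eq, (hX v hv).adj_hub⟩
  have hR3 : ∀ r ∈ insert w X, 3 ≤ G.degree r := by
    rintro r (rfl | hr)
    exacts [hw, (hX3 r hr).1.ge]
  have hwX : w ∉ X := fun h => (hX3 w h).2.ne rfl
  obtain ⟨f, c, hfc⟩ := T.exists_partialColoring hG (Set.insert_nonempty w X) hR3 hiso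
  have hA : ∀ {v}, 3 ≤ G.degree v → v ∉ insert w X → v ∈ (T.star (insert w X))ᶜ :=
    fun hv hvR => T.notMem_star hv hvR
  let B : V → Set V := fun x =>
    if x ∈ X then insert x (⋃ s ∈ ({p x, q x} : Finset V), T.int x s) else T.int w x
  have hmemB : ∀ x ∈ G.neighborFinset w, ∀ z ∈ B x, (x ∈ X ∧ z = x) ∨
      ∃ r ∈ insert w X, ∃ s, G.Adj r s ∧ z ∈ T.int r s ∧ T.fin r s ∉ insert w X ∧
        (x ∈ X ∧ r = x ∨ x ∉ X ∧ r = w ∧ s = x) := by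
    intro x hx z hz
    by_cases hxX : x ∈ X
    · simp only [B, hxX, if_true] at hz
      rcases hz with rfl | hz
      · exact Or.inl ⟨hxX, rfl⟩
      · simp only [Set.mem_iUnion] at hz
        obtain ⟨s, hs, hz⟩ := hz
        have hs' : s = p x ∨ s = q x := by simpa using hs
        exact Or.inr ⟨x, Or.inr hxX, s, ((hX x hxX).adj s).2 (Or.inr hs'), hz,
          (hX x hxX).fin_notMem hG hX3 hs', Or.inl ⟨hxX, rfl⟩⟩
    · simp only [B, hxX, if_false] at hz
      rw [mem_neighborFinset] at hx
      exact Or.inr ⟨w, Or.inl rfl, x, hx, hz, fin_notMem_of_hub hG hw hX hx hxX,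
        Or.inr ⟨hxX, rfl, rfl⟩⟩
  have hbranch : ∀ x, ∃ β γ, x ∈ G.neighborFinset w → β ≠ γ ∧
      Branch G (T.star (insert w X))ᶜ f c w x (B x)
        (PathRel (if x ∈ X then 2 else T.len w x) β γ) := by
    intro x
    by_cases hx : x ∈ G.neighborFinset w
    swap
    · exact ⟨0, 0, fun h => absurd h hx⟩
    by_cases hxX : x ∈ X
    · have hp := hA (T.three_le_degree_fin (hX x hxX).adj_left)
        ((hX x hxX).fin_notMem hG hX3 (Or.inl rfl))
      have hq := hA (T.three_le_degree_fin (hX x hxX).adj_right)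
        ((hX x hxX).fin_notMem hG hX3 (Or.inr rfl))
      obtain ⟨β, γ, hne, hb⟩ := (hX x hxX).exists_branch hG hp hq (hfc.c_ne hp (by simp))
        (hfc.c_ne hq (by simp))
      refine ⟨β, γ, fun _ => ⟨hne, ?_⟩⟩
      simpa only [B, hxX, if_true] using hb
    · have hx' := (mem_neighborFinset ..).1 hx
      have hend := hA (T.three_le_degree_fin hx') (fin_notMem_of_hub hG hw hX hx' hxX)
      refine ⟨_, _, fun _ => ⟨hfc.c_ne hend (by simp), ?_⟩⟩
      simpa only [B, hxX, if_false] using (T.thread hx').branch hend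
  choose b g hbg using hbranch
  refine ⟨b, g, fun x hx => (hbg x hx).1, hG.not_solvable (B := B) (by simp) hfc
    (fun x hx => (hbg x hx).2) ?_ ?_ ?_ ?_ ?_⟩
  · intro x hx y hy hxy
    rw [Set.disjoint_left]
    intro z hzx hzy
    rcases hmemB x hx z hzx with ⟨hxX, rfl⟩ | ⟨r, hr, s, hrs, hz, hfin, hcase⟩ <;>
      rcases hmemB y hy z hzy with ⟨hyX, rfl⟩ | ⟨r', hr', s', hrs', hz', hfin', hcase'⟩
    · exact hxy rfl
    · exact T.notMem_int hrs' (hX3 _ hxX).1.ge hz'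
    · exact T.notMem_int hrs (hX3 _ hyX).1.ge hz
    · rcases T.eq_or_eq_of_mem_int hrs (hR3 r hr) hz hrs' (hR3 r' hr') hz' with
        ⟨rfl, rfl⟩ | ⟨rfl, -⟩
      · rcases hcase with ⟨hx, rfl⟩ | ⟨hx, rfl, rfl⟩ <;>
          rcases hcase' with ⟨hy, rfl⟩ | ⟨hy, h₁, h₂⟩
        · exact hxy rfl
        · exact hwX (h₁ ▸ hx)
        · exact hwX hy
        · exact hxy h₂
      · exact hfin hr'
  · intro x hx
    rw [Set.disjoint_compl_left_iff_subset]
    intro z hz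
    rcases hmemB x hx z hz with ⟨hxX, rfl⟩ | ⟨r, hr, s, hrs, hz, -⟩
    · exact Or.inl (Or.inr hxX)
    · exact Or.inr ⟨r, hr, s, hrs, hz⟩
  · intro x hx hwB
    rcases hmemB x hx w hwB with ⟨hxX, rfl⟩ | ⟨r, hr, s, hrs, hz, -⟩
    · exact hwX hxX
    · exact T.notMem_int hrs hw hz
  · exact fun h => h (Or.inl (Or.inl rfl))
  · intro z
    by_cases hz : z ∈ T.star (insert w X)
    swap
    · exact Or.inl hz
    right
    rcases hz with (hz | hz) | ⟨r, rfl | hr, s, hrs, hz⟩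
    · exact Or.inl hz
    · refine Or.inr ⟨z, by simpa using (hX3 z hz).2.symm, ?_⟩
      simp only [B, hz, if_true]
      exact Set.mem_insert _ _
    · by_cases hs : s ∈ X
      · rw [(T.of_three_le_degree hrs (hX3 s hs).1.ge).2.2.1] at hz
        exact absurd hz (Set.notMem_empty z)
      · refine Or.inr ⟨s, by simpa using hrs, ?_⟩
        simpa only [B, hs, if_false] using hz
    · rcases ((hX r hr).adj s).1 hrs with h | h
      · rw [h, (hX r hr).hub.2.2.1] at hz
        exact absurd hz (Set.notMem_empty z)
      · refine Or.inr ⟨r, by simpa using (hX3 r hr).2.symm, ?_⟩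
        simp only [B, hr, if_true]
        refine Or.inr ?_
        simp only [Set.mem_iUnion]
        exact ⟨s, by simpa using h, hz⟩

end ThreadSystem

end HubOfBadVertices

section BadNeighbors

variable {V : Type*} {G : SimpleGraph V} [Fintype V] [DecidableRel G.Adj]

theorem Finset.sum_insert_le_add {ι : Type*} [DecidableEq ι] (a : ι) (s : Finset ι) (f : ι → ℕ) :
    ∑ i ∈ insert a s, f i ≤ f a + ∑ i ∈ s, f i := by
  by_cases h : a ∈ s
  · rw [Finset.insert_eq_of_mem h]
    exact Nat.le_add_left _ _
  · rw [Finset.sum_insert h]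

namespace ThreadSystem

variable {T : ThreadSystem G} {u v w y z p q : V}

theorem dart_cases {X : Set V} {p q : V → V}
    (hX : ∀ u ∈ X, T.BadAt u w (p u) (q u)) (hv : v ∉ insert w X) (hdeg : 3 ≤ G.degree v) {s : V}
    (hs : G.Adj v s) (hfin : T.fin v s ∈ insert w X) :
    T.fin v s = w ∧ G.Adj w (T.last v s) ∧ T.last v s ∉ X ∨
      ∃ u ∈ X, T.fin v s = u ∧ (T.last v s = p u ∨ T.last v s = q u) := by
  obtain ⟨h₁, h₂, -⟩ := T.reverse_of_fin_eq hdeg hs rfl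
  rcases hfin with h | h
  · rw [h] at h₁ h₂
    refine Or.inl ⟨h, h₁, fun hl => hv (Or.inr ?_)⟩
    rw [(T.of_three_le_degree h₁ (hX _ hl).degree_eq.ge).2.1] at h₂
    exact h₂ ▸ hl
  · refine Or.inr ⟨_, h, rfl, (((hX _ h).adj _).1 h₁).resolve_left fun hl => hv (Or.inl ?_)⟩
    rw [← h₂, hl, (hX _ h).hub.2.1]

theorem BadAt.sum_le (h : T.BadAt u w p q) : (3 - T.len u p) + (3 - T.len u q) = 2 := by
  rcases h.len with ⟨h₁, h₂⟩ | ⟨h₁, h₂⟩ <;> omega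

theorem BadAt.one_le_len (h : T.BadAt u w p q) : 1 ≤ T.len u p ∧ 1 ≤ T.len u q := by
  rcases h.len with ⟨h₁, h₂⟩ | ⟨h₁, h₂⟩ <;> omega

theorem BadAt.false_of_one_le (h : T.BadAt u w p q) (hG : Crit G) (huy : u ≠ y) (huz : u ≠ z)
    (hyz : y ≠ z) (hadj : ∀ x, G.Adj w x ↔ x = u ∨ x = y ∨ x = z) (hy : 1 ≤ T.len w y)
    (hz : 1 ≤ T.len w z) (hsum : 3 ≤ T.len w y + T.len w z) : False := by
  classical
  have hw := degree_eq_three hadj huy huz hyz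
  have hX : ∀ x ∈ ({u} : Set V), T.BadAt x w p q := by rintro x rfl; exact h
  have hly := T.len_le ((hadj y).2 (by simp))
  have hlz := T.len_le ((hadj z).2 (by simp))
  obtain ⟨b, c, hbc, hns⟩ := exists_not_solvable_hub hG hw.ge {u} (fun _ => p) (fun _ => q) hX
    (fun v hv hdeg hall => by
      refine T.false_of_darts hG hdeg {(w, y), (w, z), (u, p), (u, q)} (fun s hs => ?_)
        (Finset.card_le_four.trans (by omega)) ?_ ?_
      · rcases dart_cases hX hv hdeg hs (hall s hs) with ⟨h₁, h₂, h₃⟩ | ⟨x, rfl, h₁, h₂⟩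
        · have := ((hadj _).1 h₂).resolve_left h₃
          rw [h₁]
          rcases this with h' | h' <;> simp [h']
        · rw [h₁]
          rcases h₂ with h' | h' <;> simp [h']
      · refine (Finset.sum_insert_le_add _ _ _).trans (le_trans (Nat.add_le_add_left
          ((Finset.sum_insert_le_add _ _ _).trans (Nat.add_le_add_left
          ((Finset.sum_insert_le_add _ _ _)) _)) _) ?_)
        rw [Finset.sum_singleton]
        dsimp only
        have := h.sum_le
        omega
      · have := h.one_le_len
        simp [hy, hz, this])
  refine hns (solvable_of_sum_le ?_ ?_ hbc (by simp [hw]) (by simp [hw]) ?_)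
  all_goals rw [neighborFinset_eq_triple hadj]
  · simp [huy.symm, huz.symm, hly, hlz]
  · simp [huy.symm, huz.symm, hy, hz]
  · rw [Finset.sum_insert (by simp [huy, huz]), Finset.sum_pair hyz]
    simp [huy.symm, huz.symm]
    omega

theorem BadAt.false_of_bad (h : T.BadAt u w p q) (hG : Crit G) (huy : u ≠ y) (huz : u ≠ z)
    (hyz : y ≠ z) (hadj : ∀ x, G.Adj w x ↔ x = u ∨ x = y ∨ x = z) (hy : 2 ≤ T.len w y)
    {p' q' : V} (h' : T.BadAt z w p' q') : False := by
  classical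
  have hw := degree_eq_three hadj huy huz hyz
  have hX : ∀ x ∈ ({u, z} : Set V), T.BadAt x w (if x = u then p else p')
      (if x = u then q else q') := by
    rintro x (rfl | rfl)
    · simpa using h
    · simpa [huz.symm] using h'
  have hly := T.len_le ((hadj y).2 (by simp))
  obtain ⟨b, c, hbc, hns⟩ := exists_not_solvable_hub hG hw.ge {u, z}
    (fun x => if x = u then p else p') (fun x => if x = u then q else q') hX
    (fun v hv hdeg hall => by
      refine T.false_of_darts hG hdeg {(w, y), (u, p), (u, q), (z, p'), (z, q')} (fun s hs => ?_)
        Finset.card_le_five ?_ ?_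
      · rcases dart_cases hX hv hdeg hs (hall s hs) with
          ⟨h₁, h₂, h₃⟩ | ⟨x, rfl | rfl, h₁, h₂⟩
        · have := (hadj _).1 h₂
          rw [h₁]
          simp only [Set.mem_insert_iff, Set.mem_singleton_iff, not_or] at h₃
          simp [(this.resolve_left h₃.1).resolve_right h₃.2]
        · rw [h₁]
          rcases h₂ with h' | h' <;> simp [h']
        · rw [h₁]
          simp only [huz.symm, if_false] at h₂
          rcases h₂ with h' | h' <;> simp [h']
      · refine (Finset.sum_insert_le_add _ _ _).trans (le_trans (Nat.add_le_add_left
          ((Finset.sum_insert_le_add _ _ _).trans (Nat.add_le_add_left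
          ((Finset.sum_insert_le_add _ _ _).trans (Nat.add_le_add_left
          ((Finset.sum_insert_le_add _ _ _)) _)) _)) _) ?_)
        rw [Finset.sum_singleton]
        dsimp only
        have := h.sum_le
        have := h'.sum_le
        omega
      · have := h.one_le_len
        have := h'.one_le_len
        have : 1 ≤ T.len w y := by omega
        simp [*])
  refine hns (solvable_of_sum_le ?_ ?_ hbc (by simp [hw]) (by simp [hw]) ?_)
  all_goals rw [neighborFinset_eq_triple hadj]
  · simp [huy.symm, hyz, hly]
  · simp [huy.symm, hyz]
    omega
  · rw [Finset.sum_insert (by simp [huy, huz]), Finset.sum_pair hyz]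
    simp [huy.symm, hyz]
    omega

theorem BadAt.false_of_three (h : T.BadAt u w p q) (hG : Crit G) (huy : u ≠ y) (huz : u ≠ z)
    (hyz : y ≠ z) (hadj : ∀ x, G.Adj w x ↔ x = u ∨ x = y ∨ x = z) (hy : T.len w y = 3)
    (hz : T.len w z = 0) : False := by
  classical
  have hw := degree_eq_three hadj huy huz hyz
  have hX : ∀ x ∈ ({u} : Set V), T.BadAt x w p q := by rintro x rfl; exact h
  have hwy := (hadj y).2 (by simp)
  have hwz := (hadj z).2 (by simp)
  have hfz := T.of_three_le_degree hwz (T.three_le_degree_of_len hwz hz)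
  obtain ⟨b, c, hbc, hns⟩ := exists_not_solvable_hub hG hw.ge {u} (fun _ => p) (fun _ => q) hX
    (fun v hv hdeg hall => by
      have hdart : ∀ s, G.Adj v s → (T.fin v s, T.last v s) = (w, y) ∨
          v = z ∧ (T.fin v s, T.last v s) = (w, z) ∨ (T.fin v s, T.last v s) = (u, p) ∨
          (T.fin v s, T.last v s) = (u, q) := by
        intro s hs
        obtain ⟨-, h₀, -⟩ := T.reverse_of_fin_eq hdeg hs rfl
        rcases dart_cases hX hv hdeg hs (hall s hs) with ⟨h₁, h₂, h₃⟩ | ⟨x, rfl, h₁, h₂⟩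
        · rcases ((hadj _).1 h₂).resolve_left h₃ with h' | h'
          · simp [h₁, h']
          · rw [h₁, h', hfz.2.1] at h₀
            simp [h₁, h', h₀]
        · rcases h₂ with h' | h' <;> simp [h₁, h']
      by_cases hvz : v = z
      · subst hvz
        have hdart' : ∀ s, G.Adj v s → (T.fin v s, T.last v s) = (w, v) ∨
            (T.fin v s, T.last v s) = (u, p) ∨ (T.fin v s, T.last v s) = (u, q) := by
          intro s hs
          rcases hdart s hs with h' | h' | h'
          · obtain ⟨-, h₀, -⟩ := T.reverse_of_fin_eq hdeg hs rfl
            rw [Prod.mk.injEq] at h'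
            rw [h'.1, h'.2] at h₀
            exact absurd (by omega) (T.no_cycle hG hw.ge hwz hwy (hfz.2.1.trans h₀.symm) (by omega))
          · exact Or.inl h'.2
          · exact Or.inr h'
        have h3 : G.degree v ≤ 3 := (T.sum_le_of_darts hdeg {(w, v), (u, p), (u, q)} fun s hs => by
          simpa using hdart' s hs).1.trans Finset.card_le_three
        have h1 : G.degree v ≤ 1 := (T.sum_le_of_darts hdeg {(w, v)} fun s hs => by
          obtain ⟨-, h₀, -⟩ := T.reverse_of_fin_eq hdeg hs rfl
          have hne : ∀ x, x = p ∨ x = q → T.fin u x ≠ v := fun x =>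
            h.fin_ne_of_adj hG (le_antisymm h3 hdeg) hwz.symm
          rcases hdart' s hs with h' | h' | h'
          · simpa using h'
          · rw [Prod.mk.injEq] at h'
            rw [h'.1, h'.2] at h₀
            exact absurd h₀ (hne p (Or.inl rfl))
          · rw [Prod.mk.injEq] at h'
            rw [h'.1, h'.2] at h₀
            exact absurd h₀ (hne q (Or.inr rfl))).1.trans (by simp)
        omega
      · refine T.false_of_darts hG hdeg {(w, y), (u, p), (u, q)} (fun s hs => ?_)
          (Finset.card_le_three.trans (by omega)) ?_ ?_
        · simpa [hvz] using hdart s hs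
        · refine (Finset.sum_insert_le_add _ _ _).trans (le_trans (Nat.add_le_add_left
            (Finset.sum_insert_le_add _ _ _) _) ?_)
          rw [Finset.sum_singleton]
          dsimp only
          have := h.sum_le
          omega
        · have := h.one_le_len
          simp [hy, this])
  refine hns (solvable_of_three (x := y) ?_ hbc (by simpa using hwy) (by simp [huy.symm, hy])
    (by simp [hw]) ?_)
  all_goals rw [neighborFinset_eq_triple hadj]
  · simp [huy.symm, huz.symm, hy, hz]
  · rw [Finset.sum_insert (by simp [huy, huz]), Finset.sum_pair hyz]
    simp [huy.symm, huz.symm, hy, hz]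

end ThreadSystem

end BadNeighbors

section Discharging

variable {V : Type*} {G : SimpleGraph V} [Fintype V] [DecidableRel G.Adj]

namespace ThreadSystem

variable (T : ThreadSystem G) {u v x : V}

open Classical in
/-- The charge that `v` sends to its neighbor `x`. -/
noncomputable def charge (v x : V) : ℕ :=
  T.len v x + if T.Bad x ∧ 3 ≤ G.degree v then 1 else 0

theorem charge_of_not_bad (h : ¬ T.Bad x) : T.charge v x = T.len v x := by
  simp [charge, h]

theorem len_of_bad (h : G.Adj v x) (hx : T.Bad x) : T.len v x = 0 :=
  (T.of_three_le_degree h hx.1.ge).2.2.2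

theorem charge_of_one_le (h : G.Adj v x) (hx : 1 ≤ T.len v x) : T.charge v x = T.len v x :=
  T.charge_of_not_bad fun hb => by
    have := T.len_of_bad h hb
    omega

theorem charge_le_add (v x : V) : T.charge v x ≤ T.len v x + 1 := by
  unfold charge
  split_ifs <;> omega

theorem charge_le_three (h : G.Adj v x) : T.charge v x ≤ 3 := by
  have := T.len_le h
  by_cases h1 : 1 ≤ T.len v x
  · rwa [T.charge_of_one_le h h1]
  · have := T.charge_le_add v x
    omega

theorem len_eq_len_add_one {q r : V} (hadj : ∀ x, G.Adj v x ↔ x = q ∨ x = r) (hqr : q ≠ r) :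
    T.len q v = T.len v r + 1 := by
  have hdeg := degree_eq_two hadj hqr
  have hqv : G.Adj q v := ((hadj q).2 (Or.inl rfl)).symm
  have h := T.thread hqv
  have hfin := T.three_le_degree_fin hqv
  have hne : T.len q v ≠ 0 := fun h0 => by
    have := T.three_le_degree_of_len hqv h0
    omega
  generalize T.last q v = l at *
  generalize T.fin q v = w at *
  generalize T.int q v = B at *
  generalize T.len q v = t at *
  cases h with
  | nil _ => exact absurd rfl hne
  | cons h₁ _ hadj' hne' =>
    have hy := h₁.adj_first
    rcases (hadj _).1 hy with rfl | rfl
    · exact absurd rfl hne'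
    · rw [(T.eq_of_thread h₁ hfin).2.2.2]

theorem sum_add_sum_eq (hu : ∀ x, G.Adj u x → T.charge u x = T.len u x) :
    ∑ x ∈ G.neighborFinset u, (3 - T.len u x) + ∑ x ∈ G.neighborFinset u, T.charge u x =
      3 * G.degree u := by
  rw [← Finset.sum_add_distrib, ← card_neighborFinset_eq_degree, mul_comm, ← smul_eq_mul]
  refine Finset.sum_eq_card_nsmul fun x hx => ?_
  rw [mem_neighborFinset] at hx
  have := T.len_le hx
  have := hu x hx
  omega

theorem sum_charge_of_bad_neighbor (hG : Crit G) (hu : G.degree u = 3) (hx : G.Adj u x)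
    (hbad : T.Bad x) : ∑ x ∈ G.neighborFinset u, T.charge u x ≤ 3 := by
  classical
  obtain ⟨y, z, hxy, hxz, hyz, hadj⟩ := exists_triple_of_degree_eq_three hu hx
  obtain ⟨p, q, h⟩ := hbad.exists_badAt hx.symm hu.ge
  have hadj' : ∀ s, G.Adj u s ↔ s = x ∨ s = z ∨ s = y := fun s => by rw [hadj]; tauto
  have hy := (hadj y).2 (by simp)
  have hz := (hadj z).2 (by simp)
  rw [neighborFinset_eq_triple hadj, Finset.sum_insert (by simp [hxy, hxz]), Finset.sum_pair hyz]
  have h0 := T.charge_le_add u x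
  rw [T.len_of_bad hx hbad] at h0
  suffices T.charge u y + T.charge u z ≤ 2 by omega
  have key : ∀ {y z}, x ≠ y → x ≠ z → y ≠ z → (∀ s, G.Adj u s ↔ s = x ∨ s = y ∨ s = z) →
      1 ≤ T.len u y → T.len u z = 0 → T.charge u y + T.charge u z ≤ 2 := by
    intro y z hxy hxz hyz hadj hy1 hz0
    have hy := (hadj y).2 (by simp)
    have hz := (hadj z).2 (by simp)
    rw [T.charge_of_one_le hy hy1]
    have hy3 := T.len_le hy
    by_cases hzb : T.Bad z
    · obtain ⟨p', q', h'⟩ := hzb.exists_badAt hz.symm hu.ge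
      have := T.charge_le_add u z
      by_contra hcon
      exact h.false_of_bad hG hxy hxz hyz hadj (by omega) h'
    · rw [T.charge_of_not_bad hzb]
      by_contra hcon
      exact h.false_of_three hG hxy hxz hyz hadj (by omega) hz0
  by_cases hy1 : 1 ≤ T.len u y <;> by_cases hz1 : 1 ≤ T.len u z
  · rw [T.charge_of_one_le hy hy1, T.charge_of_one_le hz hz1]
    by_contra hcon
    exact h.false_of_one_le hG hxy hxz hyz hadj hy1 hz1 (by omega)
  · exact key hxy hxz hyz hadj hy1 (by omega)
  · rw [add_comm]
    exact key hxz hxy hyz.symm hadj' hz1 (by omega)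
  · have := T.charge_le_add u y
    have := T.charge_le_add u z
    omega

theorem sum_charge_of_degree_three (hG : Crit G) (hu : G.degree u = 3) :
    ∑ x ∈ G.neighborFinset u, T.charge u x ≤ 3 + ∑ x ∈ G.neighborFinset u, T.charge x u := by
  by_cases hb : ∃ x, G.Adj u x ∧ T.Bad x
  · obtain ⟨x, hx, hbad⟩ := hb
    exact (T.sum_charge_of_bad_neighbor hG hu hx hbad).trans (Nat.le_add_right _ _)
  · push Not at hb
    have hch : ∀ x, G.Adj u x → T.charge u x = T.len u x := fun x hx =>
      T.charge_of_not_bad (hb x hx)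
    have h₁ := T.sum_add_sum_eq hch
    have h₂ := T.not_sum_le_four hG hu.ge (by omega)
    by_cases hbad : T.Bad u
    · obtain ⟨w, hw, hdeg⟩ := hbad.exists_adj hG
      have h₃ : T.charge w u = 1 := by
        simp [charge, hbad, hdeg, T.len_of_bad hw.symm hbad]
      have := Finset.single_le_sum (f := fun x => T.charge x u) (fun _ _ => Nat.zero_le _)
        ((mem_neighborFinset G u w).2 hw)
      omega
    · have h₃ : ∑ x ∈ G.neighborFinset u, T.charge u x = ∑ x ∈ G.neighborFinset u, T.len u x :=
        Finset.sum_congr rfl fun x hx => hch x (by simpa using hx)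
      have : ∑ x ∈ G.neighborFinset u, T.len u x ≠ 4 := fun h => hbad ⟨hu, h⟩
      omega

theorem sum_charge_le (s : Finset V) (hs : s ⊆ G.neighborFinset u) :
    ∑ x ∈ s, T.charge u x ≤ s.card * 3 := by
  rw [← smul_eq_mul]
  exact Finset.sum_le_card_nsmul _ _ _ fun x hx => T.charge_le_three (by simpa using hs hx)

theorem sum_charge_of_four_le (hG : Crit G) (hu : 4 ≤ G.degree u) :
    ∑ x ∈ G.neighborFinset u, T.charge u x + 12 ≤ 5 * G.degree u := by
  classical
  have hcard := G.card_neighborFinset_eq_degree u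
  by_cases h6 : 6 ≤ G.degree u
  · have := T.sum_charge_le (G.neighborFinset u) subset_rfl
    omega
  by_cases hz : ∃ x, G.Adj u x ∧ T.len u x = 0
  · obtain ⟨x, hx, hx0⟩ := hz
    have hx' : x ∈ G.neighborFinset u := by simpa using hx
    have hxc := T.charge_le_add u x
    have hsum := Finset.add_sum_erase _ (fun x => T.charge u x) hx'
    have hle := T.sum_charge_le ((G.neighborFinset u).erase x) (Finset.erase_subset _ _)
    have hcard' := Finset.card_erase_add_one hx'
    by_cases h5 : G.degree u = 5
    · omega
    by_cases hz' : ∃ y, G.Adj u y ∧ y ≠ x ∧ T.len u y = 0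
    · obtain ⟨y, hy, hyx, hy0⟩ := hz'
      have hy' : y ∈ (G.neighborFinset u).erase x := by simpa [hyx] using hy
      have hyc := T.charge_le_add u y
      have hsum' := Finset.add_sum_erase _ (fun x => T.charge u x) hy'
      have hle' := T.sum_charge_le (((G.neighborFinset u).erase x).erase y)
        ((Finset.erase_subset _ _).trans (Finset.erase_subset _ _))
      have hcard'' := Finset.card_erase_add_one hy'
      omega
    · push Not at hz'
      have h₂ := T.not_sum_le_four hG (by omega) (by omega : G.degree u ≤ 4)
      rw [← Finset.add_sum_erase _ _ hx'] at h₂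
      have h₁ : ∑ y ∈ (G.neighborFinset u).erase x, (3 - T.len u y) +
          ∑ y ∈ (G.neighborFinset u).erase x, T.charge u y =
          ((G.neighborFinset u).erase x).card * 3 := by
        rw [← Finset.sum_add_distrib, ← smul_eq_mul]
        refine Finset.sum_eq_card_nsmul fun y hy => ?_
        rw [Finset.mem_erase, mem_neighborFinset] at hy
        have := T.len_le hy.2
        have := T.charge_of_one_le hy.2 (Nat.pos_of_ne_zero (hz' y hy.2 hy.1))
        omega
      omega
  · push Not at hz
    have h1 : ∀ x, G.Adj u x → 1 ≤ T.len u x := fun x hx => Nat.pos_of_ne_zero (hz x hx)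
    have h₁ := T.sum_add_sum_eq fun x hx => T.charge_of_one_le hx (h1 x hx)
    have h₂ := T.not_sum_le_five hG u (by omega) (by omega) h1
    omega

theorem sum_charge_of_degree_two (hu : G.degree u = 2) :
    ∑ x ∈ G.neighborFinset u, T.charge u x + 2 ≤ ∑ x ∈ G.neighborFinset u, T.charge x u := by
  classical
  obtain ⟨q, r, hqr, hN⟩ := Finset.card_eq_two.1 ((G.card_neighborFinset_eq_degree u).trans hu)
  have hadj : ∀ x, G.Adj u x ↔ x = q ∨ x = r := fun x => by
    simpa using Finset.ext_iff.1 hN x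
  rw [hN, Finset.sum_pair hqr, Finset.sum_pair hqr]
  have h₁ := T.len_eq_len_add_one hadj hqr
  have h₂ := T.len_eq_len_add_one (fun x => by rw [hadj, or_comm]) hqr.symm
  have hbad : ¬ T.Bad u := fun h => by
    have := h.1
    omega
  rw [T.charge_of_not_bad hbad, T.charge_of_not_bad hbad]
  simp only [charge, hu, Nat.reduceLeDiff, and_false, if_false]
  omega

theorem twelve_add_sum_charge_le (hG : Crit G) (u : V) :
    12 + ∑ x ∈ G.neighborFinset u, T.charge u x ≤
      5 * G.degree u + ∑ x ∈ G.neighborFinset u, T.charge x u := by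
  have := hG.two_le_degree u
  rcases (by omega : G.degree u = 2 ∨ G.degree u = 3 ∨ 4 ≤ G.degree u) with h | h | h
  · have := T.sum_charge_of_degree_two h
    omega
  · have := T.sum_charge_of_degree_three hG h
    omega
  · have := T.sum_charge_of_four_le hG h
    omega

end ThreadSystem

theorem Crit.twelve_mul_card_le (hG : Crit G) : 12 * Fintype.card V ≤ 10 * G.edgeFinset.card := by
  obtain ⟨T⟩ := hG.nonempty_threadSystem
  have hsum := Finset.sum_le_sum fun u (_ : u ∈ Finset.univ) => T.twelve_add_sum_charge_le hG u
  have hcomm : ∑ u, ∑ x ∈ G.neighborFinset u, T.charge u x =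
      ∑ u, ∑ x ∈ G.neighborFinset u, T.charge x u :=
    Finset.sum_comm' fun x y => by simp [G.adj_comm]
  rw [Finset.sum_add_distrib, Finset.sum_add_distrib, hcomm, ← Finset.mul_sum,
    G.sum_degrees_eq_twice_card_edges, Finset.sum_const, Finset.card_univ, smul_eq_mul] at hsum
  omega

end Discharging

section MaximumAverageDegree

variable {V : Type*} {G : SimpleGraph V}

theorem MadLT.false_of_chord [Fintype V] (hmad : MadLT G (12 / 5)) {a b c d e : V}
    (hab : G.Adj a b) (hbc : G.Adj b c) (hcd : G.Adj c d) (hde : G.Adj d e) (hea : G.Adj e a)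
    (had : a ≠ d) (hbd : b ≠ d) (hbe : b ≠ e) (hce : c ≠ e) (hac : G.Adj a c) : False := by
  classical
  let S : Finset V := {a, b, c, d, e}
  let F : Finset (Sym2 V) := {s(a, b), s(b, c), s(c, d), s(d, e), s(e, a), s(a, c)}
  have h := hmad ((⊤ : G.Subgraph).induce (S : Set V)) ⟨a, by simp [S]⟩
  have hF : F.card = 6 := by
    simp [F, Finset.card_insert_of_notMem, hab.ne, hbc.ne, hcd.ne, hde.ne, hea.ne, had, hbd, hbe,
      hce, hac.ne, hab.ne', hcd.ne', hea.ne', had.symm, hce.symm, hac.ne']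
  have hS : ((⊤ : G.Subgraph).induce (S : Set V)).verts.ncard ≤ 5 := by
    rw [Subgraph.induce_verts, Set.ncard_coe_finset]
    exact Finset.card_le_five
  have hsub : (F : Set (Sym2 V)) ⊆ ((⊤ : G.Subgraph).induce (S : Set V)).edgeSet := by
    intro x hx
    simp only [F, Finset.coe_insert, Finset.coe_singleton, Set.mem_insert_iff,
      Set.mem_singleton_iff] at hx
    rcases hx with rfl | rfl | rfl | rfl | rfl | rfl <;> simp [S, *]
  have hle := Set.ncard_le_ncard hsub
  rw [Set.ncard_coe_finset, hF] at hle
  have h₁ : (6 : ℚ) ≤ ((⊤ : G.Subgraph).induce (S : Set V)).edgeSet.ncard := by exact_mod_cast hle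
  have h₂ : (((⊤ : G.Subgraph).induce (S : Set V)).verts.ncard : ℚ) ≤ 5 :=
    Nat.cast_le_ofNat.2 hS
  linarith

theorem MadLT.no_cycle [Fintype V] (hmad : MadLT G (12 / 5))
    (hC5 : IsEmpty (SimpleGraph.cycleGraph 5 ↪g G)) {a b c d e : V}
    (hab : G.Adj a b) (hbc : G.Adj b c) (hcd : G.Adj c d) (hde : G.Adj d e) (hea : G.Adj e a)
    (hac : a ≠ c) (had : a ≠ d) (hbd : b ≠ d) (hbe : b ≠ e) (hce : c ≠ e) : False := by
  have nac : ¬ G.Adj a c := fun h => hmad.false_of_chord hab hbc hcd hde hea had hbd hbe hce h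
  have nbd : ¬ G.Adj b d := fun h =>
    hmad.false_of_chord hbc hcd hde hea hab hbe hce hac.symm had.symm h
  have nce : ¬ G.Adj c e := fun h =>
    hmad.false_of_chord hcd hde hea hab hbc hac.symm had.symm hbd.symm hbe.symm h
  have nda : ¬ G.Adj d a := fun h =>
    hmad.false_of_chord hde hea hab hbc hcd hbd.symm hbe.symm hce.symm hac h
  have neb : ¬ G.Adj e b := fun h =>
    hmad.false_of_chord hea hab hbc hcd hde hce.symm hac had hbd h
  have hadj : ∀ i j, G.Adj (![a, b, c, d, e] i) (![a, b, c, d, e] j) ↔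
      (cycleGraph 5).Adj i j := by
    intro i j
    fin_cases i <;> fin_cases j <;>
      first
      | exact iff_of_true (by first | assumption | exact G.adj_symm (by assumption)) (by decide)
      | exact iff_of_false (by first | assumption | exact G.irrefl |
          exact fun h => absurd (G.adj_symm h) (by assumption)) (by decide)
  refine hC5.false ⟨⟨![a, b, c, d, e], fun i j hij => ?_⟩, fun {i j} => hadj i j⟩
  revert hij
  fin_cases i <;> fin_cases j <;> simp [hab.ne, hbc.ne, hcd.ne, hde.ne, hea.ne, had, hbd, hbe,
    hce, hac, hab.ne', hbc.ne', hcd.ne', hde.ne', hea.ne', had.symm, hbd.symm, hbe.symm,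
    hce.symm, hac.symm]

end MaximumAverageDegree

section MinimalCounterexample

variable {V : Type*} {G : SimpleGraph V}

theorem exists_pcfOn_of_induce {A : Set V} {f : A → Fin 4} (hf : IsPCFColoring (G.induce A) f) :
    ∃ g, PCFOn G A g := by
  classical
  refine ⟨fun v => if h : v ∈ A then f ⟨v, h⟩ else 0, fun u hu v hv huv => ?_, ?_⟩
  · simpa [hu, hv] using hf.1 (u := ⟨u, hu⟩) (v := ⟨v, hv⟩) huv
  · rintro v hv ⟨u, hu, huv⟩
    obtain ⟨⟨x, hx⟩, hvx, huniq⟩ := hf.2 ⟨v, hv⟩ ⟨⟨u, hu⟩, huv⟩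
    refine ⟨x, hx, hvx, fun w hw hvw hwx => ?_⟩
    simp only [hw, hx, dif_pos] at hwx
    exact congrArg Subtype.val (huniq ⟨w, hw⟩ hvw hwx)

theorem PCFOn.induce {A : Set V} {B : Set A} {f : V → Fin 4}
    (hf : PCFOn G (Subtype.val '' B) f) : PCFOn (G.induce A) B (fun v => f v) := by
  refine ⟨fun u hu v hv huv => hf.1 u ⟨u, hu, rfl⟩ v ⟨v, hv, rfl⟩ huv, ?_⟩
  rintro v hv ⟨u, hu, huv⟩
  obtain ⟨-, ⟨x, hx, rfl⟩, hvx, huniq⟩ := hf.2 v ⟨v, hv, rfl⟩ ⟨u, ⟨u, hu, rfl⟩, huv⟩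
  exact ⟨x, hx, hvx, fun w hw hvw hwx => Subtype.ext (huniq w ⟨w, hw, rfl⟩ hvw hwx)⟩

theorem exists_pcfOn [Fintype V] (hmad : MadLT G (12 / 5))
    (hC5 : IsEmpty (SimpleGraph.cycleGraph 5 ↪g G)) (A : Set V) : ∃ f, PCFOn G A f := by
  classical
  induction hn : A.ncard using Nat.strong_induction_on generalizing A with
  | _ n ih =>
    by_contra hcon
    have hG : Crit (G.induce A) :=
      { no_coloring := fun ⟨f, hf⟩ => hcon (exists_pcfOn_of_induce hf)
        exists_pcfOn := fun B hB => by
          have hlt : (Subtype.val '' B : Set V).ncard < n := by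
            rw [← hn]
            refine Set.ncard_lt_ncard ⟨by simp, fun h => hB ?_⟩
            ext x
            obtain ⟨y, hy, hyx⟩ := h x.2
            simpa [Subtype.ext hyx] using hy
          obtain ⟨f, hf⟩ := ih _ hlt _ rfl
          exact ⟨_, hf.induce⟩
        no_cycle := fun a b c d e h₁ h₂ h₃ h₄ h₅ n₁ n₂ n₃ n₄ n₅ =>
          hmad.no_cycle hC5 h₁ h₂ h₃ h₄ h₅ (fun h => n₁ (Subtype.ext h))
            (fun h => n₂ (Subtype.ext h)) (fun h => n₃ (Subtype.ext h))
            (fun h => n₄ (Subtype.ext h)) (fun h => n₅ (Subtype.ext h)) }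
    have hne : A.Nonempty := by
      by_contra h
      rw [Set.not_nonempty_iff_eq_empty] at h
      exact hcon ⟨fun _ => 0, by simp [PCFOn, h]⟩
    have hcard := hG.twelve_mul_card_le
    have hlt := hmad ((⊤ : G.Subgraph).induce A) hne
    have hedge : ((⊤ : G.Subgraph).induce A).edgeSet.ncard = (G.induce A).edgeFinset.card := by
      rw [← Subgraph.image_coe_edgeSet_coe, Set.ncard_image_of_injective _
        (Sym2.map.injective Subtype.val_injective), ← Set.ncard_coe_finset, coe_edgeFinset,
        induce_eq_coe_induce_top]
      rfl
    have hvert : ((⊤ : G.Subgraph).induce A).verts.ncard = Fintype.card A := by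
      rw [← Nat.card_eq_fintype_card]
      rfl
    rw [hedge, hvert] at hlt
    have : (12 * Fintype.card A : ℚ) ≤ 10 * (G.induce A).edgeFinset.card := by exact_mod_cast hcard
    linarith

end MinimalCounterexample

/-- If `G` is a finite simple graph with `mad(G) < 12/5` and no induced `5`-cycle,
then `G` has a proper conflict-free `4`-coloring. -/
theorem pcf_four_of_madLT {V : Type*} [Fintype V] (G : SimpleGraph V)
    (hmad : MadLT G (12 / 5))
    (hC5 : IsEmpty (SimpleGraph.cycleGraph 5 ↪g G)) :
    ∃ f : V → Fin 4, IsPCFColoring G f := by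
  obtain ⟨f, h₁, h₂⟩ := exists_pcfOn hmad hC5 Set.univ
  refine ⟨f, fun u v huv => h₁ u trivial v trivial huv, fun v hv => ?_⟩
  obtain ⟨u, -, hvu, huniq⟩ := h₂ v trivial (by simpa using hv)
  exact ⟨u, hvu, fun w hw => huniq w trivial hw⟩
end

section
/- For every integer c ≥ 4, a c-PCF-critical graph has no vertex of degree 1. -/
open SimpleGraph

/-- Deleting a vertex from a critical graph leaves a PCF-colorable graph; the coloring is
extended arbitrarily to the deleted vertex. -/
theorem PCFCritical.exists_coloring_off_vertex {V : Type*} {G : SimpleGraph V} {c : ℕ}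
    (hG : PCFCritical G c) (hc : 0 < c) (v : V) :
    ∃ g : V → Fin c,
      (∀ a b, a ≠ v → b ≠ v → G.Adj a b → g a ≠ g b) ∧
      ∀ a, a ≠ v → (∃ b, b ≠ v ∧ G.Adj a b) →
        ∃ b, b ≠ v ∧ G.Adj a b ∧ ∀ w, w ≠ v → G.Adj a w → g w = g b → w = b := by
  classical
  obtain ⟨f, hproper, hunique⟩ := hG.2 ((⊤ : G.Subgraph).deleteVerts {v}) fun h => by
    have hv : v ∈ ((⊤ : G.Subgraph).deleteVerts {v}).verts := by simp [h]
    simp at hv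
  have hmem : ∀ a, a ≠ v → a ∈ ((⊤ : G.Subgraph).deleteVerts {v}).verts := by simp
  have hne : ∀ a ∈ ((⊤ : G.Subgraph).deleteVerts {v}).verts, a ≠ v := by simp
  refine ⟨fun a => if h : a ≠ v then f ⟨a, hmem a h⟩ else ⟨0, hc⟩, ?_, ?_⟩
  · intro a b ha hb hab
    simp only [ha, hb, ne_eq, not_false_eq_true, dite_true]
    exact hproper (by simp [ha, hb, hab])
  · rintro a ha ⟨b, hb, hab⟩
    obtain ⟨⟨u, hu⟩, hau, huniq⟩ :=
      hunique ⟨a, hmem a ha⟩ ⟨⟨b, hmem b hb⟩, by simp [ha, hb, hab]⟩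
    have huv := hne u hu
    refine ⟨u, huv, Subgraph.coe_adj_sub _ _ _ hau, fun w hw haw hwu => ?_⟩
    simp only [hw, huv, ne_eq, not_false_eq_true, dite_true] at hwu
    exact congrArg Subtype.val (huniq ⟨w, hmem w hw⟩ (by simp [ha, hw, haw]) hwu)

/-- For every integer `c ≥ 4`, a `c`-PCF-critical graph has no vertex of degree `1`. -/
theorem no_one_vertex {c : ℕ} (hc : 4 ≤ c) {V : Type*} [Fintype V]
    (G : SimpleGraph V) [DecidableRel G.Adj] (hG : PCFCritical G c) (v : V) :
    G.degree v ≠ 1 := by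
  classical
  intro hdeg
  obtain ⟨u, hvu, hu⟩ := G.degree_eq_one_iff_existsUnique_adj.mp hdeg
  have huv : u ≠ v := hvu.ne'
  obtain ⟨g, hproper, hunique⟩ := hG.exists_coloring_off_vertex (by omega) v
  -- The color for `v` must avoid that of `u` and that of a chosen witness `w` for `u`.
  obtain ⟨w, hw⟩ : ∃ w, (∃ b, b ≠ v ∧ G.Adj u b) →
      w ≠ v ∧ G.Adj u w ∧ ∀ x, x ≠ v → G.Adj u x → g x = g w → x = w := by
    by_cases h : ∃ b, b ≠ v ∧ G.Adj u b
    · obtain ⟨w, hw⟩ := hunique u huv h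
      exact ⟨w, fun _ => hw⟩
    · exact ⟨u, fun h' => absurd h' h⟩
  obtain ⟨k, hk⟩ : ∃ k, k ∉ ({g u, g w} : Finset (Fin c)) := by
    by_contra! h
    have hcard := Finset.card_le_card (fun k _ => h k : Finset.univ ⊆ {g u, g w})
    have := Finset.card_le_two (a := g u) (b := g w)
    simp only [Finset.card_univ, Fintype.card_fin] at hcard
    omega
  simp only [Finset.mem_insert, Finset.mem_singleton, not_or] at hk
  refine hG.1 ⟨Function.update g v k, fun a b hab => ?_, fun a ha => ?_⟩
  · have hadj := hab.symm
    have hirr := hab.ne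
    grind [Function.update_apply]
  · by_cases hav : a = v
    · subst hav
      exact ⟨u, hvu, fun x hx _ => hu x hx⟩
    have hnb : a ≠ u → ∀ x, G.Adj a x → x ≠ v := by
      rintro hau x hax rfl
      exact hau (hu a hax.symm)
    by_cases hau : a = u
    · subst hau
      by_cases h : ∃ b, b ≠ v ∧ G.Adj a b
      · obtain ⟨hwv, haw, huniq⟩ := hw h
        refine ⟨w, haw, fun x hx hxw => ?_⟩
        grind [Function.update_apply]
      · refine ⟨v, hvu.symm, fun x hx _ => ?_⟩
        by_contra hxv
        exact h ⟨x, hxv, hx⟩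
    · obtain ⟨b, hab⟩ := ha
      obtain ⟨x, hxv, hax, huniq⟩ := hunique a hav ⟨b, hnb hau b hab, hab⟩
      refine ⟨x, hax, fun y hy hyx => huniq y (hnb hau y hy) hy ?_⟩
      simpa [Function.update_apply, hxv, hnb hau y hy] using hyx
end

section
/- For every integer c ≥ 4, a c-PCF-critical graph G contains no path u₁v₁v₂u₂ in which v₁ and v₂ both have degree 2 in G and u₁ has degree 3 in G; that is, no vertex of degree 3 is adjacent to a 2-thread. -/
open SimpleGraph

/-- A critical graph has a coloring that is proper conflict-free away from any given nonempty
set of vertices. -/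
lemma PCFCritical.exists_coloring_avoiding {V : Type*} {G : SimpleGraph V} {c : ℕ}
    (hG : PCFCritical G c) (hc : 0 < c) {S : Set V} (hS : S.Nonempty) :
    ∃ f : V → Fin c, (∀ u ∉ S, ∀ v ∉ S, G.Adj u v → f u ≠ f v) ∧
      ∀ v ∉ S, (∃ u ∉ S, G.Adj v u) →
        ∃ u ∉ S, G.Adj v u ∧ ∀ w ∉ S, G.Adj v w → f w = f u → w = u := by
  classical
  obtain ⟨s, hs⟩ := hS
  have hne : (⊤ : G.Subgraph).induce Sᶜ ≠ ⊤ := by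
    intro h
    have hv : s ∈ ((⊤ : G.Subgraph).induce Sᶜ).verts := by
      rw [h]
      exact Set.mem_univ s
    exact hv hs
  obtain ⟨f, hproper, hfree⟩ := hG.2 _ hne
  refine ⟨fun v => if h : v ∈ S then ⟨0, hc⟩ else f ⟨v, h⟩, ?_, ?_⟩
  · intro u hu v hv huv
    simpa [hu, hv] using @hproper ⟨u, hu⟩ ⟨v, hv⟩ ⟨hu, hv, huv⟩
  · rintro v hv ⟨u, hu, hvu⟩
    obtain ⟨⟨x, hx⟩, hvx, hunique⟩ := hfree ⟨v, hv⟩ ⟨⟨u, hu⟩, hv, hu, hvu⟩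
    refine ⟨x, hx, hvx.2.2, fun w hw hvw hfw => ?_⟩
    have hx' : x ∉ S := hx
    simp only [hw, hx', dite_false] at hfw
    exact congrArg Subtype.val (hunique ⟨w, hw⟩ ⟨hv, hw, hvw⟩ hfw)

/-- With at least four colors, two adjacent vertices can be colored so that both avoid `p` and `q`
and the second one also avoids `x`. -/
lemma exists_two_thread_colors {c : ℕ} (hc : 4 ≤ c) (p q x : Fin c) :
    ∃ α β : Fin c, α ≠ p ∧ α ≠ q ∧ β ≠ p ∧ β ≠ q ∧ β ≠ x ∧ β ≠ α := by
  have avoid (a b d : Fin c) : ∃ e, e ≠ a ∧ e ≠ b ∧ e ≠ d := by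
    have hcard : ({a, b, d} : Finset (Fin c)).card < Fintype.card (Fin c) := by
      have := Finset.card_le_three (a := a) (b := b) (c := d)
      simp only [Fintype.card_fin]
      omega
    obtain ⟨e, he⟩ := Finset.exists_mem_notMem_of_card_lt_card
      (s := {a, b, d}) (t := Finset.univ) (by simpa using hcard)
    exact ⟨e, by simpa using he.2⟩
  by_cases hx : x = p ∨ x = q
  · obtain ⟨α, hα⟩ := avoid p q x
    obtain ⟨β, hβ⟩ := avoid p q α
    exact ⟨α, β, by grind⟩
  · obtain ⟨β, hβ⟩ := avoid p q x
    exact ⟨x, β, by grind⟩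

/-- A vertex of degree two is adjacent only to its two known neighbors. -/
lemma adj_iff_of_degree_eq_two {V : Type*} {G : SimpleGraph V} {v a b : V}
    [Fintype (G.neighborSet v)] (hv : G.degree v = 2) (ha : G.Adj v a) (hb : G.Adj v b)
    (hab : a ≠ b) (w : V) : G.Adj v w ↔ w = a ∨ w = b := by
  classical
  have hsub : ({a, b} : Finset V) ⊆ G.neighborFinset v := by
    intro z hz
    grind [mem_neighborFinset]
  have heq := Finset.eq_of_subset_of_card_le hsub (by
    rw [card_neighborFinset_eq_degree, hv, Finset.card_pair hab])
  rw [← mem_neighborFinset, ← heq]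
  simp

/-- A vertex of degree three has exactly two neighbors besides a given one. -/
lemma exists_adj_iff_of_degree_eq_three {V : Type*} {G : SimpleGraph V} {u v : V}
    [Fintype (G.neighborSet u)] (hu : G.degree u = 3) (huv : G.Adj u v) :
    ∃ a b, a ≠ b ∧ a ≠ v ∧ b ≠ v ∧ ∀ w, G.Adj u w ↔ w = v ∨ w = a ∨ w = b := by
  classical
  have hmem : v ∈ G.neighborFinset u := by simpa using huv
  have hcard : ((G.neighborFinset u).erase v).card = 2 := by
    rw [Finset.card_erase_of_mem hmem, card_neighborFinset_eq_degree, hu]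
  obtain ⟨a, b, hab, heq⟩ := Finset.card_eq_two.mp hcard
  have hiff (w : V) : (w ≠ v ∧ G.Adj u w) ↔ w = a ∨ w = b := by
    rw [← mem_neighborFinset, ← Finset.mem_erase, heq]
    simp
  exact ⟨a, b, hab, ((hiff a).2 (.inl rfl)).1, ((hiff b).2 (.inr rfl)).1, by grind⟩

/-- For every integer `c ≥ 4`, a `c`-PCF-critical graph contains no path
`u₁v₁v₂u₂` in which `v₁` and `v₂` have degree `2` and `u₁` has degree `3`:
no `3`-vertex is adjacent to a `2`-thread. -/
theorem no_three_vertex_adjacent_two_thread {c : ℕ} (hc : 4 ≤ c) {V : Type*} [Fintype V]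
    (G : SimpleGraph V) [DecidableRel G.Adj] (hG : PCFCritical G c) :
    ¬ ∃ u₁ v₁ v₂ u₂ : V, u₁ ≠ v₂ ∧ u₁ ≠ u₂ ∧ v₁ ≠ u₂ ∧
      G.Adj u₁ v₁ ∧ G.Adj v₁ v₂ ∧ G.Adj v₂ u₂ ∧
      G.degree v₁ = 2 ∧ G.degree v₂ = 2 ∧ G.degree u₁ = 3 := by
  classical
  rintro ⟨u₁, v₁, v₂, u₂, hu₁v₂, hu, hv₁u₂, huv₁, hvv, hvu₂, hd₁, hd₂, hd₃⟩
  have hN₁ := adj_iff_of_degree_eq_two hd₁ huv₁.symm hvv hu₁v₂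
  have hN₂ := adj_iff_of_degree_eq_two hd₂ hvv.symm hvu₂ hv₁u₂
  obtain ⟨a, b, hab, hav₁, hbv₁, hNu⟩ := exists_adj_iff_of_degree_eq_three hd₃ huv₁
  have hne₁ := huv₁.ne
  have hne := hvv.ne
  have hne₂ := hvu₂.ne
  have hM₁ (w : V) : G.Adj w v₁ ↔ w = u₁ ∨ w = v₂ := by rw [G.adj_comm, hN₁]
  have hM₂ (w : V) : G.Adj w v₂ ↔ w = v₁ ∨ w = u₂ := by rw [G.adj_comm, hN₂]
  obtain ⟨f, hproper, hfree⟩ := hG.exists_coloring_avoiding (by omega)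
    (S := {v₁, v₂}) ⟨v₁, by simp⟩
  simp only [Set.mem_insert_iff, Set.mem_singleton_iff, not_or] at hproper hfree
  have hua : G.Adj u₁ a := by simp [hNu]
  have hub : G.Adj u₁ b := by simp [hNu]
  have hav₂ : a ≠ v₂ := by grind
  have hbv₂ : b ≠ v₂ := by grind
  have hfab : f a ≠ f b := by
    obtain ⟨y, hy, hay, hy'⟩ := hfree u₁ ⟨hne₁, hu₁v₂⟩ ⟨a, ⟨hav₁, hav₂⟩, hua⟩
    have ha := hy' a ⟨hav₁, hav₂⟩ hua
    have hb := hy' b ⟨hbv₁, hbv₂⟩ hub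
    grind
  obtain ⟨x, hx⟩ : ∃ x : Fin c, (∃ w, (w ≠ v₁ ∧ w ≠ v₂) ∧ G.Adj u₂ w) →
      ∃ y, (y ≠ v₁ ∧ y ≠ v₂) ∧ G.Adj u₂ y ∧ f y = x ∧
        ∀ w, (w ≠ v₁ ∧ w ≠ v₂) → G.Adj u₂ w → f w = x → w = y := by
    by_cases h : ∃ w, (w ≠ v₁ ∧ w ≠ v₂) ∧ G.Adj u₂ w
    · obtain ⟨y, hy, hadj, hunique⟩ := hfree u₂ ⟨hv₁u₂.symm, hne₂.symm⟩ h
      exact ⟨f y, fun _ => ⟨y, hy, hadj, rfl, hunique⟩⟩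
    · exact ⟨f u₂, fun h' => absurd h' h⟩
  obtain ⟨α, β, hαp, hαq, hβp, hβq, hβx, hβα⟩ := exists_two_thread_colors hc (f u₁) (f u₂) x
  let g : V → Fin c := fun v => if v = v₁ then α else if v = v₂ then β else f v
  have hg₁ : g v₁ = α := by simp [g]
  have hg₂ : g v₂ = β := by simp [g, hne.symm]
  have hg (w : V) (h₁ : w ≠ v₁) (h₂ : w ≠ v₂) : g w = f w := by simp [g, h₁, h₂]
  clear_value g
  refine hG.1 ⟨g, ?_, ?_⟩
  · intro u v huv
    by_cases hu₁ : u = v₁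
    · grind
    by_cases hu₂ : u = v₂
    · grind
    by_cases hv₁ : v = v₁
    · grind
    by_cases hv₂ : v = v₂
    · grind
    rw [hg u hu₁ hu₂, hg v hv₁ hv₂]
    exact hproper u ⟨hu₁, hu₂⟩ v ⟨hv₁, hv₂⟩ huv
  · rintro v ⟨u, huv⟩
    by_cases hv₁ : v = v₁
    · exact ⟨u₁, by grind⟩
    by_cases hv₂ : v = v₂
    · exact ⟨u₂, by grind⟩
    by_cases hvu₁ : v = u₁
    · subst hvu₁
      by_cases hfa : f a = α
      · exact ⟨b, by grind⟩
      · exact ⟨a, by grind⟩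
    by_cases hvu₂ : v = u₂
    · subst hvu₂
      by_cases h : ∃ w, (w ≠ v₁ ∧ w ≠ v₂) ∧ G.Adj v w
      · obtain ⟨y, hy, hadj, hfy, hunique⟩ := hx h
        refine ⟨y, hadj, fun w hw hgw => ?_⟩
        rw [hg y hy.1 hy.2, hfy] at hgw
        have hw₁ : w ≠ v₁ := by grind
        have hw₂ : w ≠ v₂ := by grind
        exact hunique w ⟨hw₁, hw₂⟩ hw (by rw [← hgw, hg w hw₁ hw₂])
      · exact ⟨v₂, by grind⟩
    have havoid (w : V) (hw : G.Adj v w) : w ≠ v₁ ∧ w ≠ v₂ := by grind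
    obtain ⟨y, hy, hadj, hunique⟩ := hfree v ⟨hv₁, hv₂⟩ ⟨u, havoid u huv, huv⟩
    refine ⟨y, hadj, fun w hw hgw => ?_⟩
    have hw' := havoid w hw
    rw [hg y hy.1 hy.2, hg w hw'.1 hw'.2] at hgw
    exact hunique w hw' hw hgw
end

section
/- For every integer c ≥ 4, a c-PCF-critical graph G contains no path u₁v₁v₂v₃v₄u₂ in which v₁, v₂, v₃, v₄ all have degree 2 in G and u₁ ≠ u₂; that is, every 4-thread of G lies on an induced 5-cycle. -/
open SimpleGraph

/-- Colors for a path `x₁x₂x₃x₄` of degree-two vertices whose ends attach to vertices colored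
`p` and `q`, where `x₁` has to avoid `a` and `x₄` has to avoid `b`. -/
lemma exists_four_thread_colors {c : ℕ} (hc : 4 ≤ c) (p q a b : Fin c) :
    ∃ x₁ x₂ x₃ x₄ : Fin c, x₁ ≠ p ∧ x₁ ≠ a ∧ x₂ ≠ p ∧ x₁ ≠ x₂ ∧ x₁ ≠ x₃ ∧ x₂ ≠ x₃ ∧
      x₂ ≠ x₄ ∧ x₃ ≠ x₄ ∧ x₃ ≠ q ∧ x₄ ≠ q ∧ x₄ ≠ b := by
  have avoid : ∀ s : Finset (Fin c), s.card < 4 → ∃ x, x ∉ s := fun s hs =>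
    Finset.exists_mem_notMem_of_card_lt_card (s := s) (t := Finset.univ)
      (by simpa using hs.trans_le hc) |>.imp fun _ h => h.2
  by_cases hr : ∃ r, r ∉ ({p, q, a, b} : Finset (Fin c))
  · obtain ⟨r, hr⟩ := hr
    by_cases hpq : p = q
    · obtain ⟨y, hy⟩ := avoid {p, r} (Finset.card_le_two.trans_lt (by norm_num))
      obtain ⟨z, hz⟩ := avoid {p, r, y} (Finset.card_le_three.trans_lt (by norm_num))
      refine ⟨r, y, z, r, ?_⟩
      simp only [Finset.mem_insert, Finset.mem_singleton] at hr hy hz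
      grind
    · refine ⟨r, q, p, r, ?_⟩
      simp only [Finset.mem_insert, Finset.mem_singleton] at hr
      grind
  · have hcard : ({p, q, a, b} : Finset (Fin c)).card = 4 := by
      refine le_antisymm Finset.card_le_four ?_
      by_contra h
      exact hr (avoid _ (not_le.mp h))
    refine ⟨q, a, b, p, ?_⟩
    have hne : (p ≠ q ∧ p ≠ a ∧ p ≠ b) ∧ (q ≠ a ∧ q ≠ b) ∧ a ≠ b := by
      refine ⟨⟨?_, ?_, ?_⟩, ⟨?_, ?_⟩, ?_⟩ <;> rintro rfl <;> revert hcard <;>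
        simpa [Finset.insert_comm] using (Finset.card_le_three.trans_lt (by norm_num)).ne
    grind

/-- A vertex of degree two has no neighbors besides two given distinct ones. -/
lemma SimpleGraph.Adj.eq_or_eq_of_degree_eq_two {V : Type*} {G : SimpleGraph V} {v a b w : V}
    [Fintype (G.neighborSet v)] (hd : G.degree v = 2) (ha : G.Adj v a) (hb : G.Adj v b)
    (hab : a ≠ b) (hw : G.Adj v w) : w = a ∨ w = b := by
  classical
  have h : ({a, b} : Finset V) = G.neighborFinset v :=
    Finset.eq_of_subset_of_card_le (by simp [Finset.insert_subset_iff, ha, hb])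
      (by rw [G.card_neighborFinset_eq_degree, hd, Finset.card_pair hab])
  have : w ∈ ({a, b} : Finset V) := h ▸ (G.mem_neighborFinset v w).2 hw
  simpa using this

/-- In a critical graph, deleting a nonempty vertex set `S` leaves a PCF-colorable graph; the
coloring is extended arbitrarily to `S`. -/
lemma PCFCritical.exists_coloring_off {V : Type*} {G : SimpleGraph V} {c : ℕ} (hc : 0 < c)
    (hG : PCFCritical G c) {S : Set V} (hS : S.Nonempty) :
    ∃ f : V → Fin c, (∀ u ∉ S, ∀ v ∉ S, G.Adj u v → f u ≠ f v) ∧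
      ∀ v ∉ S, (∃ u ∉ S, G.Adj v u) →
        ∃ u ∉ S, G.Adj v u ∧ ∀ w ∉ S, G.Adj v w → f w = f u → w = u := by
  classical
  let H : G.Subgraph := (⊤ : G.Subgraph).induce Sᶜ
  have hH : H ≠ ⊤ := fun h => by
    obtain ⟨x, hx⟩ := hS
    have : x ∈ H.verts := h ▸ Set.mem_univ x
    exact this hx
  obtain ⟨f, hf, hcf⟩ := hG.2 H hH
  have hadj : ∀ u v : H.verts, H.coe.Adj u v ↔ G.Adj u v := fun u v => by
    have hu : (u : V) ∉ S := u.2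
    have hv : (v : V) ∉ S := v.2
    simp [H, hu, hv]
  refine ⟨fun v => if h : v ∈ H.verts then f ⟨v, h⟩ else ⟨0, hc⟩, ?_, ?_⟩
  · intro u hu v hv huv
    have hu' : u ∈ H.verts := hu
    have hv' : v ∈ H.verts := hv
    simpa only [hu', hv', dif_pos] using hf ((hadj ⟨u, hu'⟩ ⟨v, hv'⟩).2 huv)
  · rintro v hv ⟨u, hu, hvu⟩
    obtain ⟨t, hvt, ht⟩ := hcf ⟨v, hv⟩ ⟨⟨u, hu⟩, (hadj _ _).2 hvu⟩
    refine ⟨t, t.2, (hadj _ _).1 hvt, fun w hw hvw hwt => ?_⟩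
    have hw' : w ∈ H.verts := hw
    simp only [hw', t.2, dif_pos] at hwt
    exact congrArg Subtype.val (ht ⟨w, hw'⟩ ((hadj _ _).2 hvw) hwt)

/-- For every integer `c ≥ 4`, a `c`-PCF-critical graph contains no path
`u₁v₁v₂v₃v₄u₂` in which `v₁, v₂, v₃, v₄` all have degree `2` and `u₁ ≠ u₂`. -/
theorem no_four_thread {c : ℕ} (hc : 4 ≤ c) {V : Type*} [Fintype V]
    (G : SimpleGraph V) [DecidableRel G.Adj] (hG : PCFCritical G c) :
    ¬ ∃ u₁ v₁ v₂ v₃ v₄ u₂ : V,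
      u₁ ≠ v₂ ∧ u₁ ≠ v₃ ∧ u₁ ≠ v₄ ∧ u₁ ≠ u₂ ∧
      v₁ ≠ v₃ ∧ v₁ ≠ v₄ ∧ v₁ ≠ u₂ ∧
      v₂ ≠ v₄ ∧ v₂ ≠ u₂ ∧ v₃ ≠ u₂ ∧
      G.Adj u₁ v₁ ∧ G.Adj v₁ v₂ ∧ G.Adj v₂ v₃ ∧ G.Adj v₃ v₄ ∧ G.Adj v₄ u₂ ∧
      G.degree v₁ = 2 ∧ G.degree v₂ = 2 ∧ G.degree v₃ = 2 ∧ G.degree v₄ = 2 := by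
  classical
  rintro ⟨u₁, v₁, v₂, v₃, v₄, u₂, h12, h13, h14, hu, k13, k14, k1u, k24, k2u, k3u,
    e1, e2, e3, e4, e5, d1, d2, d3, d4⟩
  have n1 := fun w => SimpleGraph.Adj.eq_or_eq_of_degree_eq_two (w := w) d1 e1.symm e2 h12
  have n2 := fun w => SimpleGraph.Adj.eq_or_eq_of_degree_eq_two (w := w) d2 e2.symm e3 k13
  have n3 := fun w => SimpleGraph.Adj.eq_or_eq_of_degree_eq_two (w := w) d3 e3.symm e4 k24
  have n4 := fun w => SimpleGraph.Adj.eq_or_eq_of_degree_eq_two (w := w) d4 e4.symm e5 k3u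
  obtain ⟨f, hf, hcf⟩ := hG.exists_coloring_off (S := {v₁, v₂, v₃, v₄}) (by omega) ⟨v₁, by simp⟩
  -- each vertex off the thread comes with a color whose avoidance preserves its condition
  have key : ∀ v ∉ ({v₁, v₂, v₃, v₄} : Set V), ∃ a : Fin c,
      (∃ u ∉ ({v₁, v₂, v₃, v₄} : Set V), G.Adj v u) →
        ∃ u ∉ ({v₁, v₂, v₃, v₄} : Set V), G.Adj v u ∧ f u = a ∧
          ∀ w ∉ ({v₁, v₂, v₃, v₄} : Set V), G.Adj v w → f w = f u → w = u := by
    intro v hv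
    by_cases h : ∃ u ∉ ({v₁, v₂, v₃, v₄} : Set V), G.Adj v u
    · obtain ⟨u, hu, hvu, hw⟩ := hcf v hv h
      exact ⟨f u, fun _ => ⟨u, hu, hvu, rfl, hw⟩⟩
    · exact ⟨f v, fun h' => absurd h' h⟩
  have m1 : u₁ ∉ ({v₁, v₂, v₃, v₄} : Set V) := by simp [e1.ne, h12, h13, h14]
  have m2 : u₂ ∉ ({v₁, v₂, v₃, v₄} : Set V) := by
    simp [e5.ne.symm, k1u.symm, k2u.symm, k3u.symm]
  obtain ⟨a, ha⟩ := key u₁ m1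
  obtain ⟨b, hb⟩ := key u₂ m2
  obtain ⟨x₁, x₂, x₃, x₄, p1, p2, p3, p4, p5, p6, p7, p8, p9, p10, p11⟩ :=
    exists_four_thread_colors hc (f u₁) (f u₂) a b
  let g : V → Fin c := fun v =>
    if v = v₁ then x₁ else if v = v₂ then x₂ else if v = v₃ then x₃ else if v = v₄ then x₄
    else f v
  have g1 : g v₁ = x₁ := by simp [g]
  have g2 : g v₂ = x₂ := by simp [g, e2.ne.symm]
  have g3 : g v₃ = x₃ := by simp [g, e3.ne.symm, k13.symm]
  have g4 : g v₄ = x₄ := by simp [g, e4.ne.symm, k14.symm, k24.symm]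
  have gf : ∀ v ∉ ({v₁, v₂, v₃, v₄} : Set V), g v = f v := by
    intro v hv
    simp only [Set.mem_insert_iff, Set.mem_singleton_iff, not_or] at hv
    simp [g, hv]
  have gu1 := gf u₁ m1
  have gu2 := gf u₂ m2
  have thread : ∀ v ∈ ({v₁, v₂, v₃, v₄} : Set V), ∀ w, G.Adj v w → g v ≠ g w := by
    intro v hv w hvw
    simp only [Set.mem_insert_iff, Set.mem_singleton_iff] at hv
    grind
  refine hG.1 ⟨g, fun v w hvw => ?_, fun v hv => ?_⟩
  · by_cases hv : v ∈ ({v₁, v₂, v₃, v₄} : Set V)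
    · exact thread v hv w hvw
    by_cases hw : w ∈ ({v₁, v₂, v₃, v₄} : Set V)
    · exact (thread w hw v hvw.symm).symm
    rw [gf v hv, gf w hw]
    exact hf v hv w hw hvw
  · by_cases hvS : v ∈ ({v₁, v₂, v₃, v₄} : Set V)
    · simp only [Set.mem_insert_iff, Set.mem_singleton_iff] at hvS
      rcases hvS with rfl | rfl | rfl | rfl
      · exact ⟨_, e2, by grind⟩
      · exact ⟨_, e3, by grind⟩
      · exact ⟨_, e4, by grind⟩
      · exact ⟨_, e5, by grind⟩
    -- a neighbor on the thread of a vertex off the thread is one of the two attachments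
    have attach : ∀ w ∈ ({v₁, v₂, v₃, v₄} : Set V), G.Adj v w →
        (v = u₁ ∧ w = v₁) ∨ (v = u₂ ∧ w = v₄) := by
      intro w hw hvw
      have hwv := hvw.symm
      simp only [Set.mem_insert_iff, Set.mem_singleton_iff] at hw hvS
      grind
    by_cases hN : ∃ u ∉ ({v₁, v₂, v₃, v₄} : Set V), G.Adj v u
    · obtain ⟨u, huS, hvu, huw, huc⟩ : ∃ u ∉ ({v₁, v₂, v₃, v₄} : Set V), G.Adj v u ∧
          (∀ w ∉ ({v₁, v₂, v₃, v₄} : Set V), G.Adj v w → f w = f u → w = u) ∧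
          (v = u₁ → f u = a) ∧ (v = u₂ → f u = b) := by
        by_cases hv1 : v = u₁
        · subst hv1
          obtain ⟨u, h1, h2, h3, h4⟩ := ha hN
          exact ⟨u, h1, h2, h4, fun _ => h3, fun h => absurd h hu⟩
        by_cases hv2 : v = u₂
        · subst hv2
          obtain ⟨u, h1, h2, h3, h4⟩ := hb hN
          exact ⟨u, h1, h2, h4, fun h => absurd h hv1, fun _ => h3⟩
        obtain ⟨u, h1, h2, h3⟩ := hcf v hvS hN
        exact ⟨u, h1, h2, h3, fun h => absurd h hv1, fun h => absurd h hv2⟩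
      refine ⟨u, hvu, fun w hvw hwu => ?_⟩
      rw [gf u huS] at hwu
      by_cases hw : w ∈ ({v₁, v₂, v₃, v₄} : Set V)
      · rcases attach w hw hvw with ⟨rfl, rfl⟩ | ⟨rfl, rfl⟩
        · exact absurd (g1.symm.trans (hwu.trans (huc.1 rfl))) p2
        · exact absurd (g4.symm.trans (hwu.trans (huc.2 rfl))) p11
      · exact huw w hw hvw (gf w hw ▸ hwu)
    · push Not at hN
      obtain ⟨u, hvu⟩ := hv
      have mem : ∀ w, G.Adj v w → w ∈ ({v₁, v₂, v₃, v₄} : Set V) :=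
        fun w hvw => by_contra fun h => hN w h hvw
      refine ⟨u, hvu, fun w hvw _ => ?_⟩
      have hw := attach w (mem w hvw) hvw
      have hu' := attach u (mem u hvu) hvu
      grind
end
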